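/- Let E_1, E_2 ⊆ P^2 be two smooth projective cubic curves over an algebraically closed field k, Y = C(E_1 × E_2) the affine cone over E_1 × E_2 under the Segre-induced embedding, and f : X → Y the blow up of Y along Z = C(E_1 × H) for a hyperplane section H ⊆ E_2. Then both X and Y are smooth in codimension 1 with trivial canonical divisor, and X is Gorenstein (hence Cohen–Macaulay). -/

import Mathlib

open AlgebraicGeometry CategoryTheory
open scoped KaehlerDifferential TensorProduct Polynomial

universe u

noncomputable section

namespace EllipticCone

/-! ### Plane cubics, Segre products and affine cones -/

/-- `F` is the equation of a smooth cubic curve in `ℙ²` over an algebraically closed field: a cubic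
form such that at no point of `ℙ²` the form and all its first partial derivatives vanish. -/
structure IsSmoothPlaneCubic {k : Type u} [Field k] (F : MvPolynomial (Fin 3) k) : Prop where
  isHomogeneous : F.IsHomogeneous 3
  smooth : ∀ p : Fin 3 → k, p ≠ 0 → MvPolynomial.eval p F = 0 →
    ∃ i, MvPolynomial.eval p (MvPolynomial.pderiv i F) ≠ 0

section Segre

variable {k : Type u} [Field k] {σ τ : Type} (𝔞 : Ideal (MvPolynomial σ k))
  (𝔟 : Ideal (MvPolynomial τ k))

/-- The coordinate ring of the product of the affine schemes `V(𝔞)` and `V(𝔟)`. -/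
abbrev ProdRing : Type u := (MvPolynomial σ k ⧸ 𝔞) ⊗[k] (MvPolynomial τ k ⧸ 𝔟)

/-- The function `x_i y_j` on `V(𝔞) × V(𝔟)`. -/
def segreCoord (ij : σ × τ) : ProdRing 𝔞 𝔟 :=
  Ideal.Quotient.mk 𝔞 (MvPolynomial.X ij.1) ⊗ₜ[k] Ideal.Quotient.mk 𝔟 (MvPolynomial.X ij.2)

/-- The comorphism `z_ij ↦ x_i y_j` of `(x, y) ↦ (x_i y_j)`. -/
def segreHom : MvPolynomial (σ × τ) k →ₐ[k] ProdRing 𝔞 𝔟 :=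
  MvPolynomial.aeval (segreCoord 𝔞 𝔟)

/-- Let `V`, `W` be the closed subschemes of projective space defined by the homogeneous ideals
`𝔞`, `𝔟`. This is the homogeneous ideal of `V × W` in the Segre embedding, that is, the ideal of
the affine cone `C(V × W)`: it consists of the polynomials `f` in the variables `z_ij` such that
`f(x_i y_j)` vanishes on `(C(V) ∖ 0) × (C(W) ∖ 0)`. The latter scheme is covered by the open sets
`x_i y_j ≠ 0`. (No saturation hypothesis on `𝔞`, `𝔟` is needed.) -/
def segreConeIdeal : Ideal (MvPolynomial (σ × τ) k) :=
  ⨅ ij : σ × τ, RingHom.ker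
    ((IsScalarTower.toAlgHom k (ProdRing 𝔞 𝔟) (Localization.Away (segreCoord 𝔞 𝔟 ij))).comp
      (segreHom 𝔞 𝔟))

/-- The affine coordinate ring of the cone `C(V × W)`. -/
abbrev SegreConeRing : Type u := MvPolynomial (σ × τ) k ⧸ segreConeIdeal 𝔞 𝔟

end Segre

/-! ### Blow-ups of affine schemes -/

section BlowUp

variable {R : Type u} [CommRing R] (I : Ideal R)

/-- The component `I ^ d` of degree `d` of the Rees algebra `⨁ I ^ d`. -/
def reesGrading (d : ℕ) : Submodule R (reesAlgebra I) where
  carrier := {f | ∀ i, i ≠ d → (f : R[X]).coeff i = 0}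
  add_mem' hf hg i hi := by simp [hf i hi, hg i hi]
  zero_mem' i _ := by simp
  smul_mem' r f hf i hi := by simp [hf i hi]

/-- The component of degree `d` of an element of the Rees algebra. -/
def reesComponent (d : ℕ) : reesAlgebra I →ₗ[R] reesGrading I d where
  toFun f := ⟨⟨Polynomial.monomial d ((f : R[X]).coeff d),
    reesAlgebra.monomial_mem.mpr (f.2 d)⟩, fun _ hi => Polynomial.coeff_monomial_of_ne _ hi⟩
  map_add' f g := by
    ext : 2
    simp
  map_smul' r f := by
    ext : 2
    simp [Polynomial.smul_monomial]

instance reesGrading.gradedAlgebra : GradedAlgebra (reesGrading I) where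
  one_mem i hi := by simp [Polynomial.coeff_one, hi]
  mul_mem := by
    intro a b f g hf hg i hi
    change ((f : R[X]) * (g : R[X])).coeff i = 0
    rw [Polynomial.coeff_mul]
    refine Finset.sum_eq_zero fun x hx => ?_
    have hx := Finset.HasAntidiagonal.mem_antidiagonal.mp hx
    by_cases h1 : x.1 = a
    · rw [hg x.2 (by omega), mul_zero]
    · rw [hf x.1 h1, zero_mul]
  decompose' f := ∑ d ∈ (f : R[X]).support, DirectSum.of _ d (reesComponent I d f)
  left_inv f := by
    rw [map_sum]
    ext1
    simp only [DirectSum.coeAddMonoidHom_of, AddSubmonoidClass.coe_finsetSum]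
    exact (Polynomial.as_sum_support (f : R[X])).symm
  right_inv f := by
    have key : ∀ (f : reesAlgebra I) (s : Finset ℕ), (f : R[X]).support ⊆ s →
        ∑ d ∈ (f : R[X]).support, DirectSum.of (fun i => reesGrading I i) d (reesComponent I d f) =
          ∑ d ∈ s, DirectSum.of (fun i => reesGrading I i) d (reesComponent I d f) := by
      intro f s hs
      refine Finset.sum_subset hs fun d _ hd => ?_
      have : reesComponent I d f = 0 := by
        ext : 2
        simp [reesComponent, Polynomial.notMem_support_iff.mp hd]
      rw [this, map_zero]
    induction f using DirectSum.induction_on with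
    | zero => simp
    | of d x =>
      rw [DirectSum.coeAddMonoidHom_of]
      refine (key _ {d} ?_).trans ?_
      rotate_left
      · rw [Finset.sum_singleton]
        congr 1
        ext i
        by_cases h : i = d
        · subst h
          simp [reesComponent]
        · simp [reesComponent, Polynomial.coeff_monomial_of_ne _ h, x.2 i h]
      · intro i hi
        rw [Polynomial.mem_support_iff] at hi
        by_contra h
        exact hi (x.2 i (by simpa using h))
    | add f g hf hg =>
      set f' := DirectSum.coeAddMonoidHom (reesGrading I) f
      set g' := DirectSum.coeAddMonoidHom (reesGrading I) g
      rw [map_add]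
      refine Eq.trans (key (f' + g') ((f' : R[X]).support ∪ (g' : R[X]).support) Polynomial.support_add) ?_
      have hf := (key f' ((f' : R[X]).support ∪ (g' : R[X]).support)
        Finset.subset_union_left).symm.trans hf
      have hg := (key g' ((f' : R[X]).support ∪ (g' : R[X]).support)
        Finset.subset_union_right).symm.trans hg
      rw [← hf, ← hg, ← Finset.sum_add_distrib]
      simp only [map_add]

/-- The blow-up of `Spec R` along the closed subscheme `V(I)`: `Proj ⨁ I ^ d`. -/
def blowUp : Scheme.{u} := Proj (reesGrading I)

/-- The blow-down morphism. -/
def blowUpMap : blowUp I ⟶ Spec (.of R) :=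
  Proj.toSpecZero (reesGrading I) ≫
    Spec.map (CommRingCat.ofHom (algebraMap R (reesGrading I 0)))

end BlowUp

/-! ### Smoothness in codimension one and canonical divisors -/

section Canonical

variable {k : Type u} [Field k] {X : Scheme.{u}} (s : X ⟶ Spec (.of k))

/-- The `k`-scheme `X` is smooth in codimension `1`: every point of codimension at most `1` has an
open neighbourhood that is smooth over `k`. -/
def SmoothInCodimOne : Prop :=
  ∀ x : X, Order.coheight x ≤ 1 → ∃ U : X.Opens, x ∈ U ∧ Smooth (U.ι ≫ s)

/-- The ring homomorphism `k → 𝒪_{X,x}` of a `k`-scheme. -/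
def scalarsToStalk (x : X) : k →+* X.presheaf.stalk x :=
  ((Scheme.ΓSpecIso (.of k)).inv ≫ s.appTop ≫ X.presheaf.germ ⊤ x trivial).hom

/-- Let `K` be an algebra over `k` and over a ring `O` (below: the function field
of a variety and the local ring at a point of codimension one), and let `ω ∈ ⋀ⁿ Ω_{K/k}`. Then
`ω` has neither zero nor pole along `O` if `O ω ⊆ ⋀ⁿ Ω_{K/k}` is the image of `⋀ⁿ Ω_{O/k}`, that is,
the `O`-submodule spanned by the forms `da₁ ∧ ⋯ ∧ daₙ` with `aᵢ ∈ O`. -/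
def HasOrderZero (k O K : Type u) [CommRing k] [CommRing O] [CommRing K] [Algebra k K] [Algebra O K]
    {n : ℕ} (ω : ⋀[K]^n Ω[K⁄k]) : Prop :=
  Submodule.span (algebraMap O K).range {ω} =
    Submodule.span (algebraMap O K).range (Set.range fun a : Fin n → O =>
      exteriorPower.ιMulti K n fun i => KaehlerDifferential.D k K (algebraMap O K (a i)))

/-- The canonical divisor (class) of a variety `X` that is smooth in codimension `1` is the class
of the Weil divisor of any nonzero rational differential form of top degree. So it is trivial if and
only if some nonzero rational top form has neither zeros nor poles in codimension one. Here `n` is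
the top degree, the rank of `Ω_{K(X)/k}`. -/
def HasTrivialCanonicalDivisor : Prop :=
  ∃ _ : IsIntegral X,
    letI : Algebra k X.functionField := (scalarsToStalk s (genericPoint X)).toAlgebra
    ∃ n : ℕ, Module.finrank X.functionField Ω[X.functionField⁄k] = n ∧
      ∃ ω : ⋀[X.functionField]^n Ω[X.functionField⁄k], ω ≠ 0 ∧
        ∀ x : X, Order.coheight x = 1 → HasOrderZero k (X.presheaf.stalk x) X.functionField ω

end Canonical

/-! ### Gorenstein and Cohen–Macaulay schemes -/

/-- A Gorenstein local ring: a Noetherian local ring of finite injective dimension over itself. -/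
structure IsGorensteinLocalRing (R : Type u) [CommRing R] : Prop where
  isLocalRing : IsLocalRing R
  isNoetherianRing : IsNoetherianRing R
  finite_injectiveDimension : ∃ n : ℕ, HasInjectiveDimensionLE (ModuleCat.of R R) n

/-- A Cohen–Macaulay local ring: a Noetherian local ring with a regular sequence whose length is
the dimension. -/
structure IsCohenMacaulayLocalRing (R : Type u) [CommRing R] : Prop where
  isLocalRing : IsLocalRing R
  isNoetherianRing : IsNoetherianRing R
  exists_isRegular : ∃ rs : List R,
    RingTheory.Sequence.IsRegular R rs ∧ (rs.length : WithBot ℕ∞) = ringKrullDim R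

/-- A scheme is Gorenstein if it is locally Noetherian with Gorenstein local rings. -/
structure IsGorenstein (X : Scheme.{u}) : Prop where
  isLocallyNoetherian : IsLocallyNoetherian X
  stalk : ∀ x : X, IsGorensteinLocalRing (X.presheaf.stalk x)

/-- A scheme is Cohen–Macaulay if it is locally Noetherian with Cohen–Macaulay local rings. -/
structure IsCohenMacaulay (X : Scheme.{u}) : Prop where
  isLocallyNoetherian : IsLocallyNoetherian X
  stalk : ∀ x : X, IsCohenMacaulayLocalRing (X.presheaf.stalk x)

/-! ### The objects of the theorem -/

section Objects

variable {k : Type u} [Field k] (F₁ F₂ ℓ : MvPolynomial (Fin 3) k)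

/-- The affine coordinate ring of the cone `Y = C(E₁ × E₂) ⊆ 𝔸⁹`, where `E_i = V(F_i) ⊆ ℙ²`. -/
abbrev coneRing : Type u := SegreConeRing (Ideal.span {F₁}) (Ideal.span {F₂})

/-- The cone `Y = C(E₁ × E₂)`. -/
def coneY : Scheme.{u} := Spec (.of (coneRing F₁ F₂))

/-- The structure morphism of `Y`. -/
def coneY.toSpec : coneY F₁ F₂ ⟶ Spec (.of k) :=
  Spec.map (CommRingCat.ofHom (algebraMap k (coneRing F₁ F₂)))

/-- The ideal in the coordinate ring of `Y` of the cone `Z = C(E₁ × H)`, where `H ⊆ E₂` is the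
hyperplane section (as a scheme) by the line `ℓ = 0`. -/
def idealZ : Ideal (coneRing F₁ F₂) :=
  (segreConeIdeal (Ideal.span {F₁}) (Ideal.span {F₂, ℓ})).map (Ideal.Quotient.mk _)

/-- The blow-up `X` of `Y` along `Z`. -/
def blowUpX : Scheme.{u} := blowUp (idealZ F₁ F₂ ℓ)

/-- The blow-down morphism `f : X ⟶ Y`. -/
def blowDown : blowUpX F₁ F₂ ℓ ⟶ coneY F₁ F₂ := blowUpMap (idealZ F₁ F₂ ℓ)

/-- The structure morphism of `X`. -/
def blowUpX.toSpec : blowUpX F₁ F₂ ℓ ⟶ Spec (.of k) := blowDown F₁ F₂ ℓ ≫ coneY.toSpec F₁ F₂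

end Objects

end EllipticCone

end

noncomputable section

namespace EllipticCone

/-! ### Injective dimension of modules -/

section InjectiveDimension

variable (R : Type u) [CommRing R] (M : Type u) [AddCommGroup M] [Module R M]

/-- The `R`-module `M` has injective dimension at most `n`. -/
def InjDimLE (n : ℕ) : Prop := HasInjectiveDimensionLE (ModuleCat.of R M) n

variable {R M}

theorem injDimLE_zero_iff : InjDimLE R M 0 ↔ Module.Injective R M := by
  rw [InjDimLE, HasInjectiveDimensionLE, zero_add, ← injective_iff_hasInjectiveDimensionLT_one,
    Module.injective_iff_injective_object]

theorem InjDimLE.mono {m n : ℕ} (h : InjDimLE R M m) (hmn : m ≤ n) : InjDimLE R M n :=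
  have : HasInjectiveDimensionLT (ModuleCat.of R M) (m + 1) := h
  hasInjectiveDimensionLT_of_ge _ (m + 1) (n + 1) (by omega)

variable (R M) in
theorem exists_injective_embedding :
    ∃ (I : Type u) (_ : AddCommGroup I) (_ : Module R I) (f : M →ₗ[R] I),
      Module.Injective R I ∧ Function.Injective f := by
  let ⟨I, _, f, _⟩ := EnoughInjectives.presentation (ModuleCat.of R M)
  exact ⟨I, inferInstance, inferInstance, f.hom, Module.injective_module_of_injective_object R I,
    (ModuleCat.mono_iff_injective f).mp ‹_›⟩

section Exact

variable {N P : Type u} [AddCommGroup N] [Module R N] [AddCommGroup P] [Module R P]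
  {f : M →ₗ[R] N} {g : N →ₗ[R] P}

theorem shortExact_of_exact (hf : Function.Injective f) (hfg : Function.Exact f g)
    (hg : Function.Surjective g) :
    (ModuleCat.shortComplexOfCompEqZero f g hfg.linearMap_comp_eq_zero).ShortExact :=
  ModuleCat.shortComplex_shortExact _ hfg hf hg

theorem injDimLE_left {n : ℕ} (hf : Function.Injective f) (hfg : Function.Exact f g)
    (hg : Function.Surjective g) (hN : InjDimLE R N (n + 1)) (hP : InjDimLE R P n) :
    InjDimLE R M (n + 1) :=
  (shortExact_of_exact hf hfg hg).hasInjectiveDimensionLT_X₁ (n + 1) hP hN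

theorem injDimLE_right {n : ℕ} (hf : Function.Injective f) (hfg : Function.Exact f g)
    (hg : Function.Surjective g) (hM : InjDimLE R M (n + 1)) (hN : InjDimLE R N n) :
    InjDimLE R P n :=
  (shortExact_of_exact hf hfg hg).hasInjectiveDimensionLT_X₃ (n + 1) hN hM

end Exact

/-- Dimension shifting: a module of injective dimension at most `n + 1` embeds into an injective
module with cokernel of injective dimension at most `n`. -/
theorem InjDimLE.exists_cokernel {n : ℕ} (h : InjDimLE R M (n + 1)) :
    ∃ (I : Type u) (_ : AddCommGroup I) (_ : Module R I) (f : M →ₗ[R] I),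
      Module.Injective R I ∧ Function.Injective f ∧ InjDimLE R (I ⧸ f.range) n := by
  obtain ⟨I, _, _, f, hI, hf⟩ := exists_injective_embedding R M
  exact ⟨I, _, _, f, hI, hf, injDimLE_right hf f.exact_map_mkQ_range
    (Submodule.mkQ_surjective _) h ((injDimLE_zero_iff.mpr hI).mono (Nat.zero_le _))⟩

/-! ### Injective dimension modulo a nonzerodivisor -/

section Quotient

variable (x : R)

/-- The map induced on `x`-torsion. -/
def torsionMap {N : Type u} [AddCommGroup N] [Module R N] (f : M →ₗ[R] N) :
    Submodule.torsionBy R M x →ₗ[R ⧸ Ideal.span {x}] Submodule.torsionBy R N x where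
  toFun m := ⟨f m, by
    rw [Submodule.mem_torsionBy_iff, ← map_smul, Submodule.smul_coe_torsionBy, map_zero]⟩
  map_add' a b := by ext; simp
  map_smul' r a := by
    obtain ⟨r, rfl⟩ := Ideal.Quotient.mk_surjective r
    ext
    simp

@[simp]
theorem coe_torsionMap {N : Type u} [AddCommGroup N] [Module R N] (f : M →ₗ[R] N)
    (m : Submodule.torsionBy R M x) : (torsionMap x f m : N) = f m := rfl

theorem injective_torsionBy [Module.Injective R M] :
    Module.Injective (R ⧸ Ideal.span {x}) (Submodule.torsionBy R M x) where
  out X Y _ _ _ _ f hf g := by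
    let _ : Module R X := Module.compHom X (Ideal.Quotient.mk (Ideal.span {x}))
    let _ : Module R Y := Module.compHom Y (Ideal.Quotient.mk (Ideal.span {x}))
    have hX (r : R) (a : X) : r • a = Ideal.Quotient.mk (Ideal.span {x}) r • a := rfl
    have hY (r : R) (a : Y) : r • a = Ideal.Quotient.mk (Ideal.span {x}) r • a := rfl
    let f' : X →ₗ[R] Y :=
      { toFun := f
        map_add' := map_add f
        map_smul' := fun r a => by simp [hX, hY] }
    let g' : X →ₗ[R] M :=
      { toFun := fun a => g a
        map_add' := fun a b => by simp
        map_smul' := fun r a => by simp [hX] }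
    obtain ⟨h, hh⟩ := Module.Injective.out f' hf g'
    refine ⟨{ toFun := fun y => ⟨h y, ?_⟩, map_add' := fun a b => ?_, map_smul' := fun r a => ?_ },
      fun a => ?_⟩
    · rw [Submodule.mem_torsionBy_iff, ← map_smul, hY,
        Ideal.Quotient.eq_zero_iff_mem.mpr (Ideal.mem_span_singleton_self x), zero_smul, map_zero]
    · ext; simp
    · obtain ⟨r, rfl⟩ := Ideal.Quotient.mk_surjective r
      ext
      simp [← hY]
    · ext
      exact hh a

/-- An injective module is divisible by nonzerodivisors. -/
theorem smul_surjective_of_injective [Module.Injective R M] (hx : x ∈ nonZeroDivisors R) (m : M) :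
    ∃ m', x • m' = m := by
  have hinj : Function.Injective (LinearMap.mulLeft R x) := fun a b hab =>
    (mul_cancel_left_mem_nonZeroDivisors hx).mp hab
  obtain ⟨h, hh⟩ := Module.Injective.out (LinearMap.mulLeft R x) hinj
    (LinearMap.toSpanSingleton R M m)
  refine ⟨h 1, ?_⟩
  have := hh 1
  simp only [LinearMap.mulLeft_apply, mul_one, LinearMap.toSpanSingleton_apply, one_smul] at this
  rw [← map_smul, smul_eq_mul, mul_one, this]

theorem InjDimLE.torsionBy {n : ℕ} (hx : x ∈ nonZeroDivisors R) (h : InjDimLE R M n)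
    (hM : ∀ m : M, ∃ m', x • m' = m) : InjDimLE (R ⧸ Ideal.span {x}) (Submodule.torsionBy R M x) n := by
  induction n generalizing M with
  | zero =>
    have := injDimLE_zero_iff.mp h
    exact injDimLE_zero_iff.mpr (injective_torsionBy x)
  | succ n ih =>
    obtain ⟨I, _, _, f, hI, hf, hC⟩ := h.exists_cokernel
    have hC' := ih hC (fun c => by
      obtain ⟨i, rfl⟩ := Submodule.mkQ_surjective _ c
      obtain ⟨i', rfl⟩ := smul_surjective_of_injective x hx i
      exact ⟨f.range.mkQ i', by simp⟩)
    refine injDimLE_left (f := torsionMap x f) (g := torsionMap x f.range.mkQ) ?_ ?_ ?_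
      ((injDimLE_zero_iff.mpr (injective_torsionBy x)).mono (Nat.zero_le _)) hC'
    · intro a b hab
      exact Subtype.ext (hf (congrArg Subtype.val hab))
    · intro i
      constructor
      · intro hi
        have hi' : (f.range.mkQ (i : I)) = 0 := congrArg Subtype.val hi
        rw [Submodule.mkQ_apply, Submodule.Quotient.mk_eq_zero] at hi'
        obtain ⟨m, hm⟩ := hi'
        refine ⟨⟨m, ?_⟩, Subtype.ext hm⟩
        rw [Submodule.mem_torsionBy_iff]
        apply hf
        rw [map_smul, hm, map_zero, Submodule.smul_coe_torsionBy]
      · rintro ⟨m, rfl⟩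
        ext
        simp
    · rintro ⟨c, hc⟩
      obtain ⟨i, rfl⟩ := Submodule.mkQ_surjective _ c
      rw [Submodule.mem_torsionBy_iff, ← map_smul, Submodule.mkQ_apply,
        Submodule.Quotient.mk_eq_zero] at hc
      obtain ⟨m, hm⟩ := hc
      obtain ⟨m', rfl⟩ := hM m
      refine ⟨⟨i - f m', ?_⟩, ?_⟩
      · rw [Submodule.mem_torsionBy_iff, smul_sub, ← hm, map_smul, sub_self]
      · ext
        simp

/-- If `R` has finite injective dimension over itself, then so has `R ⧸ (x)` for every
nonzerodivisor `x`. -/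
theorem exists_injDimLE_quotient (hx : x ∈ nonZeroDivisors R) (h : ∃ n, InjDimLE R R n) :
    ∃ n, InjDimLE (R ⧸ Ideal.span {x}) (R ⧸ Ideal.span {x}) n := by
  obtain ⟨n, hn⟩ := h
  obtain ⟨I, _, _, f, hI, hf, hC⟩ := (hn.mono (Nat.le_succ n)).exists_cokernel
  have hdiv (c : I ⧸ f.range) : ∃ c', x • c' = c := by
    obtain ⟨i, rfl⟩ := Submodule.mkQ_surjective _ c
    obtain ⟨i', rfl⟩ := smul_surjective_of_injective x hx i
    exact ⟨f.range.mkQ i', by simp⟩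
  have hC' := InjDimLE.torsionBy x hx hC hdiv
  -- the connecting map `C[x] → R ⧸ (x)` is described by its inverse relation
  have key (c : Submodule.torsionBy R (I ⧸ f.range) x) :
      ∃ r : R, ∃ i : I, f.range.mkQ i = c ∧ f r = x • i := by
    obtain ⟨c, hc⟩ := c
    obtain ⟨i, rfl⟩ := Submodule.mkQ_surjective _ c
    rw [Submodule.mem_torsionBy_iff, ← map_smul, Submodule.mkQ_apply,
      Submodule.Quotient.mk_eq_zero] at hc
    obtain ⟨r, hr⟩ := hc
    exact ⟨r, i, rfl, hr⟩
  have uniq (r r' : R) (i i' : I) (hi : f.range.mkQ i = f.range.mkQ i') (hr : f r = x • i)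
      (hr' : f r' = x • i') :
      Ideal.Quotient.mk (Ideal.span {x}) r = Ideal.Quotient.mk (Ideal.span {x}) r' := by
    rw [← sub_eq_zero, ← map_sub, Submodule.mkQ_apply, Submodule.Quotient.mk_eq_zero] at hi
    obtain ⟨s, hs⟩ := hi
    rw [Ideal.Quotient.eq, Ideal.mem_span_singleton]
    refine ⟨s, hf ?_⟩
    rw [map_sub, hr, hr', ← smul_sub, ← hs, ← map_smul, smul_eq_mul]
  choose r i hi hr using key
  let δ : Submodule.torsionBy R (I ⧸ f.range) x →ₗ[R ⧸ Ideal.span {x}] R ⧸ Ideal.span {x} :=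
    { toFun := fun c => Ideal.Quotient.mk _ (r c)
      map_add' := fun c c' => by
        rw [← map_add]
        refine uniq _ _ (i (c + c')) (i c + i c') ?_ (hr _) ?_
        · rw [map_add, hi, hi, hi]; rfl
        · rw [map_add, hr, hr, smul_add]
      map_smul' := fun q c => by
        obtain ⟨q, rfl⟩ := Ideal.Quotient.mk_surjective q
        rw [RingHom.id_apply, smul_eq_mul, ← map_mul]
        refine uniq _ _ (i _) (q • i c) ?_ (hr _) ?_
        · rw [map_smul, hi, hi, Submodule.torsionBy.mk_ideal_smul]; rfl
        · rw [← smul_eq_mul, map_smul, hr, smul_comm] }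
  refine ⟨n, injDimLE_right (f := torsionMap x f.range.mkQ) (g := δ) ?_ ?_ ?_
    ((injDimLE_zero_iff.mpr (injective_torsionBy x)).mono (Nat.zero_le _)) hC'⟩
  · intro a b hab
    have hab' : f.range.mkQ (a : I) = f.range.mkQ b := congrArg Subtype.val hab
    rw [← sub_eq_zero, ← map_sub, Submodule.mkQ_apply, Submodule.Quotient.mk_eq_zero] at hab'
    obtain ⟨s, hs⟩ := hab'
    have : f (x * s) = 0 := by
      rw [← smul_eq_mul, map_smul, hs, smul_sub, Submodule.smul_coe_torsionBy,
        Submodule.smul_coe_torsionBy, sub_zero]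
    have hs0 : x * s = 0 := hf (by rw [this, map_zero])
    have hs0 : s = 0 := (mul_right_mem_nonZeroDivisors_eq_zero_iff hx).mp (by rw [mul_comm, hs0])
    rw [hs0, map_zero] at hs
    exact Subtype.ext (sub_eq_zero.mp hs.symm)
  · intro c
    constructor
    · intro hc
      have hc : Ideal.Quotient.mk _ (r c) = 0 := hc
      rw [Ideal.Quotient.eq_zero_iff_mem, Ideal.mem_span_singleton] at hc
      obtain ⟨s, hs⟩ := hc
      refine ⟨⟨i c - f s, ?_⟩, ?_⟩
      · rw [Submodule.mem_torsionBy_iff, smul_sub, ← hr, hs, ← smul_eq_mul, map_smul, sub_self]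
      · ext
        rw [coe_torsionMap, map_sub, hi, sub_eq_self, Submodule.mkQ_apply,
          Submodule.Quotient.mk_eq_zero]
        exact ⟨s, rfl⟩
    · rintro ⟨a, rfl⟩
      refine (uniq _ 0 (i _) a (hi _) (hr _) ?_).trans (map_zero _)
      rw [map_zero, Submodule.smul_coe_torsionBy]
  · intro q
    obtain ⟨q, rfl⟩ := Ideal.Quotient.mk_surjective q
    obtain ⟨j, hj⟩ := smul_surjective_of_injective x hx (f q)
    refine ⟨⟨f.range.mkQ j, ?_⟩, ?_⟩
    · rw [Submodule.mem_torsionBy_iff, ← map_smul, hj, Submodule.mkQ_apply,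
        Submodule.Quotient.mk_eq_zero]
      exact ⟨q, rfl⟩
    · exact uniq _ _ _ j (hi _) (hr _) hj.symm

end Quotient

/-! ### Polynomial rings have finite injective dimension -/

section Polynomial

variable (R M) in
/-- The sequences in `M`, on which the polynomial variable acts by the shift. This is the
coextension of scalars `Hom_R(R[X], M)`. -/
abbrev ShiftModule : Type u := Module.AEval' (LinearMap.funLeft R M Nat.succ)

/-- The sequence as a function. -/
def ShiftModule.seq : ShiftModule R M ≃ₗ[R] (ℕ → M) :=
  (Module.AEval'.of (LinearMap.funLeft R M Nat.succ)).symm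

@[simp]
theorem ShiftModule.seq_X_smul (s : ShiftModule R M) (n : ℕ) :
    ShiftModule.seq ((Polynomial.X : R[X]) • s) n = ShiftModule.seq s (n + 1) := by
  obtain ⟨s, rfl⟩ := (Module.AEval'.of (LinearMap.funLeft R M Nat.succ)).surjective s
  rw [Module.AEval'.X_smul_of]
  rfl

/-- A map of `R`-modules that commutes with the variable is `R[X]`-linear. -/
def linearMapOfCommX {N P : Type u} [AddCommGroup N] [Module R N] [Module R[X] N]
    [IsScalarTower R R[X] N] [AddCommGroup P] [Module R P] [Module R[X] P]
    [IsScalarTower R R[X] P] (f : N →ₗ[R] P)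
    (hf : ∀ n, f ((Polynomial.X : R[X]) • n) = (Polynomial.X : R[X]) • f n) : N →ₗ[R[X]] P where
  toFun := f
  map_add' := map_add f
  map_smul' p n := by
    induction p using Polynomial.induction_on' with
    | add p q hp hq => simp only [add_smul, map_add, hp, hq, RingHom.id_apply]
    | monomial k a =>
      induction k generalizing n with
      | zero =>
        rw [RingHom.id_apply, Polynomial.monomial_zero_left, ← Polynomial.algebraMap_eq,
          algebraMap_smul, algebraMap_smul, map_smul]
      | succ k ih =>
        rw [← Polynomial.monomial_mul_X, mul_smul, ih, RingHom.id_apply, RingHom.id_apply, mul_smul, hf]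

/-- Functoriality of `ShiftModule`. -/
def ShiftModule.map {N : Type u} [AddCommGroup N] [Module R N] (f : M →ₗ[R] N) :
    ShiftModule R M →ₗ[R[X]] ShiftModule R N :=
  linearMapOfCommX
    (ShiftModule.seq.symm.toLinearMap ∘ₗ f.compLeft ℕ ∘ₗ ShiftModule.seq.toLinearMap) (fun s => by
      apply ShiftModule.seq.injective
      ext n
      simp)

@[simp]
theorem ShiftModule.seq_map {N : Type u} [AddCommGroup N] [Module R N] (f : M →ₗ[R] N)
    (s : ShiftModule R M) (n : ℕ) :
    ShiftModule.seq (ShiftModule.map f s) n = f (ShiftModule.seq s n) := by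
  simp [ShiftModule.map, linearMapOfCommX]

theorem ShiftModule.injective [Module.Injective R M] :
    Module.Injective R[X] (ShiftModule R M) where
  out X Y _ _ _ _ f hf g := by
    let _ : Module R X := Module.compHom X (algebraMap R R[X])
    let _ : Module R Y := Module.compHom Y (algebraMap R R[X])
    have : IsScalarTower R R[X] X := ⟨fun a b c => by
      rw [Algebra.smul_def, mul_smul]; rfl⟩
    have : IsScalarTower R R[X] Y := ⟨fun a b c => by
      rw [Algebra.smul_def, mul_smul]; rfl⟩
    obtain ⟨h, hh⟩ := Module.Injective.out (f.restrictScalars R) hf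
      (LinearMap.proj 0 ∘ₗ ShiftModule.seq.toLinearMap ∘ₗ g.restrictScalars R)
    refine ⟨linearMapOfCommX (ShiftModule.seq.symm.toLinearMap ∘ₗ LinearMap.pi fun n =>
      h ∘ₗ (LinearMap.lsmul R[X] Y (Polynomial.X ^ n)).restrictScalars R) (fun y => ?_),
      fun x => ?_⟩
    · apply ShiftModule.seq.injective
      ext n
      simp [smul_smul, pow_succ, mul_comm]
    · apply ShiftModule.seq.injective
      ext n
      have (n : ℕ) (s : ShiftModule R M) : ShiftModule.seq s n =
          ShiftModule.seq ((Polynomial.X ^ n : R[X]) • s) 0 := by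
        induction n generalizing s with
        | zero => simp
        | succ n ih => rw [pow_succ, mul_smul, ← ih, ShiftModule.seq_X_smul]
      have h2 := hh ((Polynomial.X ^ n : R[X]) • x)
      simp only [LinearMap.coe_restrictScalars, map_smul, LinearMap.coe_comp, LinearEquiv.coe_coe,
        Function.comp_apply, LinearMap.coe_proj, Function.eval] at h2
      rw [this n (g x), ← h2]
      simp [linearMapOfCommX]

theorem InjDimLE.shiftModule {n : ℕ} (h : InjDimLE R M n) :
    InjDimLE R[X] (ShiftModule R M) n := by
  induction n generalizing M with
  | zero =>
    have := injDimLE_zero_iff.mp h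
    exact injDimLE_zero_iff.mpr ShiftModule.injective
  | succ n ih =>
    obtain ⟨I, _, _, f, hI, hf, hC⟩ := h.exists_cokernel
    refine injDimLE_left (f := ShiftModule.map f) (g := ShiftModule.map f.range.mkQ) ?_ ?_ ?_
      ((injDimLE_zero_iff.mpr ShiftModule.injective).mono (Nat.zero_le _)) (ih hC)
    · intro a b hab
      apply ShiftModule.seq.injective
      ext n
      apply hf
      rw [← ShiftModule.seq_map, hab, ShiftModule.seq_map]
    · intro s
      constructor
      · intro hs
        have (n : ℕ) : ShiftModule.seq s n ∈ f.range := by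
          rw [← Submodule.Quotient.mk_eq_zero, ← Submodule.mkQ_apply, ← ShiftModule.seq_map, hs,
            map_zero, Pi.zero_apply]
        choose m hm using this
        refine ⟨ShiftModule.seq.symm m, ShiftModule.seq.injective ?_⟩
        ext n
        simp [hm]
      · rintro ⟨m, rfl⟩
        apply ShiftModule.seq.injective
        ext n
        simp
    · intro s
      choose m hm using fun n => Submodule.mkQ_surjective _ (ShiftModule.seq s n)
      refine ⟨ShiftModule.seq.symm m, ShiftModule.seq.injective ?_⟩
      ext n
      simp only [ShiftModule.seq_map, LinearEquiv.apply_symm_apply, hm]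

/-- If all `R`-modules have injective dimension at most `n`, then all `R[X]`-modules have injective
dimension at most `n + 1`. -/
theorem injDimLE_polynomial {n : ℕ}
    (h : ∀ (M : Type u) [AddCommGroup M] [Module R M], InjDimLE R M n)
    (M : Type u) [AddCommGroup M] [Module R[X] M] : InjDimLE R[X] M (n + 1) := by
  let _ : Module R M := Module.compHom M (algebraMap R R[X])
  have : IsScalarTower R R[X] M := ⟨fun a b c => by rw [Algebra.smul_def, mul_smul]; rfl⟩
  let f : M →ₗ[R[X]] ShiftModule R M := linearMapOfCommX (ShiftModule.seq.symm.toLinearMap ∘ₗ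
    LinearMap.pi fun n => (LinearMap.lsmul R[X] M (Polynomial.X ^ n)).restrictScalars R)
    (fun y => by
      apply ShiftModule.seq.injective
      ext n
      simp [smul_smul, pow_succ, mul_comm])
  have hf (m : M) (n : ℕ) : ShiftModule.seq (f m) n = (Polynomial.X ^ n : R[X]) • m := by
    simp [f, linearMapOfCommX]
  let μ : M →ₗ[R] M := (LinearMap.lsmul R[X] M Polynomial.X).restrictScalars R
  let g : ShiftModule R M →ₗ[R[X]] ShiftModule R M :=
    (LinearMap.lsmul R[X] (ShiftModule R M) Polynomial.X) - ShiftModule.map μ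
  have hg (s : ShiftModule R M) (n : ℕ) : ShiftModule.seq (g s) n =
      ShiftModule.seq s (n + 1) - (Polynomial.X : R[X]) • ShiftModule.seq s n := by
    simp [g, μ]
  refine injDimLE_left (f := f) (g := g) ?_ ?_ ?_ ((h M).shiftModule.mono (Nat.le_succ n))
    (h M).shiftModule
  · intro a b hab
    have := congrArg (fun s => ShiftModule.seq s 0) hab
    simpa [hf] using this
  · intro s
    constructor
    · intro hs
      refine ⟨ShiftModule.seq s 0, ShiftModule.seq.injective ?_⟩
      ext n
      rw [hf]
      induction n with
      | zero => simp
      | succ n ih =>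
        have := hg s n
        rw [hs, map_zero, Pi.zero_apply, eq_comm, sub_eq_zero] at this
        rw [this, ← ih, pow_succ', mul_smul]
    · rintro ⟨m, rfl⟩
      apply ShiftModule.seq.injective
      ext n
      rw [hg, hf, hf, pow_succ', mul_smul, sub_self, map_zero, Pi.zero_apply]
  · intro t
    let s : ℕ → M := fun n => n.rec 0 fun n a => (Polynomial.X : R[X]) • a + ShiftModule.seq t n
    refine ⟨ShiftModule.seq.symm s, ShiftModule.seq.injective ?_⟩
    ext n
    rw [hg, LinearEquiv.apply_symm_apply]
    simp [s]

attribute [local instance] RingHomInvPair.of_ringEquiv in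
theorem InjDimLE.of_ringEquiv {S : Type u} [CommRing S] (e : R ≃+* S) {n : ℕ}
    (h : ∀ (M : Type u) [AddCommGroup M] [Module R M], InjDimLE R M n)
    (M : Type u) [AddCommGroup M] [Module S M] : InjDimLE S M n := by
  let _ : Module R M := Module.compHom M e.toRingHom
  let e' : ModuleCat.of R M ≃ₛₗ[RingHomClass.toRingHom e] ModuleCat.of S M :=
    { __ := AddEquiv.refl M
      map_smul' := fun r m => rfl }
  exact (ModuleCat.hasInjectiveDimensionLE_iff_of_semiLinearEquiv e e' n).mp (h M)

theorem exists_injDimLE_mvPolynomial {σ : Type} [Finite σ]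
    (h : ∃ n, ∀ (M : Type u) [AddCommGroup M] [Module R M], InjDimLE R M n) :
    ∃ n, ∀ (M : Type u) [AddCommGroup M] [Module (MvPolynomial σ R) M],
      InjDimLE (MvPolynomial σ R) M n := by
  induction σ using Finite.induction_empty_option with
  | of_equiv e H =>
    obtain ⟨n, hn⟩ := H
    exact ⟨n, fun M _ _ => InjDimLE.of_ringEquiv (MvPolynomial.renameEquiv R e).toRingEquiv hn M⟩
  | h_empty =>
    obtain ⟨n, hn⟩ := h
    exact ⟨n, fun M _ _ => InjDimLE.of_ringEquiv (MvPolynomial.isEmptyRingEquiv R PEmpty).symm hn M⟩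
  | h_option H =>
    obtain ⟨n, hn⟩ := H
    exact ⟨n + 1, fun M _ _ => InjDimLE.of_ringEquiv
      (MvPolynomial.optionEquivLeft R _).symm.toRingEquiv (injDimLE_polynomial hn) M⟩

theorem injDimLE_of_field {k : Type u} [Field k] (M : Type u) [AddCommGroup M] [Module k M] :
    InjDimLE k M 0 :=
  injDimLE_zero_iff.mpr ⟨fun X Y _ _ _ _ f hf g => by
    obtain ⟨l, hl⟩ := f.exists_leftInverse_of_injective (LinearMap.ker_eq_bot.mpr hf)
    exact ⟨g ∘ₗ l, fun x => congrArg g (LinearMap.congr_fun hl x)⟩⟩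

end Polynomial

/-! ### Gorenstein local rings -/

attribute [local instance] RingHomInvPair.of_ringEquiv in
theorem exists_injDimLE_of_ringEquiv {S : Type u} [CommRing S] (e : R ≃+* S)
    (h : ∃ n, InjDimLE R R n) : ∃ n, InjDimLE S S n := by
  obtain ⟨n, hn⟩ := h
  let e' : ModuleCat.of R R ≃ₛₗ[RingHomClass.toRingHom e] ModuleCat.of S S :=
    { __ := e.toAddEquiv
      map_smul' := fun r m => by simp }
  exact ⟨n, (ModuleCat.hasInjectiveDimensionLE_iff_of_semiLinearEquiv e e' n).mp hn⟩

theorem exists_injDimLE_localization [IsNoetherianRing R] (S : Submonoid R)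
    (h : ∃ n, InjDimLE R R n) : ∃ n, InjDimLE (Localization S) (Localization S) n := by
  obtain ⟨n, hn⟩ := h
  have : HasInjectiveDimensionLE (ModuleCat.of R R) n := hn
  have h2 := ModuleCat.localizedModule_hasInjectiveDimensionLE n S (ModuleCat.of R R)
  have hloc := ModuleCat.localizedModule_isLocalizedModule (ModuleCat.of R R) S
  let e : (ModuleCat.of R R).localizedModule S ≃ₗ[Localization S]
      ModuleCat.of (Localization S) (Localization S) :=
    (@IsLocalizedModule.linearEquiv _ _ S _ _ _ _ _ _ _ _ _
      ((ModuleCat.of R R).localizedModuleMkLinearMap S)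
      (Algebra.linearMap R (Localization S)) hloc _).extendScalarsOfIsLocalization S (Localization S)
  exact ⟨n, (ModuleCat.hasInjectiveDimensionLE_iff_of_linearEquiv e n).mp h2⟩

theorem isGorensteinLocalRing_atPrime [IsNoetherianRing R] (h : ∃ n, InjDimLE R R n)
    (p : Ideal R) [p.IsPrime] (S : Type u) [CommRing S] [Algebra R S]
    [IsLocalization.AtPrime S p] : IsGorensteinLocalRing S where
  isLocalRing := IsLocalization.AtPrime.isLocalRing S p
  isNoetherianRing := IsLocalization.isNoetherianRing p.primeCompl S inferInstance
  finite_injectiveDimension := exists_injDimLE_of_ringEquiv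
    (IsLocalization.algEquiv p.primeCompl (Localization p.primeCompl) S).toRingEquiv
    (exists_injDimLE_localization p.primeCompl h)

end InjectiveDimension

end EllipticCone

end

noncomputable section

namespace EllipticCone

/-! ### Cohen–Macaulay rings -/

section CohenMacaulay

open RingTheory.Sequence IsLocalRing

variable {R : Type u} [CommRing R]

theorem IsCohenMacaulayLocalRing.of_isWeaklyRegular [IsLocalRing R] [IsNoetherianRing R]
    (rs : List R) (hmem : ∀ r ∈ rs, r ∈ maximalIdeal R) (hreg : IsWeaklyRegular R rs)
    (hdim : ringKrullDim R ≤ rs.length) : IsCohenMacaulayLocalRing R where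
  isLocalRing := inferInstance
  isNoetherianRing := inferInstance
  exists_isRegular := by
    have hreg' := (IsLocalRing.isRegular_iff_isWeaklyRegular_of_subset_maximalIdeal hmem).mpr hreg
    refine ⟨rs, hreg', le_antisymm ?_ hdim⟩
    have hne : Ideal.ofList rs ≠ ⊤ := fun h => by
      apply hreg'.top_ne_smul
      rw [h, Submodule.top_smul]
    have : Nontrivial (R ⧸ Ideal.ofList rs) := Ideal.Quotient.nontrivial_iff.mpr hne
    rw [← ringKrullDim_add_length_eq_ringKrullDim_of_isRegular rs hreg']
    have h0 : (0 : WithBot ℕ∞) ≤ ringKrullDim (R ⧸ Ideal.ofList rs) := ringKrullDim_nonneg_of_nontrivial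
    exact le_add_of_nonneg_left h0

theorem mem_maximalIdeal_of_isRegular [IsLocalRing R] {rs : List R} (h : IsRegular R rs) :
    ∀ r ∈ rs, r ∈ maximalIdeal R := by
  intro r hr hu
  apply h.top_ne_smul
  rw [Ideal.eq_top_of_isUnit_mem (Ideal.ofList rs) (Ideal.subset_span hr) hu,
    Submodule.top_smul]

theorem IsCohenMacaulayLocalRing.of_ringEquiv {S : Type u} [CommRing S] (e : R ≃+* S)
    (h : IsCohenMacaulayLocalRing R) : IsCohenMacaulayLocalRing S := by
  have := h.isLocalRing
  have := h.isNoetherianRing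
  have := e.isLocalRing
  have := isNoetherianRing_of_ringEquiv R e
  obtain ⟨rs, hreg, hlen⟩ := h.exists_isRegular
  refine ⟨inferInstance, inferInstance, rs.map e, ?_, ?_⟩
  · refine (AddEquiv.isRegular_congr (e := e.toAddEquiv) ?_).mp hreg
    rw [List.forall₂_map_right_iff, List.forall₂_same]
    intro r _ x
    simp
  · rw [List.length_map, hlen, ringKrullDim_eq_of_ringEquiv e]

/-- The quotient of a Cohen–Macaulay local ring by a nonzerodivisor of the maximal ideal is
Cohen–Macaulay. -/
theorem IsCohenMacaulayLocalRing.quotient (h : IsCohenMacaulayLocalRing R) {x : R}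
    (hx : IsSMulRegular R x) (hxu : ¬ IsUnit x) :
    IsCohenMacaulayLocalRing (R ⧸ Ideal.span {x}) := by
  have := h.isLocalRing
  have := h.isNoetherianRing
  obtain ⟨rs, hreg, hlen⟩ := h.exists_isRegular
  have hxm : x ∈ maximalIdeal R := hxu
  have hdim := ringKrullDim_quotient_span_singleton_succ_eq_ringKrullDim hx hxm
  have : Nontrivial (R ⧸ Ideal.span {x}) := Ideal.Quotient.nontrivial_iff.mpr (by
    rwa [Ne, Ideal.span_singleton_eq_top])
  have : IsLocalRing (R ⧸ Ideal.span {x}) :=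
    IsLocalRing.of_surjective' (Ideal.Quotient.mk _) Ideal.Quotient.mk_surjective
  have h0 : (0 : WithBot ℕ∞) ≤ ringKrullDim (R ⧸ Ideal.span {x}) := ringKrullDim_nonneg_of_nontrivial
  obtain ⟨n, hn⟩ : ∃ n, rs.length = n + 1 := by
    refine Nat.exists_eq_succ_of_ne_zero fun hz => ?_
    rw [hz, ← hdim] at hlen
    have h1 : (1 : WithBot ℕ∞) ≤ ((0 : ℕ) : WithBot ℕ∞) := hlen ▸ le_add_of_nonneg_left h0
    exact absurd h1 (by decide)
  have hlt : maximalIdeal R • (⊤ : Submodule R R) < ⊤ := by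
    rw [smul_eq_mul, Ideal.mul_top]
    exact (maximalIdeal.isMaximal R).ne_top.lt_top
  have hexr : ∃ rs : List R, rs.length = n + 1 ∧ (∀ r ∈ rs, r ∈ maximalIdeal R) ∧
      IsRegular (ModuleCat.of R R) rs :=
    ⟨rs, hn, mem_maximalIdeal_of_isRegular hreg, hreg⟩
  have hext : ∀ i < n + 1, Subsingleton (Abelian.Ext
      (ModuleCat.of R (Shrink.{u} (R ⧸ maximalIdeal R))) (ModuleCat.of R R) i) :=
    ((ModuleCat.exists_isRegular_tfae (maximalIdeal R) (n + 1) (ModuleCat.of R R)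
      hlt).out 3 1).mp hexr
  have hext' : ∀ i < n, Subsingleton (Abelian.Ext
      (ModuleCat.of R (Shrink.{u} (R ⧸ maximalIdeal R))) (ModuleCat.of R (QuotSMulTop x R)) i) := by
    intro i hi
    have zero1 := AddCommGrpCat.isZero_of_iff_subsingleton.mpr (hext i (by omega))
    have zero2 := AddCommGrpCat.isZero_of_iff_subsingleton.mpr (hext (i + 1) (by omega))
    exact AddCommGrpCat.subsingleton_of_isZero <| ShortComplex.Exact.isZero_of_both_zeros
      ((Abelian.Ext.covariant_sequence_exact₃' _
        (IsSMulRegular.smulShortComplex_shortExact (M := ModuleCat.of R R) hx)) i (i + 1) rfl)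
      (zero1.eq_zero_of_src _) (zero2.eq_zero_of_tgt _)
  let e : (R ⧸ Ideal.span {x}) ≃ₗ[R] QuotSMulTop x R :=
    Submodule.quotEquivOfEq _ _ (by
      rw [← Submodule.ideal_span_singleton_smul, smul_eq_mul, Ideal.mul_top])
  have : Nontrivial (QuotSMulTop x R) := e.symm.toEquiv.nontrivial
  have hlt' : maximalIdeal R • (⊤ : Submodule R (QuotSMulTop x R)) < ⊤ := by
    rw [lt_top_iff_ne_top]
    intro htop
    have := Submodule.eq_bot_of_le_smul_of_le_jacobson_bot (maximalIdeal R)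
      (⊤ : Submodule R (QuotSMulTop x R)) Module.Finite.fg_top htop.ge
      (by rw [IsLocalRing.jacobson_eq_maximalIdeal ⊥ bot_ne_top])
    exact bot_ne_top this.symm
  obtain ⟨ss, hsn, hsm, hsreg⟩ : ∃ rs : List R, rs.length = n ∧ (∀ r ∈ rs, r ∈ maximalIdeal R) ∧
      IsRegular (ModuleCat.of R (QuotSMulTop x R)) rs := ((ModuleCat.exists_isRegular_tfae (maximalIdeal R) n
    (ModuleCat.of R (QuotSMulTop x R)) hlt').out 1 3).mp hext'
  refine IsCohenMacaulayLocalRing.of_isWeaklyRegular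
    (ss.map (Ideal.Quotient.mk (Ideal.span {x}))) ?_ ?_ ?_
  · intro r hr
    obtain ⟨s, hs, rfl⟩ := List.mem_map.mp hr
    intro hu
    have : IsLocalHom (Ideal.Quotient.mk (Ideal.span {x})) :=
      IsLocalHom.of_surjective _ Ideal.Quotient.mk_surjective
    exact hsm s hs (isUnit_of_map_unit _ _ hu)
  · rw [← Ideal.Quotient.algebraMap_eq, isWeaklyRegular_map_algebraMap_iff]
    exact (e.isWeaklyRegular_congr ss).mpr hsreg.toIsWeaklyRegular
  · rw [List.length_map, hsn]
    have h2 : ringKrullDim (R ⧸ Ideal.span {x}) + 1 = (n : WithBot ℕ∞) + 1 := by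
      rw [hdim, ← hlen, hn]; push_cast; rfl
    exact (ENat.WithBot.add_one_cancel.mp h2).le

/-- All local rings of `R` are Cohen–Macaulay. -/
def IsCMRing (R : Type u) [CommRing R] : Prop :=
  IsNoetherianRing R ∧
    ∀ (p : Ideal R) [p.IsPrime], IsCohenMacaulayLocalRing (Localization.AtPrime p)

theorem IsCMRing.atPrime (h : IsCMRing R) (p : Ideal R) [p.IsPrime] (S : Type u) [CommRing S]
    [Algebra R S] [IsLocalization.AtPrime S p] : IsCohenMacaulayLocalRing S :=
  (h.2 p).of_ringEquiv
    (IsLocalization.algEquiv p.primeCompl (Localization.AtPrime p) S).toRingEquiv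

theorem IsCMRing.of_ringEquiv {S : Type u} [CommRing S] (e : R ≃+* S) (h : IsCMRing R) :
    IsCMRing S := by
  have := h.1
  refine ⟨isNoetherianRing_of_ringEquiv R e, fun p _ => ?_⟩
  have : (p.comap e.toRingHom).IsPrime := Ideal.comap_isPrime _ _
  exact (h.2 (p.comap e.toRingHom)).of_ringEquiv
    (IsLocalization.ringEquivOfRingEquiv (M := (p.comap e.toRingHom).primeCompl)
      (T := p.primeCompl) _ _ e (by
        ext x
        constructor
        · rintro ⟨y, hy, rfl⟩
          exact hy
        · intro hx
          exact ⟨e.symm x, by simpa [Ideal.primeCompl] using hx, by simp⟩))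

theorem isCMRing_of_field (K : Type u) [Field K] : IsCMRing K := by
  refine ⟨inferInstance, fun p _ => ?_⟩
  have hdim := IsLocalization.AtPrime.ringKrullDim_eq_height p (Localization.AtPrime p)
  have := IsLocalization.isNoetherianRing p.primeCompl (Localization.AtPrime p) inferInstance
  have hp : p.height = 0 := by
    rw [(Ideal.eq_bot_or_top p).resolve_right (Ideal.IsPrime.ne_top inferInstance),
      Ideal.height_bot]
  refine .of_isWeaklyRegular [] (by simp) (.nil _ _) ?_
  rw [hdim, hp]
  simp

theorem isCohenMacaulayLocalRing_polynomial_atPrime (h : IsCohenMacaulayLocalRing R)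
    (P : Ideal R[X]) [P.IsPrime] (hP : P.comap Polynomial.C = @maximalIdeal R _ h.isLocalRing) :
    IsCohenMacaulayLocalRing (Localization.AtPrime P) := by
  have := h.isLocalRing
  have := h.isNoetherianRing
  obtain ⟨rs, hreg, hlen⟩ := h.exists_isRegular
  have hdim := IsLocalization.AtPrime.ringKrullDim_eq_height P (Localization.AtPrime P)
  have := IsLocalization.isNoetherianRing P.primeCompl (Localization.AtPrime P) inferInstance
  have hrs := mem_maximalIdeal_of_isRegular hreg
  have hreg1 : IsWeaklyRegular R[X] (rs.map (algebraMap R R[X])) :=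
    hreg.toIsWeaklyRegular.of_flat
  have hrs1 : ∀ r ∈ rs.map (algebraMap R R[X]), r ∈ P := by
    intro r hr
    obtain ⟨s, hs, rfl⟩ := List.mem_map.mp hr
    have : s ∈ P.comap Polynomial.C := hP ▸ hrs s hs
    exact this
  -- a sequence in `P` that is regular on `R[X]` and long enough suffices
  have key (ts : List R[X]) (h1 : ∀ r ∈ ts, r ∈ P) (h2 : IsWeaklyRegular R[X] ts)
      (h3 : (P.height : WithBot ℕ∞) ≤ ts.length) :
      IsCohenMacaulayLocalRing (Localization.AtPrime P) := by
    refine .of_isWeaklyRegular (ts.map (algebraMap R[X] (Localization.AtPrime P))) ?_ h2.of_flat ?_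
    · intro r hr
      obtain ⟨s, hs, rfl⟩ := List.mem_map.mp hr
      exact (IsLocalization.AtPrime.to_map_mem_maximal_iff (Localization.AtPrime P) P s).mpr
        (h1 s hs)
    · rwa [hdim, List.length_map]
  have hmax : (maximalIdeal R).height = rs.length := by
    have := maximalIdeal_height_eq_ringKrullDim (R := R)
    rw [← hlen] at this
    exact WithBot.coe_injective this
  by_cases hq : P = (maximalIdeal R).map Polynomial.C
  · refine key _ hrs1 hreg1 ?_
    rw [hq, Polynomial.height_map_C, hmax, List.length_map]
    rfl
  · have hmaxi : (P.comap Polynomial.C).IsMaximal := by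
      simpa [hP] using maximalIdeal.isMaximal R
    obtain ⟨y, hy, hyP⟩ := Polynomial.exists_monic_span_sup_map_eq R P hmaxi
      (by rwa [hP])
    have hyP' : y ∈ P := by
      rw [hyP]
      exact Ideal.mem_sup_right (Ideal.mem_span_singleton_self y)
    refine key (rs.map (algebraMap R R[X]) ++ [y]) ?_ ?_ ?_
    · intro r hr
      rcases List.mem_append.mp hr with hr | hr
      · exact hrs1 r hr
      · rwa [List.mem_singleton.mp hr]
    · rw [isWeaklyRegular_append_iff]
      refine ⟨hreg1, ?_⟩
      rw [isWeaklyRegular_singleton_iff, isSMulRegular_iff_right_eq_zero_of_smul]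
      intro q hq
      obtain ⟨q, rfl⟩ := Submodule.mkQ_surjective _ q
      have hker : Ideal.ofList (rs.map (algebraMap R R[X])) • (⊤ : Submodule R[X] R[X]) =
          RingHom.ker (Polynomial.mapRingHom (Ideal.Quotient.mk (Ideal.ofList rs))) := by
        rw [smul_eq_mul, Ideal.mul_top, ← Ideal.map_ofList, Polynomial.ker_mapRingHom,
          Ideal.mk_ker, Polynomial.algebraMap_eq]
      rw [← map_smul, Submodule.mkQ_apply, Submodule.Quotient.mk_eq_zero, hker, RingHom.mem_ker,
        smul_eq_mul, map_mul] at hq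
      rw [Submodule.mkQ_apply, Submodule.Quotient.mk_eq_zero, hker, RingHom.mem_ker]
      exact ((hy.map _).isRegular.left.mul_left_eq_zero_iff).mp hq
    · rw [List.length_append, List.length_map, List.length_singleton]
      have : P.LiesOver (maximalIdeal R) := ⟨hP.symm⟩
      have h1 := Ideal.height_le_height_add_of_liesOver (maximalIdeal R) P
      have h2 : (P.map (Ideal.Quotient.mk
          ((maximalIdeal R).map (algebraMap R R[X])))).height ≤ 1 := by
        have hmap : P.map (Ideal.Quotient.mk ((maximalIdeal R).map (algebraMap R R[X]))) =
            Ideal.span {Ideal.Quotient.mk _ y} := by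
          conv_lhs => rw [hyP]
          rw [hP, Ideal.map_sup, Ideal.map_span, Set.image_singleton]
          refine sup_eq_right.mpr ?_
          rw [Polynomial.algebraMap_eq, Ideal.map_quotient_self]
          exact bot_le
        have hprime : (P.map (Ideal.Quotient.mk
            ((maximalIdeal R).map (algebraMap R R[X])))).IsPrime := by
          refine Ideal.map_isPrime_of_surjective Ideal.Quotient.mk_surjective ?_
          rw [Ideal.mk_ker, ← hP]
          exact Ideal.map_comap_le
        have hprin : (P.map (Ideal.Quotient.mk
            ((maximalIdeal R).map (algebraMap R R[X])))).IsPrincipal := ⟨_, hmap⟩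
        refine Ideal.height_le_one_of_isPrincipal_of_mem_minimalPrimes (P.map (Ideal.Quotient.mk
          ((maximalIdeal R).map (algebraMap R R[X])))) _ ?_
        rw [Ideal.minimalPrimes_eq_subsingleton_self]
        rfl
      have h3 : P.height ≤ (rs.length + 1 : ℕ) := by
        refine h1.trans ?_
        rw [hmax]
        push_cast
        gcongr
      exact_mod_cast h3

theorem IsCMRing.polynomial (h : IsCMRing R) : IsCMRing R[X] := by
  have := h.1
  refine ⟨inferInstance, fun p _ => ?_⟩
  let q := p.comap Polynomial.C
  let S := (Localization.AtPrime q)[X]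
  let pc := Submonoid.map Polynomial.C.toMonoidHom q.primeCompl
  let : Algebra R[X] S := Polynomial.algebra R (Localization.AtPrime q)
  have : IsLocalization pc S := Polynomial.isLocalization _ _
  let pS := p.map (algebraMap R[X] S)
  have disj : Disjoint (pc : Set R[X]) (p : Set R[X]) := by
    simpa [pc, q] using! Set.disjoint_image_left.mpr
      (Set.disjoint_compl_left_iff_subset.mpr (fun _ a ↦ a))
  have : pS.IsPrime := IsLocalization.isPrime_of_isPrime_disjoint pc _ _ ‹_› disj
  have : IsLocalization.AtPrime (Localization.AtPrime pS) p := by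
    convert IsLocalization.isLocalization_isLocalization_atPrime_isLocalization pc
      (Localization.AtPrime pS) pS
    exact (IsLocalization.under_map_of_isPrime_disjoint pc _ ‹_› disj).symm
  have eq : pS.comap Polynomial.C = maximalIdeal (Localization.AtPrime q) := by
    rw [← IsLocalization.map_under q.primeCompl _ (pS.comap Polynomial.C),
      ← IsLocalization.map_under q.primeCompl _ (maximalIdeal (Localization.AtPrime q))]
    simp only [Ideal.comap_comap, S, pS]
    rw [← Polynomial.algebraMap_eq (R := Localization.AtPrime q),
      ← IsScalarTower.algebraMap_eq R (Localization.AtPrime q) (Localization.AtPrime q)[X],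
      IsScalarTower.algebraMap_eq R R[X] (Localization.AtPrime q)[X], ← Ideal.comap_comap,
      ← Ideal.under_def R[X], IsLocalization.under_map_of_isPrime_disjoint pc _ ‹_› disj]
    simp [q, IsLocalization.AtPrime.under_maximalIdeal (Localization.AtPrime q) q]
  exact (isCohenMacaulayLocalRing_polynomial_atPrime (h.2 q) pS eq).of_ringEquiv
    (IsLocalization.algEquiv p.primeCompl (Localization.AtPrime pS)
      (Localization.AtPrime p)).toRingEquiv

theorem IsCMRing.mvPolynomial {σ : Type} [Finite σ] (h : IsCMRing R) :
    IsCMRing (MvPolynomial σ R) := by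
  induction σ using Finite.induction_empty_option with
  | of_equiv e H => exact H.of_ringEquiv (MvPolynomial.renameEquiv _ e).toRingEquiv
  | h_empty => exact h.of_ringEquiv (MvPolynomial.isEmptyRingEquiv R _).symm
  | h_option IH => exact IH.polynomial.of_ringEquiv (MvPolynomial.optionEquivLeft _ _).toRingEquiv.symm

theorem IsCMRing.quotient (h : IsCMRing R) {x : R} (hx : x ∈ nonZeroDivisors R) :
    IsCMRing (R ⧸ Ideal.span {x}) := by
  have := h.1
  refine ⟨inferInstance, fun p _ => ?_⟩
  let q := p.comap (Ideal.Quotient.mk (Ideal.span {x}))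
  have hxq : x ∈ q := by
    rw [Ideal.mem_comap, Ideal.Quotient.eq_zero_iff_mem.mpr (Ideal.mem_span_singleton_self x)]
    exact p.zero_mem
  have hS : p.primeCompl = Algebra.algebraMapSubmonoid (R ⧸ Ideal.span {x}) q.primeCompl := by
    ext y
    constructor
    · intro hy
      obtain ⟨y, rfl⟩ := Ideal.Quotient.mk_surjective y
      exact ⟨y, hy, rfl⟩
    · rintro ⟨y, hy, rfl⟩
      exact hy
  have hloc : IsLocalization.AtPrime (Localization.AtPrime q ⧸
      (Ideal.span {x}).map (algebraMap R (Localization.AtPrime q))) p := by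
    rw [IsLocalization.AtPrime, hS]
    infer_instance
  have hmap : (Ideal.span {x}).map (algebraMap R (Localization.AtPrime q)) =
      Ideal.span {algebraMap R (Localization.AtPrime q) x} := by
    rw [Ideal.map_span, Set.image_singleton]
  refine IsCohenMacaulayLocalRing.of_ringEquiv ((Ideal.quotEquivOfEq hmap).symm.trans
    (IsLocalization.algEquiv p.primeCompl _ (Localization.AtPrime p)).toRingEquiv) ?_
  refine (h.2 q).quotient ?_ ?_
  · have := IsLocalization.map_nonZeroDivisors_le q.primeCompl (Localization.AtPrime q)
      ⟨x, hx, rfl⟩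
    exact (isRegular_iff_mem_nonZeroDivisors.mpr this).left
  · exact (IsLocalization.AtPrime.to_map_mem_maximal_iff (Localization.AtPrime q) q x).mpr hxq

end CohenMacaulay
end EllipticCone
end

noncomputable section

namespace EllipticCone

/-! ### Plane cubics -/

section Cubics

open MvPolynomial

theorem aeval_mul_of_isHomogeneous {k C σ : Type*} [CommSemiring k] [CommSemiring C] [Algebra k C]
    {F : MvPolynomial σ k} {n : ℕ} (hF : F.IsHomogeneous n) (c : C) (y : σ → C) :
    aeval (fun j => c * y j) F = c ^ n * aeval y F := by
  rw [aeval_def, aeval_def, eval₂_eq, eval₂_eq, Finset.mul_sum]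
  refine Finset.sum_congr rfl fun d hd => ?_
  have hdeg : ∑ i ∈ d.support, d i = n := by
    have := hF (mem_support_iff.mp hd)
    simpa [Finsupp.weight_apply, Finsupp.sum] using this
  simp only [mul_pow, Finset.prod_mul_distrib, Finset.prod_pow_eq_pow_sum, hdeg]
  ring

theorem homogeneousComponent_mul_of_le {k σ : Type*} [CommSemiring k] {G H : MvPolynomial σ k}
    {a b : ℕ} (hG : G.totalDegree ≤ a) (hH : H.totalDegree ≤ b) :
    homogeneousComponent (a + b) (G * H) =
      homogeneousComponent a G * homogeneousComponent b H := by
  classical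
  ext d
  by_cases hd : d.degree = a + b
  · rw [coeff_homogeneousComponent, if_pos hd, coeff_mul, coeff_mul]
    refine Finset.sum_congr rfl fun e he => ?_
    have hde : e.1.degree + e.2.degree = a + b := by
      rw [← hd, ← Finset.HasAntidiagonal.mem_antidiagonal.mp he, map_add]
    rw [coeff_homogeneousComponent, coeff_homogeneousComponent]
    rcases lt_trichotomy e.1.degree a with h | h | h
    · rw [if_neg h.ne, zero_mul, coeff_eq_zero_of_totalDegree_lt (f := H), mul_zero]
      exact lt_of_le_of_lt hH (by simp only [Finsupp.degree_apply] at hde h; omega)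
    · rw [if_pos h, if_pos (by omega)]
    · rw [if_neg h.ne', zero_mul, coeff_eq_zero_of_totalDegree_lt (f := G), zero_mul]
      exact lt_of_le_of_lt hG (by simpa [Finsupp.degree_apply] using h)
  · rw [coeff_homogeneousComponent, if_neg hd]
    exact (((homogeneousComponent_isHomogeneous a G).mul
      (homogeneousComponent_isHomogeneous b H)).coeff_eq_zero hd).symm

variable {k : Type u} [Field k]

theorem three_le_height_of_X_mem (P : Ideal (MvPolynomial (Fin 3) k)) [P.IsPrime]
    (hP : ∀ i, X i ∈ P) : 3 ≤ P.height := by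
  let f (j : ℕ) : MvPolynomial (Fin 3) k →ₐ[k] MvPolynomial (Fin 3) k :=
    aeval fun l => if (l : ℕ) < j then 0 else X l
  have hf (j : ℕ) (l : Fin 3) : f j (X l) = if (l : ℕ) < j then 0 else X l := aeval_X _ _
  have hprime (j : ℕ) : (RingHom.ker (f j)).IsPrime := RingHom.ker_isPrime _
  have hle (j : ℕ) : RingHom.ker (f j) ≤ RingHom.ker (f (j + 1)) := by
    have : f (j + 1) = (f (j + 1)).comp (f j) := by
      ext l : 1
      rw [AlgHom.comp_apply, hf j]
      split_ifs with h
      · rw [hf, if_pos (by omega), map_zero]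
      · rfl
    intro x hx
    rw [RingHom.mem_ker] at hx ⊢
    rw [this, AlgHom.comp_apply, hx, map_zero]
  have hlt (j : ℕ) (hj : j < 3) : (RingHom.ker (f j)).height + 1 ≤ (RingHom.ker (f (j + 1))).height := by
    refine Ideal.height_add_one_le_of_lt_of_isPrime (lt_of_le_of_ne (hle j) fun h => ?_)
    have h1 : X ⟨j, hj⟩ ∈ RingHom.ker (f (j + 1)) := by
      rw [RingHom.mem_ker, hf, if_pos (by simp)]
    rw [← h, RingHom.mem_ker, hf, if_neg (by simp)] at h1
    exact X_ne_zero _ h1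
  have h3 : RingHom.ker (f 3) ≤ P := by
    have hmk : (Ideal.Quotient.mkₐ k P).comp (f 3) = Ideal.Quotient.mkₐ k P := by
      ext l : 1
      rw [AlgHom.comp_apply, hf, if_pos l.2, map_zero]
      exact (Ideal.Quotient.eq_zero_iff_mem.mpr (hP l)).symm
    intro x hx
    rw [← Ideal.Quotient.eq_zero_iff_mem]
    change Ideal.Quotient.mkₐ k P x = 0
    rw [← hmk, AlgHom.comp_apply, (RingHom.mem_ker).mp hx, map_zero]
  have e1 := hlt 0 (by omega)
  have e2 := hlt 1 (by omega)
  have e3 := hlt 2 (by omega)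
  calc (3 : ℕ∞) = 0 + 1 + 1 + 1 := by norm_num
    _ ≤ (RingHom.ker (f 0)).height + 1 + 1 + 1 := by gcongr; exact zero_le
    _ ≤ (RingHom.ker (f 1)).height + 1 + 1 := by gcongr
    _ ≤ (RingHom.ker (f 2)).height + 1 := by gcongr
    _ ≤ (RingHom.ker (f 3)).height := e3
    _ ≤ P.height := Ideal.height_mono h3

theorem IsSmoothPlaneCubic.ne_zero {F : MvPolynomial (Fin 3) k} (hF : IsSmoothPlaneCubic F) : F ≠ 0 := by
  rintro rfl
  obtain ⟨i, hi⟩ := hF.smooth 1 one_ne_zero (by simp)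
  simp at hi

theorem IsSmoothPlaneCubic.euler {F : MvPolynomial (Fin 3) k} (hF : IsSmoothPlaneCubic F)
    {C : Type*} [CommRing C] [Algebra k C] {y : Fin 3 → C} (hy : aeval y F = 0) :
    ∑ i, y i * aeval y (pderiv i F) = 0 := by
  have := congr_arg (aeval y) hF.isHomogeneous.sum_X_mul_pderiv
  simpa [hy] using this

variable [IsAlgClosed k]

theorem X_mem_radical_of_zeros (s : Set (MvPolynomial (Fin 3) k))
    (h : ∀ p : Fin 3 → k, (∀ G ∈ s, eval p G = 0) → p = 0) (i : Fin 3) :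
    X i ∈ (Ideal.span s).radical := by
  rw [← vanishingIdeal_zeroLocus_eq_radical (K := k), mem_vanishingIdeal_iff]
  intro p hp
  rw [zeroLocus_span] at hp
  rw [aeval_X, h p fun G hG => by simpa [aeval_eq_eval] using hp G hG, Pi.zero_apply]

/-- Two plane curves meet. -/
theorem exists_common_zero {G H : MvPolynomial (Fin 3) k} {a b : ℕ} (ha : a ≠ 0) (hb : b ≠ 0)
    (hG : G.IsHomogeneous a) (hH : H.IsHomogeneous b) :
    ∃ p : Fin 3 → k, p ≠ 0 ∧ eval p G = 0 ∧ eval p H = 0 := by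
  by_contra! hcon
  have hX := X_mem_radical_of_zeros {G, H} fun p hp => by
    by_contra hp0
    exact hcon p hp0 (hp G (by simp)) (hp H (by simp))
  have h0 {n : ℕ} (hn : n ≠ 0) {F : MvPolynomial (Fin 3) k} (hF : F.IsHomogeneous n) :
      aeval (0 : Fin 3 → k) F = 0 := by
    have := aeval_mul_of_isHomogeneous hF (0 : k) 0
    simpa [hn] using this
  have hne : Ideal.span {G, H} ≠ ⊤ := by
    intro htop
    have : Ideal.span {G, H} ≤ RingHom.ker (aeval (0 : Fin 3 → k)) := by
      rw [Ideal.span_le]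
      rintro x (rfl | rfl)
      · exact h0 ha hG
      · exact h0 hb hH
    rw [htop] at this
    have := this (Submodule.mem_top (x := 1))
    simp at this
  obtain ⟨P, hP⟩ := Ideal.nonempty_minimalPrimes hne
  have := hP.1.1
  have h3 := three_le_height_of_X_mem P fun i =>
    ((Ideal.IsPrime.isRadical this).radical_le_iff.mpr hP.1.2) (hX i)
  have h2 := Ideal.height_le_card_of_mem_minimalPrimes_span (Set.toFinite _) hP
  have h4 : ({G, H} : Set (MvPolynomial (Fin 3) k)).ncard ≤ 2 :=
    (Set.ncard_insert_le _ _).trans (by simp)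
  have : (3 : ℕ∞) ≤ (2 : ℕ) := h3.trans (h2.trans (by exact_mod_cast h4))
  exact absurd this (by decide)

namespace IsSmoothPlaneCubic

variable {F : MvPolynomial (Fin 3) k}

theorem irreducible (hF : IsSmoothPlaneCubic F) : Irreducible F := by
  have hF0 := hF.ne_zero
  have hdeg := hF.isHomogeneous.totalDegree hF0
  have hunit {G : MvPolynomial (Fin 3) k} (h0 : G ≠ 0) (hd : G.totalDegree = 0) : IsUnit G := by
    rw [isUnit_iff_totalDegree_of_isReduced]
    refine ⟨isUnit_iff_ne_zero.mpr fun hc => h0 ?_, hd⟩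
    rw [totalDegree_eq_zero_iff_eq_C.mp hd, hc, C_0]
  refine ⟨fun h => ?_, fun G H hGH => ?_⟩
  · rw [isUnit_iff_totalDegree_of_isReduced] at h
    omega
  by_contra! hcon
  have hG0 : G ≠ 0 := by rintro rfl; simp [hF0] at hGH
  have hH0 : H ≠ 0 := by rintro rfl; simp [hF0] at hGH
  have ha : G.totalDegree ≠ 0 := fun h => hcon.1 (hunit hG0 h)
  have hb : H.totalDegree ≠ 0 := fun h => hcon.2 (hunit hH0 h)
  have hab : G.totalDegree + H.totalDegree = 3 := by
    rw [← totalDegree_mul_of_isDomain hG0 hH0, ← hGH, hdeg]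
  have hcomp := homogeneousComponent_mul_of_le le_rfl le_rfl (G := G) (H := H)
  rw [hab, ← hGH, homogeneousComponent_of_mem (n := 3) (m := 3) hF.isHomogeneous, if_pos rfl]
    at hcomp
  obtain ⟨p, hp0, hpG, hpH⟩ := exists_common_zero ha hb
    (homogeneousComponent_isHomogeneous _ G) (homogeneousComponent_isHomogeneous _ H)
  obtain ⟨i, hi⟩ := hF.smooth p hp0 (by rw [hcomp, map_mul, hpG, zero_mul])
  apply hi
  rw [hcomp, Derivation.leibniz]
  simp [hpG, hpH]

theorem exists_zero (hF : IsSmoothPlaneCubic F) : ∃ p : Fin 3 → k, p ≠ 0 ∧ eval p F = 0 := by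
  obtain ⟨p, hp, h, -⟩ := exists_common_zero three_ne_zero three_ne_zero
    hF.isHomogeneous hF.isHomogeneous
  exact ⟨p, hp, h⟩

theorem exists_pderiv_notMem (hF : IsSmoothPlaneCubic F) {C : Type*} [CommRing C]
    [Algebra k C] {y : Fin 3 → C} (hy : aeval y F = 0) (P : Ideal C) [P.IsPrime] {j : Fin 3} (hj : y j ∉ P) :
    ∃ n, aeval y (pderiv n F) ∉ P := by
  by_contra! hcon
  have hX := X_mem_radical_of_zeros (insert F (Set.range fun n => pderiv n F)) (fun p hp => by
    by_contra hp0
    obtain ⟨n, hn⟩ := hF.smooth p hp0 (hp F (Set.mem_insert _ _))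
    exact hn (hp _ (Set.mem_insert_of_mem _ ⟨n, rfl⟩))) j
  have hle : Ideal.span (insert F (Set.range fun n => pderiv n F)) ≤ P.comap (aeval y) := by
    rw [Ideal.span_le]
    rintro x (rfl | ⟨n, rfl⟩)
    · simp [hy]
    · exact hcon n
  have := (Ideal.IsPrime.isRadical (I := P.comap (aeval y)) inferInstance).radical_le_iff.mpr hle hX
  rw [Ideal.mem_comap, aeval_X] at this
  exact hj this

end IsSmoothPlaneCubic

end Cubics
end EllipticCone
end

noncomputable section

namespace EllipticCone

/-! ### Tensor products of domains over an algebraically closed field -/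

section Tensor

variable {k : Type*} [Field k]

theorem exists_algHom_ne_zero [IsAlgClosed k] {A : Type*} [CommRing A] [IsReduced A] [Algebra k A]
    [Algebra.FiniteType k A] {a : A} (ha : a ≠ 0) : ∃ f : A →ₐ[k] k, f a ≠ 0 := by
  have : IsJacobsonRing A := isJacobsonRing_of_finiteType (A := k)
  have hj : a ∉ (⊥ : Ideal A).jacobson := by
    rw [← Ideal.radical_eq_jacobson]
    change a ∉ nilradical A
    rw [nilradical_eq_zero]
    exact ha
  rw [Ideal.jacobson, Ideal.mem_sInf] at hj
  push Not at hj
  obtain ⟨m, ⟨-, hm⟩, ham⟩ := hj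
  let _ : Field (A ⧸ m) := Ideal.Quotient.field m
  have : Module.Finite k (A ⧸ m) := finite_of_finite_type_of_isJacobsonRing k (A ⧸ m)
  let g : (A ⧸ m) →ₐ[k] k := IsAlgClosed.lift
  refine ⟨g.comp (Ideal.Quotient.mkₐ k m), fun h => ham ?_⟩
  rw [← Ideal.Quotient.eq_zero_iff_mem]
  exact (map_eq_zero g).mp h

theorem isDomain_tensorProduct [IsAlgClosed k] {A B : Type*} [CommRing A] [IsDomain A] [Algebra k A]
    [Algebra.FiniteType k A] [CommRing B] [IsDomain B] [Algebra k B] : IsDomain (A ⊗[k] B) := by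
  have : Nontrivial (A ⊗[k] B) := inferInstance
  let b := Module.Free.chooseBasis k B
  let β := Algebra.TensorProduct.basis A b
  let ev (f : A →ₐ[k] k) : A ⊗[k] B →ₐ[k] B :=
    Algebra.TensorProduct.lift ((Algebra.ofId k B).comp f) (AlgHom.id k B) fun _ _ => .all _ _
  have hev (f : A →ₐ[k] k) (s : A ⊗[k] B) (i) : b.repr (ev f s) i = f (β.repr s i) := by
    induction s using TensorProduct.induction_on with
    | zero => simp
    | add x y hx hy => simp [hx, hy]
    | tmul x y =>
      simp only [ev, β, Algebra.TensorProduct.lift_tmul, AlgHom.comp_apply, AlgHom.id_apply,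
        Algebra.TensorProduct.basis_repr_tmul, Algebra.ofId_apply, Finsupp.smul_apply,
        Finsupp.mapRange_apply, smul_eq_mul, map_mul, AlgHom.commutes, Algebra.algebraMap_self,
        RingHom.id_apply]
      rw [← Algebra.smul_def, map_smul, Finsupp.smul_apply, smul_eq_mul]
  have : NoZeroDivisors (A ⊗[k] B) := by
    refine ⟨fun {s t} hst => ?_⟩
    by_contra! hcon
    obtain ⟨i, hi⟩ : ∃ i, β.repr s i ≠ 0 := by
      by_contra! h
      exact hcon.1 (β.repr.map_eq_zero_iff.mp (Finsupp.ext h))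
    obtain ⟨j, hj⟩ : ∃ i, β.repr t i ≠ 0 := by
      by_contra! h
      exact hcon.2 (β.repr.map_eq_zero_iff.mp (Finsupp.ext h))
    obtain ⟨f, hf⟩ := exists_algHom_ne_zero (k := k) (mul_ne_zero hi hj)
    rw [map_mul] at hf
    have h0 : ev f s * ev f t = 0 := by rw [← map_mul, hst, map_zero]
    rcases mul_eq_zero.mp h0 with h | h
    · apply left_ne_zero_of_mul hf
      rw [← hev, h, map_zero, Finsupp.zero_apply]
    · apply right_ne_zero_of_mul hf
      rw [← hev, h, map_zero, Finsupp.zero_apply]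
  exact NoZeroDivisors.to_isDomain _

theorem eq_zero_of_tmul_one_mul {ι A B : Type*} [CommRing A] [Algebra k A] [CommRing B]
    [Algebra k B] {s : ι → A} (hs : ∀ a, (∀ j, s j * a = 0) → a = 0) (d : A ⊗[k] B)
    (hd : ∀ j, (s j ⊗ₜ[k] (1 : B)) * d = 0) : d = 0 := by
  let β := Algebra.TensorProduct.basis A (Module.Free.chooseBasis k B)
  refine β.repr.map_eq_zero_iff.mp (Finsupp.ext fun i => hs _ fun j => ?_)
  have : (s j ⊗ₜ[k] (1 : B)) * d = s j • d := by
    rw [Algebra.smul_def, Algebra.TensorProduct.algebraMap_apply, Algebra.algebraMap_self,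
      RingHom.id_apply]
  have h := hd j
  rw [this] at h
  have h2 := congr_arg (fun z => β.repr z i) h
  simpa using h2

theorem eq_zero_of_one_tmul_mul {ι A B : Type*} [CommRing A] [Algebra k A] [CommRing B]
    [Algebra k B] {s : ι → B} (hs : ∀ b, (∀ j, s j * b = 0) → b = 0) (d : A ⊗[k] B)
    (hd : ∀ j, ((1 : A) ⊗ₜ[k] s j) * d = 0) : d = 0 := by
  apply (Algebra.TensorProduct.comm k A B).injective
  rw [map_zero]
  refine eq_zero_of_tmul_one_mul hs _ fun j => ?_
  have := congr_arg (Algebra.TensorProduct.comm k A B) (hd j)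
  rwa [map_mul, map_zero, Algebra.TensorProduct.comm_tmul] at this

end Tensor

/-! ### Coordinates on products -/

section ProdRing

open MvPolynomial

variable {k : Type u} [Field k] {σ τ : Type} {𝔞 : Ideal (MvPolynomial σ k)}
  {𝔟 : Ideal (MvPolynomial τ k)}

variable (𝔞 𝔟) in
/-- A copy of `ProdRing 𝔞 𝔟`, for efficient instance search. -/
def ProdAlg : Type u := ProdRing 𝔞 𝔟

instance : CommRing (ProdAlg 𝔞 𝔟) := inferInstanceAs (CommRing (ProdRing 𝔞 𝔟))

instance : Algebra k (ProdAlg 𝔞 𝔟) := inferInstanceAs (Algebra k (ProdRing 𝔞 𝔟))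

variable (𝔞 𝔟) in
/-- The identity map. -/
def prodEquiv : ProdRing 𝔞 𝔟 ≃ₐ[k] ProdAlg 𝔞 𝔟 :=
  AlgEquiv.ofRingEquiv (f := RingEquiv.refl (ProdRing 𝔞 𝔟)) fun _ => rfl

variable (𝔞 𝔟) in
/-- The functions on the first factor. -/
def prodInl : (MvPolynomial σ k ⧸ 𝔞) →ₐ[k] ProdAlg 𝔞 𝔟 :=
  (prodEquiv 𝔞 𝔟).toAlgHom.comp Algebra.TensorProduct.includeLeft

variable (𝔞 𝔟) in
/-- The functions on the second factor. -/
def prodInr : (MvPolynomial τ k ⧸ 𝔟) →ₐ[k] ProdAlg 𝔞 𝔟 :=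
  (prodEquiv 𝔞 𝔟).toAlgHom.comp Algebra.TensorProduct.includeRight

theorem prodEquiv_tmul (a : MvPolynomial σ k ⧸ 𝔞) (b : MvPolynomial τ k ⧸ 𝔟) :
    prodEquiv 𝔞 𝔟 (a ⊗ₜ[k] b) = prodInl 𝔞 𝔟 a * prodInr 𝔞 𝔟 b := by
  change _ = prodEquiv 𝔞 𝔟 (a ⊗ₜ[k] 1) * prodEquiv 𝔞 𝔟 (1 ⊗ₜ[k] b)
  rw [← map_mul, Algebra.TensorProduct.tmul_mul_tmul, mul_one, one_mul]

theorem prodInl_injective [Nontrivial (MvPolynomial τ k ⧸ 𝔟)] :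
    Function.Injective (prodInl 𝔞 𝔟) :=
  (prodEquiv 𝔞 𝔟).injective.comp (Algebra.TensorProduct.includeLeft_injective (S := k)
    (algebraMap k (MvPolynomial τ k ⧸ 𝔟)).injective)

theorem prodInr_injective [Nontrivial (MvPolynomial σ k ⧸ 𝔞)] :
    Function.Injective (prodInr 𝔞 𝔟) :=
  (prodEquiv 𝔞 𝔟).injective.comp (Algebra.TensorProduct.includeRight_injective
    (algebraMap k (MvPolynomial σ k ⧸ 𝔞)).injective)

theorem isDomain_prodAlg [IsAlgClosed k] [Finite σ] [IsDomain (MvPolynomial σ k ⧸ 𝔞)]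
    [IsDomain (MvPolynomial τ k ⧸ 𝔟)] : IsDomain (ProdAlg 𝔞 𝔟) :=
  have := isDomain_tensorProduct (k := k) (A := MvPolynomial σ k ⧸ 𝔞) (B := MvPolynomial τ k ⧸ 𝔟)
  (prodEquiv 𝔞 𝔟).symm.toRingEquiv.toMulEquiv.isDomain (ProdRing 𝔞 𝔟)

theorem eq_zero_of_prodInl_mul {ι : Type*} {s : ι → MvPolynomial σ k ⧸ 𝔞}
    (hs : ∀ a, (∀ j, s j * a = 0) → a = 0) (d : ProdAlg 𝔞 𝔟)
    (hd : ∀ j, prodInl 𝔞 𝔟 (s j) * d = 0) : d = 0 := by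
  apply (prodEquiv 𝔞 𝔟).symm.injective
  rw [map_zero]
  refine eq_zero_of_tmul_one_mul hs _ fun j => ?_
  have := congr_arg (prodEquiv 𝔞 𝔟).symm (hd j)
  rwa [map_mul, map_zero] at this

theorem eq_zero_of_prodInr_mul {ι : Type*} {s : ι → MvPolynomial τ k ⧸ 𝔟}
    (hs : ∀ a, (∀ j, s j * a = 0) → a = 0) (d : ProdAlg 𝔞 𝔟)
    (hd : ∀ j, prodInr 𝔞 𝔟 (s j) * d = 0) : d = 0 := by
  apply (prodEquiv 𝔞 𝔟).symm.injective
  rw [map_zero]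
  refine eq_zero_of_one_tmul_mul hs _ fun j => ?_
  have := congr_arg (prodEquiv 𝔞 𝔟).symm (hd j)
  rwa [map_mul, map_zero] at this

variable (𝔞 𝔟) in
/-- The coordinate function `x_l` on `V(𝔞) × V(𝔟)`. -/
def prodX (l : σ) : ProdAlg 𝔞 𝔟 := prodInl 𝔞 𝔟 (Ideal.Quotient.mk 𝔞 (X l))

variable (𝔞 𝔟) in
/-- The coordinate function `y_j` on `V(𝔞) × V(𝔟)`. -/
def prodY (j : τ) : ProdAlg 𝔞 𝔟 := prodInr 𝔞 𝔟 (Ideal.Quotient.mk 𝔟 (X j))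

theorem prodEquiv_segreCoord (ij : σ × τ) :
    prodEquiv 𝔞 𝔟 (segreCoord 𝔞 𝔟 ij) = prodX 𝔞 𝔟 ij.1 * prodY 𝔞 𝔟 ij.2 :=
  prodEquiv_tmul _ _

theorem aeval_prodX (p : MvPolynomial σ k) :
    aeval (prodX 𝔞 𝔟) p = prodInl 𝔞 𝔟 (Ideal.Quotient.mk 𝔞 p) := by
  have : aeval (prodX 𝔞 𝔟) = (prodInl 𝔞 𝔟).comp (Ideal.Quotient.mkₐ k 𝔞) := by
    ext l : 1
    simp [prodX]
  rw [this]
  rfl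

theorem aeval_prodY (p : MvPolynomial τ k) :
    aeval (prodY 𝔞 𝔟) p = prodInr 𝔞 𝔟 (Ideal.Quotient.mk 𝔟 p) := by
  have : aeval (prodY 𝔞 𝔟) = (prodInr 𝔞 𝔟).comp (Ideal.Quotient.mkₐ k 𝔟) := by
    ext l : 1
    simp [prodY]
  rw [this]
  rfl

theorem aeval_prodX_eq_zero {p : MvPolynomial σ k} (hp : p ∈ 𝔞) : aeval (prodX 𝔞 𝔟) p = 0 := by
  rw [aeval_prodX, Ideal.Quotient.eq_zero_iff_mem.mpr hp, map_zero]

theorem aeval_prodY_eq_zero {p : MvPolynomial τ k} (hp : p ∈ 𝔟) : aeval (prodY 𝔞 𝔟) p = 0 := by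
  rw [aeval_prodY, Ideal.Quotient.eq_zero_iff_mem.mpr hp, map_zero]

variable {C : Type*} [CommRing C] [Algebra k C]

/-- A point of `V(𝔞) × V(𝔟)` with values in a `k`-algebra. -/
def prodLift (x : σ → C) (y : τ → C) (hx : 𝔞 ≤ RingHom.ker (aeval (R := k) x))
    (hy : 𝔟 ≤ RingHom.ker (aeval (R := k) y)) : ProdAlg 𝔞 𝔟 →ₐ[k] C :=
  (Algebra.TensorProduct.lift (Ideal.Quotient.liftₐ 𝔞 (aeval x) fun _ h => hx h)
    (Ideal.Quotient.liftₐ 𝔟 (aeval y) fun _ h => hy h) fun _ _ => .all _ _).comp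
    (prodEquiv 𝔞 𝔟).symm.toAlgHom

@[simp]
theorem prodLift_prodX (x : σ → C) (y : τ → C) (hx : 𝔞 ≤ RingHom.ker (aeval (R := k) x))
    (hy : 𝔟 ≤ RingHom.ker (aeval (R := k) y)) (l : σ) :
    prodLift x y hx hy (prodX 𝔞 𝔟 l) = x l := by
  change Algebra.TensorProduct.lift _ _ (fun _ _ => .all _ _) (Ideal.Quotient.mk 𝔞 (X l) ⊗ₜ[k] 1) = _
  rw [Algebra.TensorProduct.lift_tmul, map_one, mul_one]
  exact aeval_X _ _

@[simp]
theorem prodLift_prodY (x : σ → C) (y : τ → C) (hx : 𝔞 ≤ RingHom.ker (aeval (R := k) x))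
    (hy : 𝔟 ≤ RingHom.ker (aeval (R := k) y)) (l : τ) :
    prodLift x y hx hy (prodY 𝔞 𝔟 l) = y l := by
  change Algebra.TensorProduct.lift _ _ (fun _ _ => .all _ _) (1 ⊗ₜ[k] Ideal.Quotient.mk 𝔟 (X l)) = _
  rw [Algebra.TensorProduct.lift_tmul, map_one, one_mul]
  exact aeval_X _ _

variable (𝔞 𝔟) in
theorem prodAlg_surjective : Function.Surjective
    (aeval (Sum.elim (prodX 𝔞 𝔟) (prodY 𝔞 𝔟)) : MvPolynomial (σ ⊕ τ) k →ₐ[k] ProdAlg 𝔞 𝔟) := by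
  intro d
  obtain ⟨d, rfl⟩ := (prodEquiv 𝔞 𝔟).surjective d
  induction d using TensorProduct.induction_on with
  | zero => exact ⟨0, by rw [map_zero, map_zero]⟩
  | add a b ha hb =>
    obtain ⟨p, hp⟩ := ha
    obtain ⟨q, hq⟩ := hb
    exact ⟨p + q, by rw [map_add, map_add, hp, hq]⟩
  | tmul a b =>
    obtain ⟨p, rfl⟩ := Ideal.Quotient.mk_surjective a
    obtain ⟨q, rfl⟩ := Ideal.Quotient.mk_surjective b
    refine ⟨rename Sum.inl p * rename Sum.inr q, ?_⟩
    rw [prodEquiv_tmul, map_mul, aeval_rename, aeval_rename, Sum.elim_comp_inl, Sum.elim_comp_inr,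
      aeval_prodX, aeval_prodY]

theorem prodAlg_algHom_ext {f g : ProdAlg 𝔞 𝔟 →ₐ[k] C}
    (hX : ∀ l, f (prodX 𝔞 𝔟 l) = g (prodX 𝔞 𝔟 l)) (hY : ∀ j, f (prodY 𝔞 𝔟 j) = g (prodY 𝔞 𝔟 j)) :
    f = g := by
  rw [← AlgHom.cancel_right (prodAlg_surjective 𝔞 𝔟)]
  ext (l | j)
  · simpa using hX l
  · simpa using hY j

theorem prodAlg_induction {P : ProdAlg 𝔞 𝔟 → Prop}
    (hC : ∀ c : k, P (algebraMap k (ProdAlg 𝔞 𝔟) c))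
    (hadd : ∀ a b, P a → P b → P (a + b)) (hX : ∀ a l, P a → P (a * prodX 𝔞 𝔟 l))
    (hY : ∀ a j, P a → P (a * prodY 𝔞 𝔟 j)) (d : ProdAlg 𝔞 𝔟) : P d := by
  obtain ⟨p, rfl⟩ := prodAlg_surjective 𝔞 𝔟 d
  induction p using MvPolynomial.induction_on with
  | C a => simpa using hC a
  | add p q hp hq => rw [map_add]; exact hadd _ _ hp hq
  | mul_X p i hp =>
    rw [map_mul, aeval_X]
    rcases i with l | j
    · exact hX _ l hp
    · exact hY _ j hp

variable (𝔞 𝔟) in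
/-- The comorphism of `(x, y) ↦ (x_i y_j)`. -/
def prodSegre : MvPolynomial (σ × τ) k →ₐ[k] ProdAlg 𝔞 𝔟 :=
  aeval fun ij => prodX 𝔞 𝔟 ij.1 * prodY 𝔞 𝔟 ij.2

@[simp]
theorem prodSegre_X (ij : σ × τ) :
    prodSegre 𝔞 𝔟 (X ij) = prodX 𝔞 𝔟 ij.1 * prodY 𝔞 𝔟 ij.2 := aeval_X _ _

theorem prodEquiv_segreHom (p : MvPolynomial (σ × τ) k) :
    prodEquiv 𝔞 𝔟 (segreHom 𝔞 𝔟 p) = prodSegre 𝔞 𝔟 p := by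
  have : (prodEquiv 𝔞 𝔟).toAlgHom.comp (segreHom 𝔞 𝔟) = prodSegre 𝔞 𝔟 := by
    ext ij : 1
    rw [prodSegre_X, ← prodEquiv_segreCoord, AlgHom.comp_apply, segreHom, aeval_X]
    rfl
  exact congr($this p)

theorem mem_segreConeIdeal_iff (p : MvPolynomial (σ × τ) k) : p ∈ segreConeIdeal 𝔞 𝔟 ↔
    ∀ ij : σ × τ, ∃ n, (prodX 𝔞 𝔟 ij.1 * prodY 𝔞 𝔟 ij.2) ^ n * prodSegre 𝔞 𝔟 p = 0 := by
  rw [segreConeIdeal, Ideal.mem_iInf]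
  refine forall_congr' fun ij => ?_
  have key (n : ℕ) : segreCoord 𝔞 𝔟 ij ^ n * segreHom 𝔞 𝔟 p = 0 ↔
      (prodX 𝔞 𝔟 ij.1 * prodY 𝔞 𝔟 ij.2) ^ n * prodSegre 𝔞 𝔟 p = 0 := by
    rw [← prodEquiv_segreHom, ← prodEquiv_segreCoord, ← map_pow, ← map_mul]
    exact (map_eq_zero_iff _ (prodEquiv 𝔞 𝔟).injective).symm
  rw [RingHom.mem_ker, AlgHom.comp_apply, IsScalarTower.coe_toAlgHom',
    IsLocalization.map_eq_zero_iff (Submonoid.powers (segreCoord 𝔞 𝔟 ij))]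
  constructor
  · rintro ⟨⟨_, n, rfl⟩, h⟩
    exact ⟨n, (key n).mp h⟩
  · rintro ⟨n, h⟩
    exact ⟨⟨_, n, rfl⟩, (key n).mpr h⟩

end ProdRing
end EllipticCone
end

noncomputable section

namespace EllipticCone

/-! ### The charts of the blow-up -/

set_option linter.unusedSectionVars false

section Charts

open MvPolynomial

variable {k : Type u} [Field k] [IsAlgClosed k] {F : MvPolynomial (Fin 3) k}

theorem IsSmoothPlaneCubic.isDomain (hF : IsSmoothPlaneCubic F) :
    IsDomain (MvPolynomial (Fin 3) k ⧸ Ideal.span {F}) := by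
  rw [Ideal.Quotient.isDomain_iff_prime, Ideal.span_singleton_prime hF.ne_zero]
  exact hF.irreducible.prime

theorem IsSmoothPlaneCubic.mk_ne_zero (hF : IsSmoothPlaneCubic F) {G : MvPolynomial (Fin 3) k}
    (hG : G ≠ 0) (hd : G.totalDegree < 3) : Ideal.Quotient.mk (Ideal.span {F}) G ≠ 0 := by
  rw [Ne, Ideal.Quotient.eq_zero_iff_mem, Ideal.mem_span_singleton]
  intro h
  have := totalDegree_le_of_dvd_of_isDomain h hG
  rw [hF.isHomogeneous.totalDegree hF.ne_zero] at this
  omega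

theorem IsSmoothPlaneCubic.mk_X_ne_zero (hF : IsSmoothPlaneCubic F) (i : Fin 3) :
    Ideal.Quotient.mk (Ideal.span {F}) (X i) ≠ 0 :=
  hF.mk_ne_zero (X_ne_zero i) (by rw [totalDegree_X]; omega)

theorem IsSmoothPlaneCubic.mk_X_sub_one_ne_zero (hF : IsSmoothPlaneCubic F) (i : Fin 3) :
    Ideal.Quotient.mk (Ideal.span {F}) (X i - 1) ≠ 0 := by
  refine hF.mk_ne_zero (fun h => ?_) (lt_of_le_of_lt (totalDegree_sub _ _) ?_)
  · have := congr_arg (eval (0 : Fin 3 → k)) h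
    simp at this
  · simp

/-- The ideal of the affine curve `{F = 0, x_i = 1}`. -/
abbrev affineIdeal (F : MvPolynomial (Fin 3) k) (i : Fin 3) : Ideal (MvPolynomial (Fin 3) k) :=
  Ideal.span {F, X i - 1}

theorem affineIdeal_le_ker {C : Type*} [CommRing C] [Algebra k C] {i : Fin 3} {x : Fin 3 → C}
    (hx : aeval x F = 0) (hi : x i = 1) : affineIdeal F i ≤ RingHom.ker (aeval (R := k) x) := by
  rw [Ideal.span_le]
  rintro p (rfl | rfl)
  · exact hx
  · simp [hi]

theorem span_singleton_le_ker {C : Type*} [CommRing C] [Algebra k C] {x : Fin 3 → C}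
    (hx : aeval x F = 0) : Ideal.span {F} ≤ RingHom.ker (aeval (R := k) x) := by
  rw [Ideal.span_le, Set.singleton_subset_iff]
  exact hx

theorem IsSmoothPlaneCubic.isDomain_affine (hF : IsSmoothPlaneCubic F) (i : Fin 3) :
    IsDomain (MvPolynomial (Fin 3) k ⧸ affineIdeal F i) := by
  have := hF.isDomain
  set A := MvPolynomial (Fin 3) k ⧸ Ideal.span {F}
  let L := Localization.Away (Ideal.Quotient.mk (Ideal.span {F}) (X i))
  let v : Fin 3 → L := fun l => algebraMap A L (Ideal.Quotient.mk (Ideal.span {F}) (X l))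
  let c : L := IsLocalization.Away.invSelf (Ideal.Quotient.mk (Ideal.span {F}) (X i))
  have hvc : c * v i = 1 := by
    rw [mul_comm]
    exact IsLocalization.Away.mul_invSelf _
  have hv : aeval v F = 0 := by
    have : aeval v = (IsScalarTower.toAlgHom k A L).comp (Ideal.Quotient.mkₐ k (Ideal.span {F})) := by
      ext l : 1
      rw [aeval_X]
      rfl
    rw [this, AlgHom.comp_apply]
    have h0 : Ideal.Quotient.mkₐ k (Ideal.span {F}) F = 0 :=
      Ideal.Quotient.eq_zero_iff_mem.mpr (Ideal.mem_span_singleton_self F)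
    rw [h0, map_zero]
  let f : (MvPolynomial (Fin 3) k ⧸ affineIdeal F i) →ₐ[k] L :=
    Ideal.Quotient.liftₐ _ (aeval fun l => c * v l) (affineIdeal_le_ker
      (by rw [aeval_mul_of_isHomogeneous hF.isHomogeneous, hv, mul_zero]) hvc)
  let g₀ : A →+* MvPolynomial (Fin 3) k ⧸ affineIdeal F i :=
    Ideal.Quotient.factor (Ideal.span_mono (by simp))
  have hi1 : Ideal.Quotient.mk (affineIdeal F i) (X i) = 1 := by
    rw [← sub_eq_zero, ← map_one (Ideal.Quotient.mk (affineIdeal F i)), ← map_sub,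
      Ideal.Quotient.eq_zero_iff_mem]
    exact Ideal.subset_span (by simp)
  have hu : IsUnit (g₀ (Ideal.Quotient.mk (Ideal.span {F}) (X i))) := by
    change IsUnit (Ideal.Quotient.mk (affineIdeal F i) (X i))
    rw [hi1]
    exact isUnit_one
  let g : L →+* MvPolynomial (Fin 3) k ⧸ affineIdeal F i := IsLocalization.Away.lift _ hu
  have hgv (l) : g (v l) = Ideal.Quotient.mk (affineIdeal F i) (X l) :=
    IsLocalization.Away.lift_eq _ hu _
  have hgc : g c = 1 := by
    have := congr_arg g hvc
    rwa [map_mul, hgv, hi1, mul_one, map_one] at this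
  have hgf : (g.comp f.toRingHom).comp (Ideal.Quotient.mk (affineIdeal F i)) =
      Ideal.Quotient.mk (affineIdeal F i) := by
    refine MvPolynomial.ringHom_ext (fun r => ?_) fun l => ?_
    · change g (aeval (fun l => c * v l) (C r)) = _
      rw [aeval_C, IsScalarTower.algebraMap_apply k A L]
      exact IsLocalization.Away.lift_eq _ hu _
    · change g (aeval (fun l => c * v l) (X l)) = _
      rw [aeval_X, map_mul, hgc, one_mul, hgv]
  have hinj : Function.Injective f := by
    refine Function.LeftInverse.injective (g := g) fun a => ?_
    obtain ⟨a, rfl⟩ := Ideal.Quotient.mk_surjective a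
    exact congr($hgf a)
  have : IsDomain L := IsLocalization.isDomain_localization (powers_le_nonZeroDivisors_of_noZeroDivisors
    (hF.mk_X_ne_zero i))
  exact hinj.isDomain f.toRingHom

/-- The coordinate ring of the chart `x_i = 1` of `E₁` times the cone over `E₂`. -/
abbrev ChartRing (F₁ F₂ : MvPolynomial (Fin 3) k) (i : Fin 3) : Type u :=
  ProdAlg (affineIdeal F₁ i) (Ideal.span {F₂})

variable {F₁ F₂ ℓ : MvPolynomial (Fin 3) k}

theorem isDomain_coneProd (hF₁ : IsSmoothPlaneCubic F₁) (hF₂ : IsSmoothPlaneCubic F₂) :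
    IsDomain (ProdAlg (Ideal.span {F₁}) (Ideal.span {F₂})) := by
  have := hF₁.isDomain
  have := hF₂.isDomain
  exact isDomain_prodAlg

theorem isDomain_chartRing (hF₁ : IsSmoothPlaneCubic F₁) (hF₂ : IsSmoothPlaneCubic F₂)
    (i : Fin 3) : IsDomain (ChartRing F₁ F₂ i) := by
  have := hF₁.isDomain_affine i
  have := hF₂.isDomain
  exact isDomain_prodAlg

theorem prodX_ne_zero (hF₁ : IsSmoothPlaneCubic F₁) (hF₂ : IsSmoothPlaneCubic F₂) (l : Fin 3) :
    prodX (Ideal.span {F₁}) (Ideal.span {F₂}) l ≠ 0 := by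
  have := hF₂.isDomain
  exact (map_ne_zero_iff _ prodInl_injective).mpr (hF₁.mk_X_ne_zero l)

theorem prodY_ne_zero (hF₂ : IsSmoothPlaneCubic F₂) {𝔞 : Ideal (MvPolynomial (Fin 3) k)}
    [Nontrivial (MvPolynomial (Fin 3) k ⧸ 𝔞)] (j : Fin 3) :
    prodY 𝔞 (Ideal.span {F₂}) j ≠ 0 :=
  (map_ne_zero_iff _ prodInr_injective).mpr (hF₂.mk_X_ne_zero j)

theorem mem_segreConeIdeal_iff_prodSegre_eq_zero (hF₁ : IsSmoothPlaneCubic F₁)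
    (hF₂ : IsSmoothPlaneCubic F₂) (p : MvPolynomial (Fin 3 × Fin 3) k) :
    p ∈ segreConeIdeal (Ideal.span {F₁}) (Ideal.span {F₂}) ↔
      prodSegre (Ideal.span {F₁}) (Ideal.span {F₂}) p = 0 := by
  have := isDomain_coneProd hF₁ hF₂
  have := hF₁.isDomain
  rw [mem_segreConeIdeal_iff]
  constructor
  · intro h
    obtain ⟨n, hn⟩ := h (0, 0)
    refine (mul_eq_zero.mp hn).resolve_left (pow_ne_zero _ (mul_ne_zero
      (prodX_ne_zero hF₁ hF₂ 0) (prodY_ne_zero hF₂ 0)))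
  · intro h ij
    exact ⟨0, by rw [h, mul_zero]⟩

/-- Restriction of functions from the product of the cones to a chart. -/
def toChart (F₁ F₂ : MvPolynomial (Fin 3) k) (i : Fin 3) :
    ProdAlg (Ideal.span {F₁}) (Ideal.span {F₂}) →ₐ[k] ChartRing F₁ F₂ i :=
  prodLift (prodX _ _) (prodY _ _)
    (span_singleton_le_ker (aeval_prodX_eq_zero (Ideal.subset_span (by simp))))
    (span_singleton_le_ker (aeval_prodY_eq_zero (Ideal.subset_span (by simp))))

theorem prodX_self (i : Fin 3) : prodX (affineIdeal F₁ i) (Ideal.span {F₂}) i = 1 := by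
  have := aeval_prodX_eq_zero (𝔟 := Ideal.span {F₂})
    (Ideal.subset_span (by simp) : X i - 1 ∈ affineIdeal F₁ i)
  rwa [map_sub, aeval_X, map_one, sub_eq_zero] at this

theorem prodSegre_eq_zero_of_toChart (hF₁ : IsSmoothPlaneCubic F₁) (hF₂ : IsSmoothPlaneCubic F₂)
    (i : Fin 3) {p : MvPolynomial (Fin 3 × Fin 3) k}
    (hp : toChart F₁ F₂ i (prodSegre _ _ p) = 0) :
    prodSegre (Ideal.span {F₁}) (Ideal.span {F₂}) p = 0 := by
  have := isDomain_coneProd hF₁ hF₂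
  let D := ProdAlg (Ideal.span {F₁}) (Ideal.span {F₂})
  let xi : D := prodX _ _ i
  let L := Localization.Away xi
  let ι : D →ₐ[k] L := IsScalarTower.toAlgHom k D L
  let c : L := IsLocalization.Away.invSelf xi
  have hc : c * ι xi = 1 := by
    rw [mul_comm]
    exact IsLocalization.Away.mul_invSelf _
  let ψ : ChartRing F₁ F₂ i →ₐ[k] L :=
    prodLift (fun l => c * ι (prodX _ _ l)) (fun j => ι xi * ι (prodY _ _ j))
      (affineIdeal_le_ker (by
        rw [aeval_mul_of_isHomogeneous hF₁.isHomogeneous, ← comp_aeval_apply,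
          aeval_prodX_eq_zero (Ideal.subset_span (by simp)), map_zero, mul_zero]) hc)
      (span_singleton_le_ker (by
        rw [aeval_mul_of_isHomogeneous hF₂.isHomogeneous, ← comp_aeval_apply,
          aeval_prodY_eq_zero (Ideal.subset_span (by simp)), map_zero, mul_zero]))
  have hψ : (ψ.comp (toChart F₁ F₂ i)).comp (prodSegre _ _) =
      ι.comp (prodSegre (Ideal.span {F₁}) (Ideal.span {F₂})) := by
    ext lj : 1
    simp only [AlgHom.comp_apply, prodSegre_X, map_mul, toChart, ψ, prodLift_prodX, prodLift_prodY]
    have h1 : ι (prodSegre _ _ (X lj)) = ι (prodX _ _ lj.1) * ι (prodY _ _ lj.2) := by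
      rw [prodSegre_X]
      exact map_mul ι _ _
    rw [h1]
    linear_combination (ι (prodX _ _ lj.1) * ι (prodY _ _ lj.2)) * hc
  have hι : Function.Injective ι := IsLocalization.injective L
    (powers_le_nonZeroDivisors_of_noZeroDivisors (prodX_ne_zero hF₁ hF₂ i))
  apply hι
  rw [map_zero, ← AlgHom.comp_apply, ← hψ, AlgHom.comp_apply, AlgHom.comp_apply, hp, map_zero]

/-- The restriction of functions from the cone `Y` to a chart of the blow-up. -/
def coneToChart (hF₁ : IsSmoothPlaneCubic F₁) (hF₂ : IsSmoothPlaneCubic F₂) (i : Fin 3) :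
    coneRing F₁ F₂ →ₐ[k] ChartRing F₁ F₂ i :=
  Ideal.Quotient.liftₐ _ ((toChart F₁ F₂ i).comp (prodSegre _ _)) fun p hp => by
    rw [AlgHom.comp_apply, (mem_segreConeIdeal_iff_prodSegre_eq_zero hF₁ hF₂ p).mp hp, map_zero]

variable (F₁ F₂) in
/-- The coordinate function `z_lj` on `Y`. -/
def coneZ (lj : Fin 3 × Fin 3) : coneRing F₁ F₂ := Ideal.Quotient.mk _ (X lj)

theorem coneToChart_mk (hF₁ : IsSmoothPlaneCubic F₁) (hF₂ : IsSmoothPlaneCubic F₂) (i : Fin 3)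
    (p : MvPolynomial (Fin 3 × Fin 3) k) :
    coneToChart hF₁ hF₂ i (Ideal.Quotient.mk _ p) = toChart F₁ F₂ i (prodSegre _ _ p) := rfl

@[simp]
theorem coneToChart_coneZ (hF₁ : IsSmoothPlaneCubic F₁) (hF₂ : IsSmoothPlaneCubic F₂) (i : Fin 3)
    (lj : Fin 3 × Fin 3) :
    coneToChart hF₁ hF₂ i (coneZ F₁ F₂ lj) = prodX _ _ lj.1 * prodY _ _ lj.2 := by
  rw [coneZ, coneToChart_mk, prodSegre_X, map_mul, toChart, prodLift_prodX, prodLift_prodY]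

theorem coneToChart_injective (hF₁ : IsSmoothPlaneCubic F₁) (hF₂ : IsSmoothPlaneCubic F₂)
    (i : Fin 3) : Function.Injective (coneToChart hF₁ hF₂ i) := by
  rw [injective_iff_map_eq_zero]
  intro r hr
  obtain ⟨p, rfl⟩ := Ideal.Quotient.mk_surjective r
  rw [coneToChart_mk] at hr
  exact Ideal.Quotient.eq_zero_iff_mem.mpr ((mem_segreConeIdeal_iff_prodSegre_eq_zero hF₁ hF₂ p).mpr
    (prodSegre_eq_zero_of_toChart hF₁ hF₂ i hr))

theorem isDomain_coneRing (hF₁ : IsSmoothPlaneCubic F₁) (hF₂ : IsSmoothPlaneCubic F₂) :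
    IsDomain (coneRing F₁ F₂) := by
  have := isDomain_chartRing hF₁ hF₂ 0
  exact (coneToChart_injective hF₁ hF₂ 0).isDomain (coneToChart hF₁ hF₂ 0).toRingHom

end Charts
end EllipticCone
end

noncomputable section

namespace EllipticCone

/-! ### The ideal of the centre of the blow-up -/

set_option linter.unusedSectionVars false

section Centre

open MvPolynomial

variable {k : Type u} [Field k]

theorem pderiv_eq_C_of_isHomogeneous_one {ℓ : MvPolynomial (Fin 3) k} (hℓ : ℓ.IsHomogeneous 1)
    (j : Fin 3) : pderiv j ℓ = C (coeff 0 (pderiv j ℓ)) := by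
  have h : (pderiv j ℓ).IsHomogeneous 0 := hℓ.pderiv
  exact totalDegree_eq_zero_iff_eq_C.mp (Nat.le_zero.mp h.totalDegree_le)

theorem eq_sum_of_isHomogeneous_one {ℓ : MvPolynomial (Fin 3) k} (hℓ : ℓ.IsHomogeneous 1) :
    ℓ = ∑ j, C (coeff 0 (pderiv j ℓ)) * X j := by
  have h := hℓ.sum_X_mul_pderiv
  rw [one_smul] at h
  conv_lhs => rw [← h]
  refine Finset.sum_congr rfl fun j _ => ?_
  rw [mul_comm, ← pderiv_eq_C_of_isHomogeneous_one hℓ]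

variable [IsAlgClosed k]

/-- The ideal `(F, ℓ)` is saturated. -/
theorem IsSmoothPlaneCubic.mem_of_pow_X_mul_mem {F ℓ : MvPolynomial (Fin 3) k}
    (hF : IsSmoothPlaneCubic F) (hℓ : ℓ.IsHomogeneous 1) (hℓ0 : ℓ ≠ 0) (N : Fin 3 → ℕ)
    {b : MvPolynomial (Fin 3) k} (hb : ∀ j, X j ^ N j * b ∈ Ideal.span {F, ℓ}) :
    b ∈ Ideal.span {F, ℓ} := by
  set c : Fin 3 → k := fun j => coeff 0 (pderiv j ℓ) with hc
  have hsum : ℓ = ∑ j, C (c j) * X j := eq_sum_of_isHomogeneous_one hℓ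
  obtain ⟨m, hm⟩ : ∃ m, c m ≠ 0 := by
    by_contra! h
    apply hℓ0
    rw [hsum]
    simp [h]
  let e : MvPolynomial (Fin 3) k →ₐ[k] MvPolynomial (Fin 3) k :=
    aeval fun j => X j - if j = m then C (c m)⁻¹ * ℓ else 0
  have heX (j) (hj : j ≠ m) : e (X j) = X j := by simp [e, hj]
  have heℓ : e ℓ = 0 := by
    have h1 : e ℓ = ∑ j, C (c j) * (X j - if j = m then C (c m)⁻¹ * ℓ else 0) := by
      conv_lhs => rw [hsum]
      simp [e, algebraMap_eq]
    rw [h1]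
    simp only [mul_sub, Finset.sum_sub_distrib, mul_ite, mul_zero, Finset.sum_ite_eq',
      Finset.mem_univ, if_true]
    rw [← hsum, ← mul_assoc, ← C_mul, mul_inv_cancel₀ hm, C_1, one_mul, sub_self]
  have hmod (f) : f - e f ∈ Ideal.span {ℓ} := by
    have : (Ideal.Quotient.mkₐ k (Ideal.span {ℓ})).comp e = Ideal.Quotient.mkₐ k (Ideal.span {ℓ}) := by
      ext j : 1
      rw [AlgHom.comp_apply]
      by_cases hj : j = m
      · have h0 : Ideal.Quotient.mkₐ k (Ideal.span {ℓ}) ℓ = 0 :=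
          Ideal.Quotient.eq_zero_iff_mem.mpr (Ideal.mem_span_singleton_self ℓ)
        simp only [e, aeval_X, hj, if_true, map_sub, map_mul, h0, mul_zero, sub_zero]
      · rw [heX j hj]
    rw [← Ideal.Quotient.eq_zero_iff_mem, map_sub, sub_eq_zero]
    exact congr($this f).symm
  have heF : e F ≠ 0 := by
    intro h
    have := hmod F
    rw [h, sub_zero, Ideal.mem_span_singleton] at this
    obtain ⟨g, hg⟩ := this
    have hℓu : ¬ IsUnit ℓ := by
      rw [isUnit_iff_totalDegree_of_isReduced, hℓ.totalDegree hℓ0]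
      omega
    have hgu := (hF.irreducible.isUnit_or_isUnit hg).resolve_left hℓu
    have hg0 : g ≠ 0 := hgu.ne_zero
    rw [isUnit_iff_totalDegree_of_isReduced] at hgu
    have hd := totalDegree_mul_of_isDomain hℓ0 hg0
    rw [← hg, hF.isHomogeneous.totalDegree hF.ne_zero, hℓ.totalDegree hℓ0] at hd
    omega
  have hdvd (j) (hj : j ≠ m) : e F ∣ X j ^ N j * e b := by
    obtain ⟨g, h, hgh⟩ := Ideal.mem_span_pair.mp (hb j)
    have := congr_arg e hgh
    rw [map_add, map_mul, map_mul, heℓ, mul_zero, add_zero, map_mul, map_pow, heX j hj] at this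
    exact ⟨e g, by rw [← this, mul_comm]⟩
  obtain ⟨j, j', hj, hj', hjj'⟩ : ∃ j j', j ≠ m ∧ j' ≠ m ∧ j ≠ j' := by
    fin_cases m
    · exact ⟨1, 2, by decide, by decide, by decide⟩
    · exact ⟨0, 2, by decide, by decide, by decide⟩
    · exact ⟨0, 1, by decide, by decide, by decide⟩
  obtain ⟨g, hg⟩ := hdvd j hj
  obtain ⟨g', hg'⟩ := hdvd j' hj'
  have hgg' : X j' ^ N j' * g = X j ^ N j * g' := by
    apply mul_left_cancel₀ heF
    linear_combination X j ^ N j * hg' - X j' ^ N j' * hg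
  have hXg : X j ^ N j ∣ g := by
    refine (X_prime (i := j)).pow_dvd_of_dvd_mul_left (N j) (fun h => ?_) ⟨g', hgg'⟩
    exact hjj' (X_dvd_X.mp ((X_prime (i := j)).dvd_of_dvd_pow h))
  obtain ⟨g'', rfl⟩ := hXg
  have heb : e b = e F * g'' := by
    apply mul_left_cancel₀ (pow_ne_zero (N j) (X_ne_zero (R := k) j))
    linear_combination hg
  have hle : Ideal.span {ℓ} ≤ Ideal.span {F, ℓ} := Ideal.span_mono (by simp)
  have hFmem : e F ∈ Ideal.span {F, ℓ} := by
    rw [← sub_sub_self F (e F)]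
    exact sub_mem (Ideal.subset_span (by simp)) (hle (hmod F))
  rw [← sub_add_cancel b (e b), heb]
  refine add_mem ?_ (Ideal.mul_mem_right _ _ hFmem)
  rw [← heb]
  exact hle (hmod b)

variable {F₁ F₂ ℓ : MvPolynomial (Fin 3) k}

theorem prodSegre_eq_zero_of_mem (hF₁ : IsSmoothPlaneCubic F₁) (hF₂ : IsSmoothPlaneCubic F₂)
    (hℓ : ℓ.IsHomogeneous 1) (hℓ0 : ℓ ≠ 0) {p : MvPolynomial (Fin 3 × Fin 3) k}
    (hp : p ∈ segreConeIdeal (Ideal.span {F₁}) (Ideal.span {F₂, ℓ})) :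
    prodSegre (Ideal.span {F₁}) (Ideal.span {F₂, ℓ}) p = 0 := by
  have := hF₁.isDomain
  rw [mem_segreConeIdeal_iff] at hp
  choose n hn using hp
  refine eq_zero_of_prodInr_mul (s := fun j => Ideal.Quotient.mk _ (X j) ^ n (0, j)) ?_ _ ?_
  · intro b hb
    obtain ⟨b, rfl⟩ := Ideal.Quotient.mk_surjective b
    rw [Ideal.Quotient.eq_zero_iff_mem]
    refine hF₂.mem_of_pow_X_mul_mem hℓ hℓ0 (fun j => n (0, j)) fun j => ?_
    rw [← Ideal.Quotient.eq_zero_iff_mem, map_mul, map_pow]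
    exact hb j
  · intro j
    refine eq_zero_of_prodInl_mul (ι := Unit) (s := fun _ => Ideal.Quotient.mk _ (X 0) ^ n (0, j))
      (fun a ha => (mul_eq_zero.mp (ha ())).resolve_left (pow_ne_zero _ (hF₁.mk_X_ne_zero 0)))
      _ fun _ => ?_
    have := hn (0, j)
    rw [mul_pow, mul_assoc] at this
    rw [map_pow, map_pow]
    exact this

theorem exists_prodSegre_eq_mul {p : MvPolynomial (Fin 3 × Fin 3) k}
    (hp : prodSegre (Ideal.span {F₁}) (Ideal.span {F₂, ℓ}) p = 0) :
    ∃ c, prodSegre (Ideal.span {F₁}) (Ideal.span {F₂}) p = aeval (prodY _ _) ℓ * c := by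
  let D := ProdAlg (Ideal.span {F₁}) (Ideal.span {F₂})
  let I : Ideal D := Ideal.span {aeval (prodY _ _) ℓ}
  let q : D →ₐ[k] D ⧸ I := Ideal.Quotient.mkₐ k I
  let f : ProdAlg (Ideal.span {F₁}) (Ideal.span {F₂, ℓ}) →ₐ[k] D ⧸ I :=
    prodLift (fun l => q (prodX _ _ l)) (fun j => q (prodY _ _ j))
      (span_singleton_le_ker (by
        rw [← comp_aeval_apply, aeval_prodX_eq_zero (Ideal.subset_span (by simp)), map_zero]))
      (by
        rw [Ideal.span_le]
        rintro _ (rfl | rfl)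
        · change aeval _ _ = 0
          rw [← comp_aeval_apply, aeval_prodY_eq_zero (Ideal.subset_span (by simp)), map_zero]
        · change aeval _ _ = 0
          rw [← comp_aeval_apply]
          exact Ideal.Quotient.eq_zero_iff_mem.mpr (Ideal.mem_span_singleton_self _))
  have hf : f.comp (prodSegre _ _) = q.comp (prodSegre (Ideal.span {F₁}) (Ideal.span {F₂})) := by
    ext lj : 1
    simp only [f, AlgHom.comp_apply, prodSegre_X, map_mul, prodLift_prodX, prodLift_prodY]
    rw [prodSegre_X]
    exact (map_mul q _ _).symm
  have h0 : q (prodSegre _ _ p) = 0 := by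
    rw [← AlgHom.comp_apply, ← hf, AlgHom.comp_apply, hp, map_zero]
  exact Ideal.mem_span_singleton.mp (Ideal.Quotient.eq_zero_iff_mem.mp h0)

section Weights

section SignedPow

variable {Q D : Type*} [CommRing Q] [CommRing D] [Algebra Q D] (M N : Submodule Q D)

/-- The powers of `M`, and in negative degrees those of `N`. -/
def signedPow : ℤ → Submodule Q D
  | .ofNat n => M ^ n
  | .negSucc n => N ^ (n + 1)

variable {M N}

theorem signedPow_mul_left_le (h : M * N ≤ 1) (n : ℤ) :
    signedPow M N n * M ≤ signedPow M N (n + 1) := by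
  rcases n with n | n
  · exact (pow_succ M n).ge
  · have h1 : N ^ (n + 1) * M ≤ N ^ n := by
      rw [pow_succ, mul_assoc, mul_comm N M]
      exact (mul_le_mul_right h _).trans (mul_one _).le
    rcases n with _ | n
    · exact h1
    · exact h1

theorem signedPow_mul_right_le (h : M * N ≤ 1) (n : ℤ) :
    signedPow M N n * N ≤ signedPow M N (n - 1) := by
  rcases n with (_ | n) | n
  · change M ^ 0 * N ≤ N ^ (0 + 1)
    rw [pow_zero, one_mul, zero_add, pow_one]
  · have h1 : M ^ (n + 1) * N ≤ M ^ n := by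
      rw [pow_succ, mul_assoc]
      exact (mul_le_mul_right h _).trans (mul_one _).le
    have h2 : Int.ofNat (n + 1) - 1 = Int.ofNat n := by
      change ((n + 1 : ℕ) : ℤ) - 1 = n
      omega
    rw [h2]
    exact h1
  · exact (pow_succ N (n + 1)).ge

end SignedPow

variable (F₁ F₂)

/-- The functions of degree `n` for the grading with `deg x_l = 1`, `deg y_j = -1`. -/
def weightPart : ℤ → Submodule (prodSegre (Ideal.span {F₁}) (Ideal.span {F₂})).range
    (ProdAlg (Ideal.span {F₁}) (Ideal.span {F₂})) :=
  signedPow (Submodule.span _ (Set.range (prodX _ _))) (Submodule.span _ (Set.range (prodY _ _)))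

theorem span_prodX_mul_span_prodY :
    Submodule.span (prodSegre (Ideal.span {F₁}) (Ideal.span {F₂})).range
        (Set.range (prodX (Ideal.span {F₁}) (Ideal.span {F₂}))) *
      Submodule.span _ (Set.range (prodY _ _)) ≤ 1 := by
  rw [Submodule.span_mul_span, Submodule.span_le]
  rintro _ ⟨_, ⟨l, rfl⟩, _, ⟨j, rfl⟩, rfl⟩
  exact Submodule.mem_one.mpr ⟨⟨_, X (l, j), prodSegre_X _⟩, rfl⟩

variable {F₁ F₂}

theorem mul_prodX_mem_weightPart {n : ℤ} {d : ProdAlg (Ideal.span {F₁}) (Ideal.span {F₂})}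
    (hd : d ∈ weightPart F₁ F₂ n) (l : Fin 3) : d * prodX _ _ l ∈ weightPart F₁ F₂ (n + 1) :=
  signedPow_mul_left_le (span_prodX_mul_span_prodY F₁ F₂) n
    (Submodule.mul_mem_mul hd (Submodule.subset_span (Set.mem_range_self l)))

theorem mul_prodY_mem_weightPart {n : ℤ} {d : ProdAlg (Ideal.span {F₁}) (Ideal.span {F₂})}
    (hd : d ∈ weightPart F₁ F₂ n) (l : Fin 3) : d * prodY _ _ l ∈ weightPart F₁ F₂ (n - 1) :=
  signedPow_mul_right_le (span_prodX_mul_span_prodY F₁ F₂) n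
    (Submodule.mul_mem_mul hd (Submodule.subset_span (Set.mem_range_self l)))

theorem aeval_T_mul {σ D : Type*} [CommRing D] [Algebra k D] {F : MvPolynomial σ k} {n : ℕ}
    (hF : F.IsHomogeneous n) (m : ℤ) (x : σ → D) :
    aeval (fun l => (LaurentPolynomial.T m * LaurentPolynomial.C (x l) : LaurentPolynomial D)) F =
      LaurentPolynomial.T m ^ n * LaurentPolynomial.C (aeval x F) := by
  rw [aeval_mul_of_isHomogeneous hF]
  congr 1
  exact aeval_algebraMap_apply (LaurentPolynomial D) x F

/-- The coaction `x_l ↦ T x_l`, `y_j ↦ T⁻¹ y_j`. -/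
def coaction (hF₁ : IsSmoothPlaneCubic F₁) (hF₂ : IsSmoothPlaneCubic F₂) :
    ProdAlg (Ideal.span {F₁}) (Ideal.span {F₂}) →ₐ[k]
      LaurentPolynomial (ProdAlg (Ideal.span {F₁}) (Ideal.span {F₂})) :=
  prodLift (fun l => LaurentPolynomial.T 1 * LaurentPolynomial.C (prodX _ _ l))
    (fun l => LaurentPolynomial.T (-1) * LaurentPolynomial.C (prodY _ _ l))
    (span_singleton_le_ker (by
      rw [aeval_T_mul hF₁.isHomogeneous, aeval_prodX_eq_zero (Ideal.subset_span (by simp)),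
        map_zero, mul_zero]))
    (span_singleton_le_ker (by
      rw [aeval_T_mul hF₂.isHomogeneous, aeval_prodY_eq_zero (Ideal.subset_span (by simp)),
        map_zero, mul_zero]))

theorem coaction_prodX (hF₁ : IsSmoothPlaneCubic F₁) (hF₂ : IsSmoothPlaneCubic F₂) (l : Fin 3) :
    coaction hF₁ hF₂ (prodX _ _ l) = LaurentPolynomial.T 1 * LaurentPolynomial.C (prodX _ _ l) :=
  prodLift_prodX _ _ _ _ l

theorem coaction_prodY (hF₁ : IsSmoothPlaneCubic F₁) (hF₂ : IsSmoothPlaneCubic F₂) (l : Fin 3) :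
    coaction hF₁ hF₂ (prodY _ _ l) = LaurentPolynomial.T (-1) * LaurentPolynomial.C (prodY _ _ l) :=
  prodLift_prodY _ _ _ _ l

theorem coeff_mul_T_mul_C {D : Type*} [CommRing D] (f : LaurentPolynomial D) (m n : ℤ)
    (d : D) : (f * (LaurentPolynomial.T m * LaurentPolynomial.C d)).coeff n =
      f.coeff (n - m) * d := by
  rw [LaurentPolynomial.T_mul, ← LaurentPolynomial.single_eq_C_mul_T]
  exact AddMonoidAlgebra.coeff_mul_single_eq_coeff_mul _ fun _ _ => eq_sub_iff_add_eq.symm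

theorem coeff_coaction_mem (hF₁ : IsSmoothPlaneCubic F₁) (hF₂ : IsSmoothPlaneCubic F₂)
    (d : ProdAlg (Ideal.span {F₁}) (Ideal.span {F₂})) (n : ℤ) :
    (coaction hF₁ hF₂ d).coeff n ∈ weightPart F₁ F₂ n := by
  induction d using prodAlg_induction generalizing n with
  | hC c =>
    rw [AlgHom.commutes, IsScalarTower.algebraMap_apply k (ProdAlg (Ideal.span {F₁})
      (Ideal.span {F₂})), ← LaurentPolynomial.C_eq_algebraMap, LaurentPolynomial.C_apply]
    split_ifs with h
    · subst h
      exact Submodule.mem_one.mpr ⟨algebraMap k _ c, rfl⟩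
    · exact zero_mem _
  | hadd a b ha hb =>
    rw [map_add]
    exact add_mem (ha n) (hb n)
  | hX a l ha =>
    rw [map_mul, coaction_prodX, coeff_mul_T_mul_C]
    convert mul_prodX_mem_weightPart (ha (n - 1)) l
    omega
  | hY a l ha =>
    rw [map_mul, coaction_prodY, coeff_mul_T_mul_C]
    convert mul_prodY_mem_weightPart (ha (n + 1)) l
    · omega
    · omega

end Weights

variable (F₁ F₂ ℓ) in
/-- The equation `x_l ℓ(y) = 0` of `Z` in `Y`. -/
def coneA (l : Fin 3) : coneRing F₁ F₂ := aeval (fun j => coneZ F₁ F₂ (l, j)) ℓ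

theorem coneToChart_coneA (hF₁ : IsSmoothPlaneCubic F₁) (hF₂ : IsSmoothPlaneCubic F₂)
    (hℓ : ℓ.IsHomogeneous 1) (i l : Fin 3) :
    coneToChart hF₁ hF₂ i (coneA F₁ F₂ ℓ l) = prodX _ _ l * aeval (prodY _ _) ℓ := by
  rw [coneA, comp_aeval_apply]
  simp only [coneToChart_coneZ]
  rw [aeval_mul_of_isHomogeneous hℓ, pow_one]

theorem idealZ_eq (hF₁ : IsSmoothPlaneCubic F₁) (hF₂ : IsSmoothPlaneCubic F₂)
    (hℓ : ℓ.IsHomogeneous 1) (hℓ0 : ℓ ≠ 0) :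
    idealZ F₁ F₂ ℓ = Ideal.span (Set.range (coneA F₁ F₂ ℓ)) := by
  have hcone (𝔟 : Ideal (MvPolynomial (Fin 3) k)) (l : Fin 3) :
      prodSegre (Ideal.span {F₁}) 𝔟 (aeval (fun j => X (l, j)) ℓ) =
        prodX _ _ l * aeval (prodY _ _) ℓ := by
    rw [comp_aeval_apply]
    simp only [prodSegre_X]
    rw [aeval_mul_of_isHomogeneous hℓ, pow_one]
  have hA (l) : coneA F₁ F₂ ℓ l = Ideal.Quotient.mk _ (aeval (fun j => X (l, j)) ℓ) := by
    change _ = Ideal.Quotient.mkₐ k _ _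
    rw [comp_aeval_apply]
    rfl
  apply le_antisymm
  · rw [idealZ, Ideal.map_le_iff_le_comap]
    intro p hp
    obtain ⟨c, hc⟩ := exists_prodSegre_eq_mul (prodSegre_eq_zero_of_mem hF₁ hF₂ hℓ hℓ0 hp)
    have hco : coaction hF₁ hF₂ (prodSegre _ _ p) = LaurentPolynomial.C (prodSegre _ _ p) := by
      have : (coaction hF₁ hF₂).comp (prodSegre _ _) = (IsScalarTower.toAlgHom k
          (ProdAlg (Ideal.span {F₁}) (Ideal.span {F₂})) _).comp (prodSegre _ _) := by
        ext lj : 1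
        rw [AlgHom.comp_apply, AlgHom.comp_apply, prodSegre_X, map_mul, map_mul]
        simp only [coaction_prodX, coaction_prodY, IsScalarTower.coe_toAlgHom']
        rw [mul_mul_mul_comm, ← LaurentPolynomial.T_add, add_neg_cancel, LaurentPolynomial.T_zero,
          one_mul]
        rfl
      exact congr($this p)
    have hcoℓ : coaction hF₁ hF₂ (aeval (prodY _ _) ℓ) =
        LaurentPolynomial.T (-1) * LaurentPolynomial.C (aeval (prodY _ _) ℓ) := by
      rw [comp_aeval_apply]
      simp only [coaction_prodY]
      rw [aeval_T_mul hℓ, pow_one]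
    have hmain : prodSegre _ _ p = aeval (prodY _ _) ℓ * (coaction hF₁ hF₂ c).coeff 1 := by
      have h1 := hco
      conv_lhs at h1 => rw [hc, map_mul, hcoℓ, mul_comm]
      have h2 := congr(($h1).coeff 0)
      rw [coeff_mul_T_mul_C, LaurentPolynomial.C_apply, if_pos rfl] at h2
      rw [← h2, mul_comm]
      rfl
    have hmem := coeff_coaction_mem hF₁ hF₂ c 1
    have hmem' : (coaction hF₁ hF₂ c).coeff 1 ∈ Submodule.span
        (prodSegre (Ideal.span {F₁}) (Ideal.span {F₂})).range (Set.range (prodX _ _)) := by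
      have : weightPart F₁ F₂ 1 = _ := pow_one _
      rwa [this] at hmem
    obtain ⟨g, hg⟩ := (Submodule.mem_span_range_iff_exists_fun _).mp hmem'
    choose q hq using fun l => (g l).2
    have hpq : p - ∑ l, q l * aeval (fun j => X (l, j)) ℓ ∈
        segreConeIdeal (Ideal.span {F₁}) (Ideal.span {F₂}) := by
      rw [mem_segreConeIdeal_iff_prodSegre_eq_zero hF₁ hF₂, map_sub, hmain, ← hg, map_sum,
        Finset.mul_sum, sub_eq_zero]
      refine Finset.sum_congr rfl fun l _ => ?_
      rw [map_mul, hcone]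
      have : prodSegre (Ideal.span {F₁}) (Ideal.span {F₂}) (q l) = (g l : ProdAlg _ _) := hq l
      rw [this, Subalgebra.smul_def, smul_eq_mul]
      ring
    rw [Ideal.mem_comap, ← sub_add_cancel p (∑ l, q l * aeval (fun j => X (l, j)) ℓ), map_add,
      Ideal.Quotient.eq_zero_iff_mem.mpr hpq, zero_add, map_sum]
    refine sum_mem fun l _ => ?_
    rw [map_mul, ← hA]
    exact Ideal.mul_mem_left _ _ (Ideal.subset_span ⟨l, rfl⟩)
  · rw [Ideal.span_le]
    rintro _ ⟨l, rfl⟩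
    rw [hA]
    refine Ideal.mem_map_of_mem _ ?_
    rw [mem_segreConeIdeal_iff]
    intro lj
    refine ⟨0, ?_⟩
    rw [hcone, aeval_prodY_eq_zero (Ideal.subset_span (by simp)), mul_zero, mul_zero]

end Centre
end EllipticCone
end

noncomputable section

namespace EllipticCone

/-! ### The charts are Gorenstein and Cohen–Macaulay -/

set_option linter.unusedSectionVars false

section ChartGorenstein

open MvPolynomial

/-- A Cohen–Macaulay ring of finite injective dimension over itself. -/
def IsGorCMRing (R : Type u) [CommRing R] : Prop := (∃ n, InjDimLE R R n) ∧ IsCMRing R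

theorem IsGorCMRing.of_ringEquiv {R S : Type u} [CommRing R] [CommRing S] (e : R ≃+* S)
    (h : IsGorCMRing R) : IsGorCMRing S :=
  ⟨exists_injDimLE_of_ringEquiv e h.1, h.2.of_ringEquiv e⟩

theorem IsGorCMRing.quotient {R : Type u} [CommRing R] [IsDomain R] {x : R} (hx : x ≠ 0)
    (h : IsGorCMRing R) : IsGorCMRing (R ⧸ Ideal.span {x}) :=
  ⟨exists_injDimLE_quotient x (mem_nonZeroDivisors_of_ne_zero hx) h.1,
    h.2.quotient (mem_nonZeroDivisors_of_ne_zero hx)⟩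

theorem IsGorCMRing.mvPolynomial_quotient {R : Type u} [CommRing R] [IsDomain R] {τ : Type} {x : R}
    (hx : x ≠ 0) (h : IsGorCMRing (MvPolynomial τ R)) :
    IsGorCMRing (MvPolynomial τ (R ⧸ Ideal.span {x})) := by
  refine .of_ringEquiv ?_ (h.quotient (x := C x) (by simpa using hx))
  refine (Ideal.quotEquivOfEq ?_).trans
    (quotientEquivQuotientMvPolynomial (σ := τ) (Ideal.span {x})).toRingEquiv.symm
  rw [Ideal.map_span, Set.image_singleton]

theorem IsGorCMRing.mvPolynomial_congr {R S : Type u} [CommRing R] [CommRing S] {τ : Type}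
    (e : R ≃+* S) (h : IsGorCMRing (MvPolynomial τ R)) : IsGorCMRing (MvPolynomial τ S) :=
  h.of_ringEquiv (mapEquiv τ e)

variable {k : Type u} [Field k] [IsAlgClosed k] {F₁ F₂ : MvPolynomial (Fin 3) k}

/-- A copy of the coordinate ring of the affine curve `{F = 0, x_i = 1}`, for efficient instance
search. -/
def AffRing (F : MvPolynomial (Fin 3) k) (i : Fin 3) : Type u :=
  MvPolynomial (Fin 3) k ⧸ affineIdeal F i

instance (F : MvPolynomial (Fin 3) k) (i : Fin 3) : CommRing (AffRing F i) :=
  inferInstanceAs (CommRing (MvPolynomial (Fin 3) k ⧸ affineIdeal F i))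

instance (F : MvPolynomial (Fin 3) k) (i : Fin 3) : Algebra k (AffRing F i) :=
  inferInstanceAs (Algebra k (MvPolynomial (Fin 3) k ⧸ affineIdeal F i))

/-- The quotient map. -/
def affMk (F : MvPolynomial (Fin 3) k) (i : Fin 3) : MvPolynomial (Fin 3) k →ₐ[k] AffRing F i :=
  Ideal.Quotient.mkₐ k (affineIdeal F i)

theorem affMk_surjective (F : MvPolynomial (Fin 3) k) (i : Fin 3) :
    Function.Surjective (affMk F i) := Ideal.Quotient.mk_surjective

variable (F₁ F₂) in
/-- The functions on the first factor of a chart. -/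
def affInl (i : Fin 3) : AffRing F₁ i →ₐ[k] ChartRing F₁ F₂ i :=
  prodInl (affineIdeal F₁ i) (Ideal.span {F₂})

theorem affInl_affMk (i : Fin 3) (p : MvPolynomial (Fin 3) k) :
    affInl F₁ F₂ i (affMk F₁ i p) = aeval (prodX _ _) p :=
  (aeval_prodX p).symm

variable (F₁ F₂) in
/-- A chart is a hypersurface in `A_i[y_0, y_1, y_2]`. -/
theorem nonempty_chartEquiv (i : Fin 3) :
    Nonempty ((MvPolynomial (Fin 3) (AffRing F₁ i) ⧸
      Ideal.span {map (algebraMap k (AffRing F₁ i)) F₂}) ≃+* ChartRing F₁ F₂ i) := by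
  let A := AffRing F₁ i
  set J := Ideal.span {map (algebraMap k A) F₂}
  let f : MvPolynomial (Fin 3) A ⧸ J →+* ChartRing F₁ F₂ i :=
    Ideal.Quotient.lift J (eval₂Hom (affInl F₁ F₂ i).toRingHom
      (prodY _ _)) (by
      intro a ha
      refine (?_ : J ≤ RingHom.ker _) ha
      rw [Ideal.span_le, Set.singleton_subset_iff]
      change eval₂ _ _ _ = 0
      rw [eval₂_map]
      have : ((affInl F₁ F₂ i).toRingHom.comp (algebraMap k A)) =
        algebraMap k _ := AlgHom.comp_algebraMap _
      rw [this, ← aeval_def]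
      exact aeval_prodY_eq_zero (Ideal.mem_span_singleton_self _))
  have hJ : Ideal.Quotient.mk J (map (algebraMap k A) F₂) = 0 :=
    Ideal.Quotient.eq_zero_iff_mem.mpr (Ideal.mem_span_singleton_self _)
  let a : MvPolynomial (Fin 3) k →ₐ[k] MvPolynomial (Fin 3) A ⧸ J :=
    ((IsScalarTower.toAlgHom k (MvPolynomial (Fin 3) A) (MvPolynomial (Fin 3) A ⧸ J)).comp
      (IsScalarTower.toAlgHom k A (MvPolynomial (Fin 3) A))).comp (affMk F₁ i)
  have ha : a = aeval fun l => a (X l) := (aeval_unique a)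
  let b : MvPolynomial (Fin 3) k →ₐ[k] MvPolynomial (Fin 3) A ⧸ J :=
    (IsScalarTower.toAlgHom k (MvPolynomial (Fin 3) A) (MvPolynomial (Fin 3) A ⧸ J)).comp
      (mapAlgHom (Algebra.ofId k A))
  have hb : b = aeval fun l => b (X l) := (aeval_unique b)
  let h : ChartRing F₁ F₂ i →ₐ[k] MvPolynomial (Fin 3) A ⧸ J :=
    prodLift (fun l => a (X l)) (fun l => b (X l))
      (by
        rw [← ha]
        intro p hp
        have h0 : affMk F₁ i p = 0 :=
          Ideal.Quotient.eq_zero_iff_mem.mpr hp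
        rw [RingHom.mem_ker, AlgHom.comp_apply, h0, map_zero])
      (by
        rw [← hb, Ideal.span_le, Set.singleton_subset_iff]
        exact hJ)
  have hbX (j) : b (X j) = Ideal.Quotient.mk J (X j) := by
    change Ideal.Quotient.mk J (map _ (X j)) = _
    rw [map_X]
  refine ⟨RingEquiv.ofRingHom f h.toRingHom ?_ ?_⟩
  · ext d
    induction d using prodAlg_induction with
    | hC c =>
      change f (h (algebraMap k _ c)) = algebraMap k _ c
      rw [AlgHom.commutes]
      change eval₂ (affInl F₁ F₂ i).toRingHom (prodY _ _)
        (C (algebraMap k A c)) = _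
      rw [eval₂_C]
      exact AlgHom.commutes (affInl F₁ F₂ i) c
    | hadd x y hx hy => rw [map_add, map_add, hx, hy]
    | hX x l hx =>
      rw [map_mul, map_mul, hx]
      congr 1
      change f (h (prodX _ _ l)) = _
      rw [prodLift_prodX]
      change eval₂ (affInl F₁ F₂ i).toRingHom (prodY _ _)
        (C (affMk F₁ i (X l))) = _
      rw [eval₂_C]
      rfl
    | hY x l hx =>
      rw [map_mul, map_mul, hx]
      congr 1
      change f (h (prodY _ _ l)) = _
      rw [prodLift_prodY, hbX]
      change eval₂ (affInl F₁ F₂ i).toRingHom (prodY _ _) (X l) = _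
      rw [eval₂_X]
      rfl
  · apply Ideal.Quotient.ringHom_ext
    refine MvPolynomial.ringHom_ext (fun r => ?_) fun l => ?_
    · obtain ⟨p, rfl⟩ := affMk_surjective F₁ i r
      change h (eval₂ (affInl F₁ F₂ i).toRingHom (prodY _ _)
        (C (affMk F₁ i p))) = _
      rw [eval₂_C]
      change h (affInl F₁ F₂ i (affMk F₁ i p)) = _
      rw [affInl_affMk, comp_aeval_apply]
      simp only [h, prodLift_prodX]
      rw [← ha]
      rfl
    · change h (eval₂ (affInl F₁ F₂ i).toRingHom (prodY _ _)
        (X l)) = _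
      rw [eval₂_X, prodLift_prodY, hbX]
      rfl

theorem isGorCMRing_chartRing (hF₁ : IsSmoothPlaneCubic F₁) (hF₂ : IsSmoothPlaneCubic F₂)
    (i : Fin 3) : IsGorCMRing (ChartRing F₁ F₂ i) := by
  have := hF₁.isDomain
  have : IsDomain (AffRing F₁ i) := hF₁.isDomain_affine i
  have h0 : IsGorCMRing (MvPolynomial (Fin 3) (MvPolynomial (Fin 3) k)) := by
    obtain ⟨n, hn⟩ := exists_injDimLE_mvPolynomial (σ := Fin 3)
      (exists_injDimLE_mvPolynomial (σ := Fin 3) ⟨0, fun M _ _ => injDimLE_of_field (k := k) M⟩)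
    exact ⟨⟨n, hn _⟩, (isCMRing_of_field k).mvPolynomial.mvPolynomial⟩
  have h1 := h0.mvPolynomial_quotient hF₁.ne_zero
  have h2 := h1.mvPolynomial_quotient (hF₁.mk_X_sub_one_ne_zero i)
  have e : ((MvPolynomial (Fin 3) k ⧸ Ideal.span {F₁}) ⧸
      Ideal.span {Ideal.Quotient.mk (Ideal.span {F₁}) (X i - 1)}) ≃+*
      AffRing F₁ i :=
    ((Ideal.quotEquivOfEq (by rw [Ideal.map_span, Set.image_singleton])).trans
      (DoubleQuot.quotQuotEquivQuotSup (Ideal.span {F₁}) (Ideal.span {X i - 1}))).trans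
      (Ideal.quotEquivOfEq (by rw [affineIdeal, Ideal.span_insert]))
  have h3 := h2.mvPolynomial_congr e
  have hf : map (algebraMap k (AffRing F₁ i)) F₂ ≠ 0 := by
    rw [Ne, map_eq_zero_iff _ (map_injective _ (algebraMap k (AffRing F₁ i)).injective)]
    exact hF₂.ne_zero
  obtain ⟨e'⟩ := nonempty_chartEquiv F₁ F₂ i
  exact (h3.quotient hf).of_ringEquiv e'

end ChartGorenstein
end EllipticCone
end

noncomputable section

namespace EllipticCone

/-! ### The smooth locus of the charts -/

section SmoothLocus

open MvPolynomial

variable {k : Type u} [Field k] [IsAlgClosed k] {F₁ F₂ : MvPolynomial (Fin 3) k}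

set_option linter.unusedSectionVars false

variable (F₁ F₂) in
/-- The equations of a chart. -/
def chartRel (i : Fin 3) : Fin 3 → MvPolynomial (Fin 3 ⊕ Fin 3) k :=
  ![rename Sum.inl F₁, X (Sum.inl i) - 1, rename Sum.inr F₂]

theorem aeval_X_comp {σ τ : Type} (f : σ → τ) (p : MvPolynomial σ k) :
    aeval (fun l => (X (f l) : MvPolynomial τ k)) p = rename f p := by
  rw [← aeval_X_left_apply (rename f p), aeval_rename]
  rfl

variable (F₁ F₂) in
/-- A chart as the quotient of a polynomial ring by its equations. -/
def chartRelEquiv (i : Fin 3) :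
    (MvPolynomial (Fin 3 ⊕ Fin 3) k ⧸ Ideal.span (Set.range (chartRel F₁ F₂ i))) ≃ₐ[k]
      ChartRing F₁ F₂ i :=
  let I := Ideal.span (Set.range (chartRel F₁ F₂ i))
  let q := Ideal.Quotient.mkₐ k I
  have hq (a : Fin 3) : q (chartRel F₁ F₂ i a) = 0 :=
    Ideal.Quotient.eq_zero_iff_mem.mpr (Ideal.subset_span ⟨a, rfl⟩)
  AlgEquiv.ofAlgHom
    (Ideal.Quotient.liftₐ I (aeval (Sum.elim (prodX _ _) (prodY _ _))) (by
      intro a ha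
      refine (?_ : I ≤ RingHom.ker _) ha
      rw [Ideal.span_le]
      rintro _ ⟨a, rfl⟩
      change aeval _ _ = 0
      fin_cases a
      · change aeval _ (rename Sum.inl F₁) = 0
        rw [aeval_rename, Sum.elim_comp_inl]
        exact aeval_prodX_eq_zero (Ideal.subset_span (by simp))
      · change aeval _ (X (Sum.inl i) - 1) = 0
        rw [map_sub, aeval_X, Sum.elim_inl, prodX_self, map_one, sub_self]
      · change aeval _ (rename Sum.inr F₂) = 0
        rw [aeval_rename, Sum.elim_comp_inr]
        exact aeval_prodY_eq_zero (Ideal.subset_span (by simp))))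
    (prodLift (fun l => q (X (Sum.inl l))) (fun l => q (X (Sum.inr l)))
      (affineIdeal_le_ker (by
          refine Eq.trans ?_ (hq 0)
          rw [← comp_aeval_apply]
          refine congrArg q ?_
          exact aeval_X_comp _ _) (by
          rw [← sub_eq_zero, ← map_one q, ← map_sub]
          exact hq 1))
      (span_singleton_le_ker (by
          refine Eq.trans ?_ (hq 2)
          rw [← comp_aeval_apply]
          refine congrArg q ?_
          exact aeval_X_comp _ _)))
    (prodAlg_algHom_ext (fun l => by
        rw [AlgHom.comp_apply, prodLift_prodX]
        exact aeval_X _ _) fun l => by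
        rw [AlgHom.comp_apply, prodLift_prodY]
        exact aeval_X _ _)
    (Ideal.Quotient.algHom_ext _ (by
      ext (l | l)
      · change prodLift _ _ _ _ (aeval _ (X (Sum.inl l))) = _
        rw [aeval_X, Sum.elim_inl, prodLift_prodX]
        rfl
      · change prodLift _ _ _ _ (aeval _ (X (Sum.inr l))) = _
        rw [aeval_X, Sum.elim_inr, prodLift_prodY]
        rfl))

theorem chartRelEquiv_mk (i : Fin 3) (p : MvPolynomial (Fin 3 ⊕ Fin 3) k) :
    chartRelEquiv F₁ F₂ i (Ideal.Quotient.mk _ p) =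
      aeval (Sum.elim (prodX _ _) (prodY _ _)) p := rfl

theorem injective_chartVars {i m : Fin 3} (n : Fin 3) (hm : m ≠ i) :
    Function.Injective (![Sum.inl m, Sum.inl i, Sum.inr n] : Fin 3 → Fin 3 ⊕ Fin 3) := by
  intro a b hab
  fin_cases a <;> fin_cases b <;> simp_all [hm.symm]

variable (F₁ F₂) in
/-- The presentation of a chart, with the minor of the Jacobian matrix at `x_m, x_i, y_n`. -/
def chartPresentation (i m n : Fin 3) (hm : m ≠ i) :
    Algebra.PreSubmersivePresentation k (ChartRing F₁ F₂ i) (Fin 3 ⊕ Fin 3) (Fin 3) :=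
  (Algebra.PreSubmersivePresentation.naive (v := chartRel F₁ F₂ i)
    ![Sum.inl m, Sum.inl i, Sum.inr n] (injective_chartVars n hm)).ofAlgEquiv (chartRelEquiv F₁ F₂ i)

variable (F₁ F₂) in
/-- The minor of the Jacobian matrix of a chart at `x_m, x_i, y_n`. -/
def chartJacobian (i m n : Fin 3) : ChartRing F₁ F₂ i :=
  aeval (prodX _ _) (pderiv m F₁) * aeval (prodY _ _) (pderiv n F₂)

theorem pderiv_inl_rename_inr (j : Fin 3) (F : MvPolynomial (Fin 3) k) :
    pderiv (Sum.inl j) (rename (Sum.inr : Fin 3 → Fin 3 ⊕ Fin 3) F) = 0 := by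
  classical
  refine pderiv_eq_zero_of_notMem_vars fun h => ?_
  have := vars_rename _ _ h
  simp at this

theorem pderiv_inr_rename_inl (j : Fin 3) (F : MvPolynomial (Fin 3) k) :
    pderiv (Sum.inr j) (rename (Sum.inl : Fin 3 → Fin 3 ⊕ Fin 3) F) = 0 := by
  classical
  refine pderiv_eq_zero_of_notMem_vars fun h => ?_
  have := vars_rename _ _ h
  simp at this

theorem chartPresentation_jacobian (i m n : Fin 3) (hm : m ≠ i) :
    (chartPresentation F₁ F₂ i m n hm).jacobian = chartJacobian F₁ F₂ i m n := by
  rw [chartPresentation, Algebra.PreSubmersivePresentation.jacobian_ofAlgEquiv,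
    Algebra.PreSubmersivePresentation.jacobian_eq_jacobiMatrix_det, Matrix.det_fin_three]
  simp only [Algebra.PreSubmersivePresentation.jacobiMatrix_naive]
  have h1 : pderiv (Sum.inl m) (X (Sum.inl i) - 1 : MvPolynomial (Fin 3 ⊕ Fin 3) k) = 0 := by
    rw [map_sub, pderiv_X_of_ne (by simpa using hm.symm)]
    simp
  have h2 : pderiv (Sum.inl i) (X (Sum.inl i) - 1 : MvPolynomial (Fin 3 ⊕ Fin 3) k) = 1 := by
    simp
  have h3 : pderiv (Sum.inr n) (X (Sum.inl i) - 1 : MvPolynomial (Fin 3 ⊕ Fin 3) k) = 0 := by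
    rw [map_sub, pderiv_X_of_ne (by simp)]
    simp
  simp only [chartRel, Matrix.cons_val_zero, Matrix.cons_val_one, Matrix.cons_val, h1, h2, h3,
    pderiv_inl_rename_inr, pderiv_inr_rename_inl, pderiv_rename Sum.inl_injective,
    pderiv_rename Sum.inr_injective, mul_zero, zero_mul, sub_zero, mul_one, add_zero]
  change chartRelEquiv F₁ F₂ i (Ideal.Quotient.mk _ _) = _
  rw [chartRelEquiv_mk, map_mul, aeval_rename, aeval_rename, Sum.elim_comp_inl, Sum.elim_comp_inr]
  rfl

theorem isStandardSmooth_away {i m n : Fin 3} (hm : m ≠ i) (t : ChartRing F₁ F₂ i)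
    (T : Type u) [CommRing T] [Algebra k T] [Algebra (ChartRing F₁ F₂ i) T]
    [IsScalarTower k (ChartRing F₁ F₂ i) T] [IsLocalization.Away t T]
    (hJ : IsUnit (algebraMap (ChartRing F₁ F₂ i) T (chartJacobian F₁ F₂ i m n))) :
    Algebra.IsStandardSmoothOfRelativeDimension 3 k T := by
  let P := (Algebra.PreSubmersivePresentation.localizationAway T t).comp
    (chartPresentation F₁ F₂ i m n hm)
  have hu : IsUnit (algebraMap (ChartRing F₁ F₂ i) T t) :=
    IsLocalization.Away.algebraMap_isUnit _
  refine Algebra.SubmersivePresentation.isStandardSmoothOfRelativeDimension (ι := Unit ⊕ Fin 3 ⊕ Fin 3)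
    (σ := Unit ⊕ Fin 3) ⟨P, ?_⟩ ?_
  · rw [Algebra.PreSubmersivePresentation.comp_jacobian_eq_jacobian_smul_jacobian,
      Algebra.PreSubmersivePresentation.localizationAway_jacobian, chartPresentation_jacobian,
      Algebra.smul_def]
    exact hJ.mul hu
  · simp [Algebra.Presentation.dimension]

/-- The module of differentials of the function field of a chart has rank `3`. -/
theorem finrank_kaehlerDifferential_chart {i m n : Fin 3} (hm : m ≠ i)
    [IsDomain (ChartRing F₁ F₂ i)] (hJ : chartJacobian F₁ F₂ i m n ≠ 0) (K : Type u) [Field K]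
    [Algebra k K] [Algebra (ChartRing F₁ F₂ i) K] [IsScalarTower k (ChartRing F₁ F₂ i) K]
    [IsFractionRing (ChartRing F₁ F₂ i) K] : Module.finrank K Ω[K⁄k] = 3 := by
  let S := ChartRing F₁ F₂ i
  let T := Localization.Away (chartJacobian F₁ F₂ i m n)
  have := isStandardSmooth_away hm (chartJacobian F₁ F₂ i m n) T
    (n := n) (IsLocalization.Away.algebraMap_isUnit _)
  have hle : Submonoid.powers (chartJacobian F₁ F₂ i m n) ≤ nonZeroDivisors S :=
    powers_le_nonZeroDivisors_of_noZeroDivisors hJ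
  have : IsDomain T := IsLocalization.isDomain_localization hle
  let _ : Algebra T K := IsLocalization.localizationAlgebraOfSubmonoidLe T K
    (Submonoid.powers (chartJacobian F₁ F₂ i m n)) (nonZeroDivisors S) hle
  have : IsScalarTower S T K := IsLocalization.localization_isScalarTower_of_submonoid_le T K
    (Submonoid.powers (chartJacobian F₁ F₂ i m n)) (nonZeroDivisors S) hle
  have : IsFractionRing T K := IsFractionRing.isFractionRing_of_isDomain_of_isLocalization
    (Submonoid.powers (chartJacobian F₁ F₂ i m n)) T K
  have : IsScalarTower k T K := .of_algebraMap_eq fun a => by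
    rw [IsScalarTower.algebraMap_apply k S T, ← IsScalarTower.algebraMap_apply S T K,
      ← IsScalarTower.algebraMap_apply k S K]
  have : Algebra.FormallyEtale T K := .of_isLocalization (nonZeroDivisors T)
  have := Algebra.IsStandardSmoothOfRelativeDimension.isStandardSmooth 3 (R := k) (S := T)
  have h := Algebra.IsStandardSmoothOfRelativeDimension.rank_kaehlerDifferential (R := k) (S := T) 3
  rw [← (KaehlerDifferential.tensorKaehlerEquivOfFormallyEtale k T K).finrank_eq,
    Module.finrank_baseChange, Module.finrank, h]
  simp

end SmoothLocus
end EllipticCone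
end

noncomputable section

namespace EllipticCone

/-! ### The invariant differential form -/

section Forms

open MvPolynomial

theorem sum_fin_three_cyclic {M : Type*} [AddCommMonoid M] (g : Fin 3 → M) (c : Fin 3) :
    ∑ i, g i = g c + g (c + 1) + g (c + 2) := by
  rw [Fin.sum_univ_three]
  fin_cases c
  · rfl
  · change _ = g 1 + g 2 + g 0
    abel
  · change _ = g 2 + g 0 + g 1
    abel

theorem forall_fin_three_cyclic {p : Fin 3 → Prop} (c : Fin 3) (h0 : p c) (h1 : p (c + 1))
    (h2 : p (c + 2)) (i : Fin 3) : p i := by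
  have : i = c ∨ i = c + 1 ∨ i = c + 2 := by
    clear h0 h1 h2
    revert i c
    decide
  rcases this with rfl | rfl | rfl <;> assumption

theorem fin_three_add_one_add_one (c : Fin 3) : c + 1 + 1 = c + 2 := by
  revert c
  decide

theorem fin_three_add_one_add_two (c : Fin 3) : c + 1 + 2 = c := by
  revert c
  decide

theorem fin_three_add_two_add_one (c : Fin 3) : c + 2 + 1 = c := by
  revert c
  decide

theorem fin_three_add_two_add_two (c : Fin 3) : c + 2 + 2 = c + 1 := by
  revert c
  decide

variable {k K : Type u} [Field k] [Field K] [Algebra k K]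

theorem D_aeval {σ : Type*} [Fintype σ] (x : σ → K) (F : MvPolynomial σ k) :
    KaehlerDifferential.D k K (aeval x F) =
      ∑ i, aeval x (pderiv i F) • KaehlerDifferential.D k K (x i) := by
  classical
  induction F using MvPolynomial.induction_on with
  | C a => simp [← algebraMap_eq]
  | add p q hp hq => simp [hp, hq, add_smul, Finset.sum_add_distrib]
  | mul_X p i hp =>
    simp only [map_mul, Derivation.leibniz, aeval_X, hp, pderiv_X, smul_eq_mul, map_add, add_smul,
      Finset.sum_add_distrib, Finset.smul_sum, smul_smul]
    congr 1
    rw [Finset.sum_eq_single i]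
    · simp
    · intro j _ hj
      simp [hj.symm]
    · simp

/-- The form `x_a dx_b - x_b dx_a`, where `(c, a, b)` is a cyclic permutation of `(0, 1, 2)`. -/
def wronskian (k : Type u) {K : Type u} [Field k] [Field K] [Algebra k K] (x : Fin 3 → K)
    (c : Fin 3) : Ω[K⁄k] :=
  x (c + 1) • KaehlerDifferential.D k K (x (c + 2)) -
    x (c + 2) • KaehlerDifferential.D k K (x (c + 1))

/-- `η` is the residue at `F` of the standard `2`-form on the plane in homogeneous coordinates. -/
def IsCurveForm (F : MvPolynomial (Fin 3) k) (x : Fin 3 → K) (η : Ω[K⁄k]) : Prop :=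
  ∀ c, wronskian k x c = aeval x (pderiv c F) • η

theorem cyclic_relation {M : Type*} [AddCommGroup M] [Module K M] {x₀ x₁ x₂ f₀ f₁ f₂ : K}
    {d₀ d₁ d₂ : M} (he : x₀ * f₀ + x₁ * f₁ + x₂ * f₂ = 0)
    (hd : f₀ • d₀ + f₁ • d₁ + f₂ • d₂ = 0) :
    f₀ • (x₂ • d₀ - x₀ • d₂) = f₁ • (x₁ • d₂ - x₂ • d₁) ∧
    f₀ • (x₀ • d₁ - x₁ • d₀) = f₂ • (x₁ • d₂ - x₂ • d₁) := by
  constructor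
  · linear_combination (norm := module) x₂ • hd - he • d₂
  · linear_combination (norm := module) he • d₁ - x₁ • hd

theorem exists_isCurveForm {F : MvPolynomial (Fin 3) k} (hF : IsSmoothPlaneCubic F)
    {x : Fin 3 → K} (hx : aeval x F = 0) {m : Fin 3} (hm : aeval x (pderiv m F) ≠ 0) :
    ∃ η, IsCurveForm F x η := by
  have he := hF.euler hx
  have hd := D_aeval x F
  rw [hx, map_zero, sum_fin_three_cyclic _ m] at hd
  rw [sum_fin_three_cyclic _ m] at he
  obtain ⟨h1, h2⟩ := cyclic_relation he hd.symm
  refine ⟨(aeval x (pderiv m F))⁻¹ • wronskian k x m, forall_fin_three_cyclic m ?_ ?_ ?_⟩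
  · rw [smul_inv_smul₀ hm]
  · rw [smul_comm, ← inv_smul_eq_iff₀ (inv_ne_zero hm), inv_inv]
    simpa only [wronskian, fin_three_add_one_add_one, fin_three_add_one_add_two] using h1
  · rw [smul_comm, ← inv_smul_eq_iff₀ (inv_ne_zero hm), inv_inv]
    simpa only [wronskian, fin_three_add_two_add_two, fin_three_add_two_add_one] using h2

theorem aeval_pderiv_mul {F : MvPolynomial (Fin 3) k} (hF : IsSmoothPlaneCubic F)
    (c : K) (x : Fin 3 → K) (i : Fin 3) :
    aeval (fun l => c * x l) (pderiv i F) = c ^ 2 * aeval x (pderiv i F) :=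
  aeval_mul_of_isHomogeneous hF.isHomogeneous.pderiv c x

theorem IsCurveForm.of_mul {F : MvPolynomial (Fin 3) k} (hF : IsSmoothPlaneCubic F)
    {x : Fin 3 → K} {η : Ω[K⁄k]} {c : K} (hc : c ≠ 0) (h : IsCurveForm F (fun l => c * x l) η) :
    IsCurveForm F x η := by
  intro i
  have := h i
  rw [aeval_pderiv_mul hF, mul_smul] at this
  refine smul_right_injective _ (pow_ne_zero 2 hc) (Eq.trans ?_ this)
  simp only [wronskian, Derivation.leibniz]
  module

theorem IsCurveForm.exists_D_eq {F : MvPolynomial (Fin 3) k} {x : Fin 3 → K} {η : Ω[K⁄k]}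
    (h : IsCurveForm F x η) {i : Fin 3} (hi : x i = 1) (l : Fin 3) :
    ∃ c : K, KaehlerDifferential.D k K (x l) = c • η := by
  refine forall_fin_three_cyclic (p := fun l => ∃ c : K, KaehlerDifferential.D k K (x l) = c • η)
    i ⟨0, by simp [hi]⟩ ⟨aeval x (pderiv (i + 2) F), ?_⟩ ⟨-aeval x (pderiv (i + 1) F), ?_⟩ l
  · rw [← h, wronskian, fin_three_add_two_add_one, fin_three_add_two_add_two, hi]
    simp
  · rw [neg_smul, ← h, wronskian, fin_three_add_one_add_one, fin_three_add_one_add_two, hi]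
    simp

/-- The form `η ∧ p ∧ q`. -/
def wedge (η p q : Ω[K⁄k]) : ⋀[K]^3 Ω[K⁄k] := exteriorPower.ιMulti K 3 ![η, p, q]

theorem wedge_add_left (η p p' q : Ω[K⁄k]) : wedge η (p + p') q = wedge η p q + wedge η p' q :=
  ((exteriorPower.ιMulti K 3).curryLeft η).map_vecCons_add ![q] p p'

theorem wedge_smul_left (η p q : Ω[K⁄k]) (c : K) : wedge η (c • p) q = c • wedge η p q :=
  ((exteriorPower.ιMulti K 3).curryLeft η).map_vecCons_smul ![q] c p

theorem wedge_smul_first (η p q : Ω[K⁄k]) (c : K) : wedge (c • η) p q = c • wedge η p q :=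
  (exteriorPower.ιMulti K 3).map_vecCons_smul ![p, q] c η

theorem wedge_self (η p : Ω[K⁄k]) : wedge η p p = 0 :=
  (exteriorPower.ιMulti K 3).map_eq_zero_of_eq _ (i := 1) (j := 2) rfl (by decide)

theorem wedge_first_self (η q : Ω[K⁄k]) : wedge η η q = 0 :=
  (exteriorPower.ιMulti K 3).map_eq_zero_of_eq _ (i := 0) (j := 1) rfl (by decide)

theorem wedge_swap (η p q : Ω[K⁄k]) : wedge η p q = -wedge η q p := by
  have := (exteriorPower.ιMulti K 3).map_swap ![η, p, q] (i := 1) (j := 2) (by decide)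
  rw [wedge, wedge, ← neg_eq_iff_eq_neg, ← this]
  congr 1
  funext i
  fin_cases i <;> rfl

theorem wedge_add_right (η p q q' : Ω[K⁄k]) : wedge η p (q + q') = wedge η p q + wedge η p q' := by
  rw [wedge_swap, wedge_add_left, neg_add, ← wedge_swap, ← wedge_swap]

theorem wedge_smul_right (η p q : Ω[K⁄k]) (c : K) : wedge η p (c • q) = c • wedge η p q := by
  rw [wedge_swap, wedge_smul_left, wedge_swap η p q, smul_neg]

/-- `ω` is the product of the invariant form of the curve `F₁ = 0` and the residue at `F₂` of
the standard `3`-form on affine space. -/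
def IsConeForm (F₁ F₂ : MvPolynomial (Fin 3) k) (x y : Fin 3 → K) (ω : ⋀[K]^3 Ω[K⁄k]) : Prop :=
  ∃ η, IsCurveForm F₁ x η ∧ ∀ c, wedge η (KaehlerDifferential.D k K (y (c + 1)))
    (KaehlerDifferential.D k K (y (c + 2))) = aeval y (pderiv c F₂) • ω

theorem wedge_relation {η d₀ d₁ d₂ : Ω[K⁄k]} {f₀ f₁ f₂ : K}
    (hd : f₀ • d₀ + f₁ • d₁ + f₂ • d₂ = 0) :
    f₀ • wedge η d₂ d₀ = f₁ • wedge η d₁ d₂ ∧ f₀ • wedge η d₀ d₁ = f₂ • wedge η d₁ d₂ := by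
  have h0 : f₀ • d₀ = (-f₁) • d₁ + (-f₂) • d₂ := by
    linear_combination (norm := module) hd
  constructor
  · rw [← wedge_smul_right, h0, wedge_add_right, wedge_smul_right, wedge_smul_right, wedge_self,
      wedge_swap η d₂ d₁]
    module
  · rw [← wedge_smul_left, h0, wedge_add_left, wedge_smul_left, wedge_smul_left, wedge_self,
      wedge_swap η d₂ d₁]
    module

theorem exists_isConeForm {F₁ F₂ : MvPolynomial (Fin 3) k} {x y : Fin 3 → K} {η : Ω[K⁄k]}
    (hη : IsCurveForm F₁ x η) (hy : aeval y F₂ = 0) {n : Fin 3}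
    (hn : aeval y (pderiv n F₂) ≠ 0) : ∃ ω, IsConeForm F₁ F₂ x y ω := by
  have hd := D_aeval y F₂
  rw [hy, map_zero, sum_fin_three_cyclic _ n] at hd
  obtain ⟨h1, h2⟩ := wedge_relation (η := η) hd.symm
  refine ⟨(aeval y (pderiv n F₂))⁻¹ • wedge η (KaehlerDifferential.D k K (y (n + 1)))
    (KaehlerDifferential.D k K (y (n + 2))), η, hη, forall_fin_three_cyclic n ?_ ?_ ?_⟩
  · rw [smul_inv_smul₀ hn]
  · rw [smul_comm, ← inv_smul_eq_iff₀ (inv_ne_zero hn), inv_inv]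
    simpa only [fin_three_add_one_add_one, fin_three_add_one_add_two] using h1
  · rw [smul_comm, ← inv_smul_eq_iff₀ (inv_ne_zero hn), inv_inv]
    simpa only [fin_three_add_two_add_two, fin_three_add_two_add_one] using h2

theorem IsConeForm.change_chart {F₁ F₂ : MvPolynomial (Fin 3) k} (hF₁ : IsSmoothPlaneCubic F₁)
    (hF₂ : IsSmoothPlaneCubic F₂) {x y x' : Fin 3 → K} {ω : ⋀[K]^3 Ω[K⁄k]}
    (h : IsConeForm F₁ F₂ x y ω) {i i' : Fin 3} (hi : x i = 1) (hi' : x i' ≠ 0)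
    (hx' : ∀ l, x l = x i' * x' l) : IsConeForm F₁ F₂ x' (fun j => x i' * y j) ω := by
  obtain ⟨η, hη, hω⟩ := h
  obtain ⟨a, ha⟩ := hη.exists_D_eq hi i'
  refine ⟨η, .of_mul hF₁ hi' (funext hx' ▸ hη), fun c => ?_⟩
  rw [aeval_pderiv_mul hF₂, mul_smul, ← hω, Derivation.leibniz, Derivation.leibniz, ha]
  simp only [wedge_add_left, wedge_add_right, wedge_smul_left, wedge_smul_right, wedge_first_self,
    wedge_swap η _ η]
  module

end Forms
end EllipticCone
end

noncomputable section

namespace EllipticCone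

/-! ### The order of the invariant form -/

section Order

open MvPolynomial

variable {k K : Type u} [Field k] [Field K] [Algebra k K]

/-- The subring `𝒪` of `K` is a localization of the `k`-algebra generated by `G`. -/
structure IsLocalizationOfAdjoin (k : Type u) {K : Type u} [Field k] [Field K] [Algebra k K]
    (G : Set K) (𝒪 : Subring K) : Prop where
  mem : ∀ s ∈ Algebra.adjoin k G, s ∈ 𝒪
  exists_eq : ∀ a ∈ 𝒪, ∃ s ∈ Algebra.adjoin k G, ∃ t ∈ Algebra.adjoin k G,
    t ≠ 0 ∧ t⁻¹ ∈ 𝒪 ∧ a * t = s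

theorem IsLocalizationOfAdjoin.D_mem {G : Set K} {𝒪 : Subring K}
    (h : IsLocalizationOfAdjoin k G 𝒪) (N : Submodule 𝒪 Ω[K⁄k])
    (hN : ∀ g ∈ G, KaehlerDifferential.D k K g ∈ N) {a : K} (ha : a ∈ 𝒪) :
    KaehlerDifferential.D k K a ∈ N := by
  have key : ∀ s ∈ Algebra.adjoin k G, KaehlerDifferential.D k K s ∈ N := by
    intro s hs
    induction hs using Algebra.adjoin_induction with
    | mem x hx => exact hN x hx
    | algebraMap r => simp
    | add x y _ _ hx hy =>
      rw [map_add]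
      exact N.add_mem hx hy
    | mul x y hx' hy' hx hy =>
      rw [Derivation.leibniz]
      exact N.add_mem (N.smul_mem ⟨x, h.mem x hx'⟩ hy) (N.smul_mem ⟨y, h.mem y hy'⟩ hx)
  obtain ⟨s, hs, t, ht, ht0, hti, hst⟩ := h.exists_eq a ha
  have hD := congr_arg (KaehlerDifferential.D k K) hst
  rw [Derivation.leibniz] at hD
  have : KaehlerDifferential.D k K a =
      t⁻¹ • (KaehlerDifferential.D k K s - a • KaehlerDifferential.D k K t) := by
    rw [← hD, add_sub_cancel_left, inv_smul_smul₀ ht0]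
  rw [this]
  exact N.smul_mem ⟨_, hti⟩ (N.sub_mem (key s hs) (N.smul_mem ⟨a, ha⟩ (key t ht)))

theorem ιMulti_mem_span {M : Type*} [AddCommGroup M] [Module K M] (𝒪 : Subring K) {n : ℕ}
    (e v : Fin n → M) (hv : ∀ i, v i ∈ Submodule.span 𝒪 (Set.range e)) :
    exteriorPower.ιMulti K n v ∈ Submodule.span 𝒪 {exteriorPower.ιMulti K n e} := by
  have hex : ∀ i, ∃ c : Fin n → 𝒪, ∑ j, c j • e j = v i := fun i =>
    (Submodule.mem_span_range_iff_exists_fun 𝒪).mp (hv i)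
  choose c hc using hex
  have hv' : v = fun i => ∑ j, (c i j : K) • e j := funext fun i => (hc i).symm
  have hsum := (exteriorPower.ιMulti K n).toMultilinearMap.map_sum
    (g := fun i j => (c i j : K) • e j)
  rw [hv']
  refine (congrArg (· ∈ _) hsum).mpr (Submodule.sum_mem _ fun r _ => ?_)
  rw [MultilinearMap.map_smul_univ]
  have hprod : ∏ i, (c i (r i) : K) = ((∏ i, c i (r i) : 𝒪) : K) := by
    rw [SubmonoidClass.coe_finsetProd]
  rw [hprod]
  refine Submodule.smul_mem _ (∏ i, c i (r i)) ?_
  by_cases hr : Function.Injective r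
  · let σ : Equiv.Perm (Fin n) := Equiv.ofBijective r (Finite.injective_iff_bijective.mp hr)
    have := (exteriorPower.ιMulti K n).map_perm e σ
    change exteriorPower.ιMulti K n (e ∘ σ) ∈ _
    rw [this]
    rcases Int.units_eq_one_or (Equiv.Perm.sign σ) with h | h <;> rw [h]
    · rw [one_smul]
      exact Submodule.mem_span_singleton_self _
    · rw [Units.neg_smul, one_smul]
      exact Submodule.neg_mem _ (Submodule.mem_span_singleton_self _)
  · obtain ⟨a, b, hab, hne⟩ : ∃ a b, r a = r b ∧ a ≠ b := by
      simpa [Function.Injective] using hr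
    have : exteriorPower.ιMulti K n (fun i => e (r i)) = 0 :=
      (exteriorPower.ιMulti K n).map_eq_zero_of_eq _ (congrArg e hab) hne
    change exteriorPower.ιMulti K n (fun i => e (r i)) ∈ _
    rw [this]
    exact Submodule.zero_mem _

theorem hasOrderZero_of_span {O : Type u} [CommRing O] [Algebra O K] {n : ℕ} (e : Fin n → O)
    (he : ∀ a : O, KaehlerDifferential.D k K (algebraMap O K a) ∈
      Submodule.span (algebraMap O K).range
        (Set.range fun i => KaehlerDifferential.D k K (algebraMap O K (e i))))
    {ω : ⋀[K]^n Ω[K⁄k]} {u : K} (hu : u ∈ (algebraMap O K).range)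
    (hu' : u⁻¹ ∈ (algebraMap O K).range) (hu0 : u ≠ 0)
    (hω : u • ω = exteriorPower.ιMulti K n fun i => KaehlerDifferential.D k K (algebraMap O K (e i))) :
    HasOrderZero k O K ω := by
  refine le_antisymm ?_ ?_
  · rw [Submodule.span_singleton_le_iff_mem, ← inv_smul_smul₀ hu0 ω, hω]
    exact Submodule.smul_mem _ (⟨_, hu'⟩ : (algebraMap O K).range) (Submodule.subset_span ⟨e, rfl⟩)
  · rw [Submodule.span_le]
    rintro _ ⟨a, rfl⟩
    have := ιMulti_mem_span (algebraMap O K).range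
      (fun i => KaehlerDifferential.D k K (algebraMap O K (e i)))
      (fun i => KaehlerDifferential.D k K (algebraMap O K (a i))) fun i => he (a i)
    rw [← hω] at this
    refine Submodule.span_le.mpr ?_ this
    rw [Set.singleton_subset_iff]
    exact Submodule.smul_mem _ (⟨u, hu⟩ : (algebraMap O K).range) (Submodule.mem_span_singleton_self ω)

theorem IsConeForm.exists_eq_wedge {F₁ F₂ : MvPolynomial (Fin 3) k} {x y : Fin 3 → K}
    {ω : ⋀[K]^3 Ω[K⁄k]} (h : IsConeForm F₁ F₂ x y ω) {i m : Fin 3} (n : Fin 3) (hi : x i = 1)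
    (hm : m ≠ i) : ∃ p : Fin 3, ∃ ε : K, (∀ l, l = i ∨ l = m ∨ l = p) ∧ p ≠ i ∧ p ≠ m ∧
      (ε = 1 ∨ ε = -1) ∧ (ε * (aeval x (pderiv m F₁) * aeval y (pderiv n F₂))) • ω =
        wedge (KaehlerDifferential.D k K (x p)) (KaehlerDifferential.D k K (y (n + 1)))
          (KaehlerDifferential.D k K (y (n + 2))) := by
  obtain ⟨η, hη, hω⟩ := h
  have hm' : m = i + 1 ∨ m = i + 2 := by
    clear hη hω hi
    revert m i
    decide
  rcases hm' with rfl | rfl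
  · refine ⟨i + 2, -1, ?_, ?_, ?_, .inr rfl, ?_⟩
    iterate 3
      clear hη hω hi hm
      revert i
      decide
    rw [mul_smul, mul_smul, ← hω, ← wedge_smul_first, ← hη, wronskian, fin_three_add_one_add_one,
      fin_three_add_one_add_two, hi, Derivation.map_one_eq_zero, ← wedge_smul_first]
    congr 1
    module
  · refine ⟨i + 1, 1, ?_, ?_, ?_, .inl rfl, ?_⟩
    iterate 3
      clear hη hω hi hm
      revert i
      decide
    rw [mul_smul, mul_smul, ← hω, ← wedge_smul_first, ← hη, wronskian, fin_three_add_two_add_one,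
      fin_three_add_two_add_two, hi, Derivation.map_one_eq_zero, ← wedge_smul_first]
    congr 1
    module

/-- The conormal relations express all differentials by three of them. -/
theorem IsLocalizationOfAdjoin.D_mem_span {F₁ F₂ : MvPolynomial (Fin 3) k} {x y : Fin 3 → K}
    {𝒪 : Subring K} (h : IsLocalizationOfAdjoin k (Set.range x ∪ Set.range y) 𝒪)
    (hx : aeval x F₁ = 0) (hy : aeval y F₂ = 0) {i m n p : Fin 3} (hi : x i = 1)
    (hp : ∀ l, l = i ∨ l = m ∨ l = p) (him : m ≠ i) (hip : p ≠ i) (hmp : p ≠ m)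
    (hm0 : aeval x (pderiv m F₁) ≠ 0)
    (hm : (aeval x (pderiv m F₁))⁻¹ ∈ 𝒪) (hn0 : aeval y (pderiv n F₂) ≠ 0)
    (hn : (aeval y (pderiv n F₂))⁻¹ ∈ 𝒪) {a : K} (ha : a ∈ 𝒪) :
    KaehlerDifferential.D k K a ∈ Submodule.span 𝒪 (Set.range
      ![KaehlerDifferential.D k K (x p), KaehlerDifferential.D k K (y (n + 1)),
        KaehlerDifferential.D k K (y (n + 2))]) := by
  set N := Submodule.span 𝒪 (Set.range
      ![KaehlerDifferential.D k K (x p), KaehlerDifferential.D k K (y (n + 1)),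
        KaehlerDifferential.D k K (y (n + 2))])
  have h0 : KaehlerDifferential.D k K (x p) ∈ N := Submodule.subset_span ⟨0, rfl⟩
  have h1 : KaehlerDifferential.D k K (y (n + 1)) ∈ N := Submodule.subset_span ⟨1, rfl⟩
  have h2 : KaehlerDifferential.D k K (y (n + 2)) ∈ N := Submodule.subset_span ⟨2, rfl⟩
  have hpx (q : MvPolynomial (Fin 3) k) : aeval x q ∈ 𝒪 := h.mem _ (by
    rw [Algebra.adjoin_union]
    exact le_sup_left (a := Algebra.adjoin k (Set.range x))
      (by rw [Algebra.adjoin_range_eq_range_aeval]; exact ⟨q, rfl⟩))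
  have hpy (q : MvPolynomial (Fin 3) k) : aeval y q ∈ 𝒪 := h.mem _ (by
    rw [Algebra.adjoin_union]
    exact le_sup_right (b := Algebra.adjoin k (Set.range y))
      (by rw [Algebra.adjoin_range_eq_range_aeval]; exact ⟨q, rfl⟩))
  refine h.D_mem N ?_ ha
  rintro _ (⟨l, rfl⟩ | ⟨j, rfl⟩)
  · rcases hp l with rfl | rfl | rfl
    · simp [hi]
    · have hd := D_aeval x F₁
      have huniv : (Finset.univ : Finset (Fin 3)) = {i, l, p} := by
        ext a
        simpa using hp a
      rw [hx, map_zero, huniv, Finset.sum_insert (by simp [him.symm, hip.symm]),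
        Finset.sum_insert (by simp [hmp.symm]), Finset.sum_singleton, hi, Derivation.map_one_eq_zero,
        smul_zero, zero_add] at hd
      rw [← inv_smul_smul₀ hm0 (KaehlerDifferential.D k K (x l)), eq_neg_of_add_eq_zero_left hd.symm]
      exact N.smul_mem ⟨_, hm⟩ (N.neg_mem (N.smul_mem ⟨_, hpx _⟩ h0))
    · exact h0
  · refine forall_fin_three_cyclic (p := fun j => KaehlerDifferential.D k K (y j) ∈ N) n ?_ h1 h2 j
    have hd := D_aeval y F₂
    rw [hy, map_zero, sum_fin_three_cyclic _ n, add_assoc] at hd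
    rw [← inv_smul_smul₀ hn0 (KaehlerDifferential.D k K (y n)), eq_neg_of_add_eq_zero_left hd.symm]
    exact N.smul_mem ⟨_, hn⟩ (N.neg_mem (N.add_mem (N.smul_mem ⟨_, hpy _⟩ h1)
      (N.smul_mem ⟨_, hpy _⟩ h2)))


theorem aeval_mem_adjoin_range {σ : Type*} (x : σ → K) (q : MvPolynomial σ k) :
    aeval x q ∈ Algebra.adjoin k (Set.range x) := by
  rw [Algebra.adjoin_range_eq_range_aeval]
  exact ⟨q, rfl⟩

/-- The invariant form has neither zero nor pole along a local ring at which the chart is smooth. -/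
theorem IsConeForm.hasOrderZero {F₁ F₂ : MvPolynomial (Fin 3) k} {x y : Fin 3 → K}
    {ω : ⋀[K]^3 Ω[K⁄k]} (h : IsConeForm F₁ F₂ x y ω) {O : Type u} [CommRing O] [Algebra O K]
    (hO : IsLocalizationOfAdjoin k (Set.range x ∪ Set.range y) (algebraMap O K).range)
    (hx : aeval x F₁ = 0) (hy : aeval y F₂ = 0) {i m n : Fin 3} (hi : x i = 1) (him : m ≠ i)
    (hm0 : aeval x (pderiv m F₁) ≠ 0)
    (hm : (aeval x (pderiv m F₁))⁻¹ ∈ (algebraMap O K).range) (hn0 : aeval y (pderiv n F₂) ≠ 0)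
    (hn : (aeval y (pderiv n F₂))⁻¹ ∈ (algebraMap O K).range) : HasOrderZero k O K ω := by
  obtain ⟨p, ε, hp, hip, hmp, hε, hω⟩ := h.exists_eq_wedge n hi him
  have hmem (z : K) (hz : z ∈ Set.range x ∪ Set.range y) : ∃ a : O, algebraMap O K a = z :=
    hO.mem z (Algebra.subset_adjoin hz)
  obtain ⟨e₀, he₀⟩ := hmem (x p) (.inl ⟨p, rfl⟩)
  obtain ⟨e₁, he₁⟩ := hmem (y (n + 1)) (.inr ⟨_, rfl⟩)
  obtain ⟨e₂, he₂⟩ := hmem (y (n + 2)) (.inr ⟨_, rfl⟩)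
  have hefun : (fun i => KaehlerDifferential.D k K (algebraMap O K (![e₀, e₁, e₂] i))) =
      ![KaehlerDifferential.D k K (x p), KaehlerDifferential.D k K (y (n + 1)),
        KaehlerDifferential.D k K (y (n + 2))] := by
    funext i
    fin_cases i
    · exact congrArg _ he₀
    · exact congrArg _ he₁
    · exact congrArg _ he₂
  have hf : aeval x (pderiv m F₁) ∈ (algebraMap O K).range := hO.mem _
    (Algebra.adjoin_mono Set.subset_union_left (aeval_mem_adjoin_range x _))
  have hg : aeval y (pderiv n F₂) ∈ (algebraMap O K).range := hO.mem _
    (Algebra.adjoin_mono Set.subset_union_right (aeval_mem_adjoin_range y _))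
  have hεm : ε ∈ (algebraMap O K).range ∧ ε⁻¹ = ε ∧ ε ≠ 0 := by
    rcases hε with rfl | rfl
    · exact ⟨one_mem _, by simp, one_ne_zero⟩
    · exact ⟨neg_mem (one_mem _), by norm_num, by simp⟩
  refine hasOrderZero_of_span ![e₀, e₁, e₂] (fun a => ?_) (mul_mem hεm.1 (mul_mem hf hg)) ?_
    (mul_ne_zero hεm.2.2 (mul_ne_zero hm0 hn0)) (hω.trans ?_)
  · rw [hefun]
    exact hO.D_mem_span hx hy hi hp him hip hmp hm0 hm hn0 hn ⟨a, rfl⟩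
  · rw [mul_inv, mul_inv, hεm.2.1]
    exact mul_mem hεm.1 (mul_mem hm hn)
  · rw [hefun]
    rfl

theorem ιMulti_ne_zero_of_span_eq_top {M : Type*} [AddCommGroup M] [Module K M] {n : ℕ}
    (hM : Module.finrank K M = n) (e : Fin n → M) (he : ⊤ ≤ Submodule.span K (Set.range e)) :
    exteriorPower.ιMulti K n e ≠ 0 := by
  have hli := linearIndependent_of_top_le_span_of_card_eq_finrank he (by simp [hM])
  intro h0
  let b := Module.Basis.mk hli he
  have hb : ⇑b = e := Module.Basis.coe_mk hli he
  have h1 := congr_arg (exteriorPower.alternatingMapLinearEquiv b.det) h0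
  rw [exteriorPower.alternatingMapLinearEquiv_apply_ιMulti, map_zero, ← hb, b.det_self] at h1
  exact one_ne_zero h1

theorem IsConeForm.ne_zero {F₁ F₂ : MvPolynomial (Fin 3) k} {x y : Fin 3 → K}
    {ω : ⋀[K]^3 Ω[K⁄k]} (h : IsConeForm F₁ F₂ x y ω)
    (hK : IsLocalizationOfAdjoin k (Set.range x ∪ Set.range y) ⊤)
    (hr : Module.finrank K Ω[K⁄k] = 3)
    (hx : aeval x F₁ = 0) (hy : aeval y F₂ = 0) {i m n : Fin 3} (hi : x i = 1) (him : m ≠ i)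
    (hm0 : aeval x (pderiv m F₁) ≠ 0) (hn0 : aeval y (pderiv n F₂) ≠ 0) : ω ≠ 0 := by
  obtain ⟨p, ε, hp, hip, hmp, hε, hω⟩ := h.exists_eq_wedge n hi him
  rintro rfl
  rw [smul_zero] at hω
  refine ιMulti_ne_zero_of_span_eq_top hr _ ?_ hω.symm
  rw [← KaehlerDifferential.span_range_derivation k K, Submodule.span_le]
  rintro _ ⟨a, rfl⟩
  have := hK.D_mem_span hx hy hi hp him hip hmp hm0 trivial hn0 trivial (a := a) trivial
  refine Submodule.span_induction (fun z hz => Submodule.subset_span hz) (zero_mem _)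
    (fun _ _ _ _ => add_mem) (fun c z _ hz => Submodule.smul_mem _ (c : K) hz) this

end Order
end EllipticCone
end

noncomputable section

namespace EllipticCone

/-! ### Affine charts of schemes -/

section AffineCharts

variable {X : Scheme.{u}} {T : CommRingCat.{u}} (ι : Spec T ⟶ X) [IsOpenImmersion ι]

/-- The map to a stalk from the ring of functions of an affine chart. -/
def chartToStalk (x : X) (hx : x ∈ ι ''ᵁ ⊤) : T ⟶ X.presheaf.stalk x :=
  (Scheme.ΓSpecIso T).inv ≫ (ι.appIso ⊤).inv ≫ X.presheaf.germ (ι ''ᵁ ⊤) x hx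

theorem isAffineOpen_chart : IsAffineOpen (ι ''ᵁ ⊤) :=
  (isAffineOpen_top (Spec T)).image_of_isOpenImmersion ι

/-- The functions on an affine chart. -/
def chartSections : T ≅ Γ(X, ι ''ᵁ ⊤) := (Scheme.ΓSpecIso T).symm ≪≫ (ι.appIso ⊤).symm

theorem chartToStalk_eq (x : X) (hx : x ∈ ι ''ᵁ ⊤) :
    chartToStalk ι x hx = (chartSections ι).hom ≫ X.presheaf.germ (ι ''ᵁ ⊤) x hx := by
  simp [chartToStalk, chartSections]

theorem exists_isLocalization_chartToStalk (x : X) (hx : x ∈ ι ''ᵁ ⊤) :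
    ∃ (p : Ideal T) (_ : p.IsPrime),
      @IsLocalization.AtPrime T _ (X.presheaf.stalk x) _ (chartToStalk ι x hx).hom.toAlgebra p _ := by
  let := (chartToStalk ι x hx).hom.toAlgebra
  let e : T ≃+* Γ(X, ι ''ᵁ ⊤) := (chartSections ι).commRingCatIsoToRingEquiv
  let _ : Algebra Γ(X, ι ''ᵁ ⊤) (X.presheaf.stalk x) :=
    TopCat.Presheaf.algebra_section_stalk X.presheaf ⟨x, hx⟩
  let q := ((isAffineOpen_chart ι).primeIdealOf ⟨x, hx⟩).asIdeal
  have hloc : IsLocalization.AtPrime (X.presheaf.stalk x) q :=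
    (isAffineOpen_chart ι).isLocalization_stalk ⟨x, hx⟩
  have hq : q.IsPrime := ((isAffineOpen_chart ι).primeIdealOf ⟨x, hx⟩).isPrime
  refine ⟨q.comap e, inferInstance, ?_⟩
  have := IsLocalization.isLocalization_of_base_ringEquiv q.primeCompl (X.presheaf.stalk x) e.symm
  have hM : q.primeCompl.map e.symm = (q.comap e).primeCompl := by
    ext a
    constructor
    · rintro ⟨b, hb, rfl⟩ h
      exact hb (by simpa using h)
    · intro ha
      exact ⟨e a, ha, e.symm_apply_apply a⟩
  change IsLocalization (q.comap e).primeCompl _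
  rw [← hM]
  convert! this using 1

theorem scalars_comp_chartToStalk {A : CommRingCat.{u}} (g : X ⟶ Spec A) (h : A ⟶ T)
    (hg : ι ≫ g = Spec.map h) (x : X) (hx : x ∈ ι ''ᵁ ⊤) :
    h ≫ chartToStalk ι x hx =
      (Scheme.ΓSpecIso A).inv ≫ g.appTop ≫ X.presheaf.germ ⊤ x trivial := by
  have h1 := congr_arg Scheme.Hom.appTop hg
  rw [Scheme.Hom.comp_appTop] at h1
  have h2 := Scheme.Hom.app_appIso_inv ι ⊤
  rw [chartToStalk, Scheme.ΓSpecIso_inv_naturality_assoc, ← h1, Category.assoc]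
  congr 2
  have h3 : ι.appTop ≫ (ι.appIso ⊤).inv =
      X.presheaf.map (homOfLE (le_top : ι ''ᵁ ⊤ ≤ ⊤)).op := h2
  rw [reassoc_of% h3, TopCat.Presheaf.germ_res]

theorem algebraMap_chartToStalk [IsIntegral X] (x : X) (hx : x ∈ ι ''ᵁ ⊤)
    (hη : genericPoint X ∈ ι ''ᵁ ⊤) (t : T) :
    algebraMap (X.presheaf.stalk x) X.functionField ((chartToStalk ι x hx).hom t) =
      (chartToStalk ι (genericPoint X) hη).hom t := by
  have : Nonempty (ι ''ᵁ ⊤ : X.Opens) := ⟨⟨x, hx⟩⟩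
  rw [chartToStalk_eq, chartToStalk_eq]
  exact Scheme.algebraMap_germ_eq_germToFunctionField X hx _

theorem chartToStalk_injective [IsIntegral X] (x : X) (hx : x ∈ ι ''ᵁ ⊤) :
    Function.Injective (chartToStalk ι x hx).hom := by
  rw [chartToStalk_eq, CommRingCat.hom_comp]
  exact (germ_injective_of_isIntegral X x hx).comp
    (chartSections ι).commRingCatIsoToRingEquiv.injective

end AffineCharts
end EllipticCone
end

noncomputable section

namespace EllipticCone

/-! ### Schemes with smooth charts in codimension one -/

section SmoothCharts

open MvPolynomial

set_option linter.unusedSectionVars false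

variable {k : Type u} [Field k] [IsAlgClosed k] {F₁ F₂ : MvPolynomial (Fin 3) k}

/-- The map from the coordinate ring of the cone to a localization of a chart. -/
def coneToChartAway (hF₁ : IsSmoothPlaneCubic F₁) (hF₂ : IsSmoothPlaneCubic F₂) {i : Fin 3}
    (t : ChartRing F₁ F₂ i) : coneRing F₁ F₂ →+* Localization.Away t :=
  (algebraMap (ChartRing F₁ F₂ i) (Localization.Away t)).comp (coneToChart hF₁ hF₂ i).toRingHom

/-- An open immersion over `Y` of a smooth open subscheme of a chart. -/
structure IsSmoothChart (hF₁ : IsSmoothPlaneCubic F₁) (hF₂ : IsSmoothPlaneCubic F₂)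
    {X : Scheme.{u}} (s : X ⟶ coneY F₁ F₂) {i : Fin 3} {t : ChartRing F₁ F₂ i}
    (ι : Spec (.of (Localization.Away t)) ⟶ X) : Prop where
  isOpenImmersion : IsOpenImmersion ι
  comp_eq : ι ≫ s = Spec.map (CommRingCat.ofHom (coneToChartAway hF₁ hF₂ t))
  exists_dvd : ∃ m n, m ≠ i ∧ chartJacobian F₁ F₂ i m n ∣ t

/-- Every point of codimension at most one lies in a smooth chart. -/
def HasSmoothCharts (hF₁ : IsSmoothPlaneCubic F₁) (hF₂ : IsSmoothPlaneCubic F₂)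
    {X : Scheme.{u}} (s : X ⟶ coneY F₁ F₂) : Prop :=
  ∀ x : X, Order.coheight x ≤ 1 → ∃ (i : Fin 3) (t : ChartRing F₁ F₂ i)
    (ι : Spec (.of (Localization.Away t)) ⟶ X), IsSmoothChart hF₁ hF₂ s ι ∧ x ∈ Set.range ι

theorem coneToChartAway_algebraMap (hF₁ : IsSmoothPlaneCubic F₁) (hF₂ : IsSmoothPlaneCubic F₂)
    {i : Fin 3} (t : ChartRing F₁ F₂ i) :
    (coneToChartAway hF₁ hF₂ t).comp (algebraMap k (coneRing F₁ F₂)) =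
      algebraMap k (Localization.Away t) := by
  ext a
  rw [IsScalarTower.algebraMap_apply k (ChartRing F₁ F₂ i) (Localization.Away t)]
  exact congrArg (algebraMap (ChartRing F₁ F₂ i) (Localization.Away t))
    ((coneToChart hF₁ hF₂ i).commutes a)

theorem IsSmoothChart.comp_toSpec {hF₁ : IsSmoothPlaneCubic F₁} {hF₂ : IsSmoothPlaneCubic F₂}
    {X : Scheme.{u}} {s : X ⟶ coneY F₁ F₂} {i : Fin 3} {t : ChartRing F₁ F₂ i}
    {ι : Spec (.of (Localization.Away t)) ⟶ X} (h : IsSmoothChart hF₁ hF₂ s ι) :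
    ι ≫ s ≫ coneY.toSpec F₁ F₂ =
      Spec.map (CommRingCat.ofHom (algebraMap k (Localization.Away t))) := by
  rw [← Category.assoc, h.comp_eq, ← coneToChartAway_algebraMap hF₁ hF₂ t, CommRingCat.ofHom_comp,
    Spec.map_comp]
  rfl

theorem smooth_of_isStandardSmooth {T : Type u} [CommRing T] [Algebra k T]
    [Algebra.IsStandardSmooth k T] : Smooth (Spec.map (CommRingCat.ofHom (algebraMap k T))) := by
  rw [HasRingHomProperty.Spec_iff (P := @Smooth)]
  change (algebraMap k T).Smooth
  rw [RingHom.smooth_algebraMap]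
  infer_instance

theorem HasSmoothCharts.smoothInCodimOne {hF₁ : IsSmoothPlaneCubic F₁}
    {hF₂ : IsSmoothPlaneCubic F₂} {X : Scheme.{u}} {s : X ⟶ coneY F₁ F₂}
    (h : HasSmoothCharts hF₁ hF₂ s) : SmoothInCodimOne (s ≫ coneY.toSpec F₁ F₂) := by
  intro x hx
  obtain ⟨i, t, ι, hι, hxι⟩ := h x hx
  have := hι.isOpenImmersion
  obtain ⟨m, n, hm, hJ⟩ := hι.exists_dvd
  refine ⟨ι.opensRange, hxι, ?_⟩
  have := isStandardSmooth_away hm t (Localization.Away t) (isUnit_of_dvd_unit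
    (map_dvd _ hJ) (IsLocalization.Away.algebraMap_isUnit t))
  have := Algebra.IsStandardSmoothOfRelativeDimension.isStandardSmooth 3 (R := k)
    (S := Localization.Away t)
  have hsm := smooth_of_isStandardSmooth (k := k) (T := Localization.Away t)
  have : ι.opensRange.ι ≫ s ≫ coneY.toSpec F₁ F₂ = ι.isoOpensRange.inv ≫
      Spec.map (CommRingCat.ofHom (algebraMap k (Localization.Away t))) := by
    rw [← hι.comp_toSpec]
    simp
  rw [this]
  infer_instance

theorem range_eq_adjoin {L : Type u} [CommRing L] [Algebra k L] {i : Fin 3}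
    (θ : ChartRing F₁ F₂ i →ₐ[k] L) :
    θ.range = Algebra.adjoin k (Set.range (fun l => θ (prodX _ _ l)) ∪
      Set.range fun j => θ (prodY _ _ j)) := by
  have h := prodAlg_surjective (affineIdeal F₁ i) (Ideal.span {F₂})
  have hr : Set.range (fun l => θ (prodX _ _ l)) ∪ Set.range (fun j => θ (prodY _ _ j)) =
      θ '' Set.range (Sum.elim (prodX (affineIdeal F₁ i) (Ideal.span {F₂})) (prodY _ _)) := by
    rw [Set.Sum.elim_range, Set.image_union, ← Set.range_comp, ← Set.range_comp]
    rfl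
  rw [hr, ← AlgHom.map_adjoin, Algebra.adjoin_range_eq_range_aeval, (AlgHom.range_eq_top _).mpr h,
    Algebra.map_top]

/-- The embedding of the ring of a chart into the function field. -/
theorem IsSmoothChart.exists_algHom {hF₁ : IsSmoothPlaneCubic F₁} {hF₂ : IsSmoothPlaneCubic F₂}
    {X : Scheme.{u}} [IsIntegral X] {s : X ⟶ coneY F₁ F₂} {i : Fin 3} {t : ChartRing F₁ F₂ i}
    {ι : Spec (.of (Localization.Away t)) ⟶ X} (h : IsSmoothChart hF₁ hF₂ s ι)
    [Nonempty (Spec (.of (Localization.Away t)))] [Algebra k X.functionField]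
    (hk : algebraMap k X.functionField =
      scalarsToStalk (s ≫ coneY.toSpec F₁ F₂) (genericPoint X)) :
    ∃ θ : ChartRing F₁ F₂ i →ₐ[k] X.functionField, Function.Injective θ ∧ θ t ≠ 0 ∧
      (∀ r, θ (coneToChart hF₁ hF₂ i r) = ((Scheme.ΓSpecIso (.of (coneRing F₁ F₂))).inv ≫
        s.appTop ≫ X.presheaf.germ ⊤ (genericPoint X) trivial).hom r) ∧
      ∀ x ∈ Set.range ι, IsLocalizationOfAdjoin k (Set.range (fun l => θ (prodX _ _ l)) ∪
        Set.range fun j => θ (prodY _ _ j)) (algebraMap (X.presheaf.stalk x) X.functionField).range ∧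
        (θ t)⁻¹ ∈ (algebraMap (X.presheaf.stalk x) X.functionField).range := by
  have := h.isOpenImmersion
  have := isDomain_chartRing hF₁ hF₂ i
  let S := ChartRing F₁ F₂ i
  let T := Localization.Away t
  have hT : Nontrivial T := PrimeSpectrum.nonempty_iff_nontrivial.mp ‹_›
  have ht : t ≠ 0 := by
    rintro rfl
    have := IsLocalization.Away.algebraMap_isUnit (S := T) (0 : S)
    rw [map_zero] at this
    exact not_isUnit_zero this
  have hST : Function.Injective (algebraMap S T) :=
    IsLocalization.injective T (powers_le_nonZeroDivisors_of_noZeroDivisors ht)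
  have hrange (x : X) : x ∈ Set.range ι → x ∈ ι ''ᵁ ⊤ := by
    rintro ⟨y, rfl⟩
    exact ⟨y, trivial, rfl⟩
  have hη : genericPoint X ∈ ι ''ᵁ ⊤ :=
    ((genericPoint_spec X).mem_open_set_iff (ι ''ᵁ ⊤).isOpen).mpr
      ⟨ι (Classical.arbitrary _), trivial, _, trivial, rfl⟩
  let θ₀ : S →+* X.functionField :=
    (chartToStalk ι (genericPoint X) hη).hom.comp (algebraMap S T)
  have hθk (a : k) : θ₀ (algebraMap k S a) = algebraMap k X.functionField a := by
    have := scalars_comp_chartToStalk ι (s ≫ coneY.toSpec F₁ F₂) _ h.comp_toSpec _ hη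
    rw [hk]
    refine Eq.trans ?_ congr(($this).hom a)
    change _ = (chartToStalk ι (genericPoint X) hη).hom (algebraMap k T a)
    rw [IsScalarTower.algebraMap_apply k S T]
    rfl
  let θ : S →ₐ[k] X.functionField := { θ₀ with commutes' := hθk }
  have hθi : Function.Injective θ := (chartToStalk_injective ι _ hη).comp hST
  refine ⟨θ, hθi, (map_ne_zero_iff θ hθi).mpr ht, fun r => ?_, fun x hx => ?_⟩
  · have := scalars_comp_chartToStalk ι s _ h.comp_eq _ hη
    exact congr(($this).hom r)
  · have hx' := hrange x hx
    obtain ⟨p, hp, hloc⟩ := exists_isLocalization_chartToStalk ι x hx'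
    let O := X.presheaf.stalk x
    let τ : T →+* O := (chartToStalk ι x hx').hom
    have hθ (a : S) : θ a = algebraMap O X.functionField (τ (algebraMap S T a)) :=
      (algebraMap_chartToStalk ι x hx' hη _).symm
    have hinv {a : T} (ha : IsUnit (τ a)) :
        (algebraMap O X.functionField (τ a))⁻¹ ∈ (algebraMap O X.functionField).range := by
      obtain ⟨b, hb⟩ := ha.exists_right_inv
      refine ⟨b, eq_inv_of_mul_eq_one_right ?_⟩
      rw [← map_mul, hb, map_one]
    have hut : IsUnit (τ (algebraMap S T t)) :=
      (IsLocalization.Away.algebraMap_isUnit (S := T) t).map τ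
    refine ⟨⟨?_, ?_⟩, ?_⟩
    · rw [← range_eq_adjoin θ]
      rintro _ ⟨a, rfl⟩
      exact ⟨_, (hθ a).symm⟩
    · rintro _ ⟨a, rfl⟩
      rw [← range_eq_adjoin θ]
      let _ := τ.toAlgebra
      obtain ⟨⟨b, c⟩, hbc⟩ := IsLocalization.surj (M := p.primeCompl) (S := O) a
      have hc : IsUnit (τ c) := IsLocalization.map_units (M := p.primeCompl) O c
      obtain ⟨nb, b', hb'⟩ := IsLocalization.Away.surj t b
      obtain ⟨nc, c', hc'⟩ := IsLocalization.Away.surj t (c : T)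
      have hcu : IsUnit (τ (algebraMap S T (c' * t ^ nb))) := by
        rw [map_mul, ← hc', map_mul, map_mul, map_pow, map_pow, map_pow]
        exact (hc.mul (hut.pow _)).mul (hut.pow _)
      refine ⟨_, ⟨b' * t ^ nc, rfl⟩, _, ⟨c' * t ^ nb, rfl⟩, ?_, ?_, ?_⟩
      · change θ _ ≠ 0
        rw [hθ]
        exact (hcu.map _).ne_zero
      · change (θ _)⁻¹ ∈ _
        rw [hθ]
        exact hinv hcu
      · change _ * θ _ = θ _
        rw [hθ, hθ, ← map_mul]
        congr 1
        have hbc' : a * τ c = τ b := hbc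
        have hb'' : τ b * τ (algebraMap S T t) ^ nb = τ (algebraMap S T b') := by
          rw [← map_pow, ← map_mul]
          exact congrArg τ hb'
        have hc'' : τ c * τ (algebraMap S T t) ^ nc = τ (algebraMap S T c') := by
          rw [← map_pow, ← map_mul]
          exact congrArg τ hc'
        simp only [map_mul, map_pow]
        rw [← hb'', ← hc'', ← hbc']
        ring
    · rw [hθ]
      exact hinv hut

theorem chart_pderiv_isUnit {L : Type u} [Field L] [Algebra k L] {i m n : Fin 3}
    {t : ChartRing F₁ F₂ i} (hJ : chartJacobian F₁ F₂ i m n ∣ t) {θ : ChartRing F₁ F₂ i →ₐ[k] L}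
    {𝒪 : Subring L} (hθ : ∀ a, θ a ∈ 𝒪) (ht0 : θ t ≠ 0) (ht : (θ t)⁻¹ ∈ 𝒪) :
    (aeval (fun l => θ (prodX _ _ l)) (pderiv m F₁) ≠ 0 ∧
      (aeval (fun l => θ (prodX _ _ l)) (pderiv m F₁))⁻¹ ∈ 𝒪) ∧
    aeval (fun j => θ (prodY _ _ j)) (pderiv n F₂) ≠ 0 ∧
      (aeval (fun j => θ (prodY _ _ j)) (pderiv n F₂))⁻¹ ∈ 𝒪 := by
  obtain ⟨c, rfl⟩ := hJ
  rw [chartJacobian, map_mul, map_mul] at ht0 ht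
  rw [← comp_aeval_apply, ← comp_aeval_apply]
  set f := θ (aeval (prodX _ _) (pderiv m F₁))
  set g := θ (aeval (prodY _ _) (pderiv n F₂))
  have hf0 : f ≠ 0 := left_ne_zero_of_mul (left_ne_zero_of_mul ht0)
  have hg0 : g ≠ 0 := right_ne_zero_of_mul (left_ne_zero_of_mul ht0)
  have hc0 : θ c ≠ 0 := right_ne_zero_of_mul ht0
  refine ⟨⟨hf0, ?_⟩, hg0, ?_⟩
  · have : f⁻¹ = (f * g * θ c)⁻¹ * (g * θ c) := by field_simp
    rw [this]
    exact mul_mem ht (mul_mem (hθ _) (hθ _))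
  · have : g⁻¹ = (f * g * θ c)⁻¹ * (f * θ c) := by field_simp
    rw [this]
    exact mul_mem ht (mul_mem (hθ _) (hθ _))

theorem aeval_chart_eq_zero {L : Type u} [CommRing L] [Algebra k L] {i : Fin 3}
    (θ : ChartRing F₁ F₂ i →ₐ[k] L) : aeval (fun l => θ (prodX _ _ l)) F₁ = 0 ∧
      aeval (fun j => θ (prodY _ _ j)) F₂ = 0 ∧ θ (prodX _ _ i) = 1 := by
  refine ⟨?_, ?_, by rw [prodX_self, map_one]⟩
  · rw [← comp_aeval_apply, aeval_prodX_eq_zero (Ideal.subset_span (by simp)), map_zero]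
  · rw [← comp_aeval_apply, aeval_prodY_eq_zero (Ideal.subset_span (by simp)), map_zero]

theorem coheight_genericPoint (X : Scheme.{u}) [IrreducibleSpace X] :
    Order.coheight (genericPoint X) = 0 := by
  rw [Order.coheight_eq_zero]
  intro x _
  exact (genericPoint_spec X).specializes trivial

theorem range_algebraMap_of_eq_genericPoint {X : Scheme.{u}} [IsIntegral X] {x : X}
    (hx : x = genericPoint X) : (algebraMap (X.presheaf.stalk x) X.functionField).range = ⊤ := by
  subst hx
  rw [RingHom.range_eq_top]
  intro a
  refine ⟨a, ?_⟩
  change (X.presheaf.stalkSpecializes _).hom a = a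
  rw [TopCat.Presheaf.stalkSpecializes_refl]
  rfl

theorem HasSmoothCharts.hasTrivialCanonicalDivisor {hF₁ : IsSmoothPlaneCubic F₁}
    {hF₂ : IsSmoothPlaneCubic F₂} {X : Scheme.{u}} [IsIntegral X] {s : X ⟶ coneY F₁ F₂}
    (h : HasSmoothCharts hF₁ hF₂ s) : HasTrivialCanonicalDivisor (s ≫ coneY.toSpec F₁ F₂) := by
  refine ⟨‹_›, ?_⟩
  let : Algebra k X.functionField :=
    (scalarsToStalk (s ≫ coneY.toSpec F₁ F₂) (genericPoint X)).toAlgebra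
  obtain ⟨i, t, ι, hι, hxι⟩ := h (genericPoint X) (by rw [coheight_genericPoint]; exact zero_le)
  have : Nonempty (Spec (.of (Localization.Away t))) := ⟨hxι.choose⟩
  obtain ⟨θ, hθ, ht0, hθr, hθx⟩ := hι.exists_algHom rfl
  obtain ⟨m, n, hm, hJ⟩ := hι.exists_dvd
  obtain ⟨hloc, -⟩ := hθx _ hxι
  rw [range_algebraMap_of_eq_genericPoint rfl] at hloc
  have := isDomain_chartRing hF₁ hF₂ i
  obtain ⟨hx, hy, hi⟩ := aeval_chart_eq_zero θ
  obtain ⟨⟨hm0, -⟩, hn0, -⟩ := chart_pderiv_isUnit hJ (θ := θ) (𝒪 := ⊤) (fun _ => trivial) ht0 trivial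
  obtain ⟨η, hη⟩ := exists_isCurveForm hF₁ hx hm0
  obtain ⟨ω, hω⟩ := exists_isConeForm hη hy hn0
  have hr : Module.finrank X.functionField Ω[X.functionField⁄k] = 3 := by
    let := θ.toRingHom.toAlgebra
    have : IsScalarTower k (ChartRing F₁ F₂ i) X.functionField :=
      .of_algebraMap_eq fun a => (θ.commutes a).symm
    have : FaithfulSMul (ChartRing F₁ F₂ i) X.functionField :=
      (faithfulSMul_iff_algebraMap_injective _ _).mpr hθ
    have : IsFractionRing (ChartRing F₁ F₂ i) X.functionField := .of_field _ _ fun z => by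
      obtain ⟨a, ha, b, hb, hb0, -, hab⟩ := hloc.exists_eq z trivial
      rw [← range_eq_adjoin θ] at ha hb
      obtain ⟨a, rfl⟩ := ha
      obtain ⟨b, rfl⟩ := hb
      exact ⟨a, b, eq_div_of_mul_eq hb0 hab⟩
    refine finrank_kaehlerDifferential_chart (F₁ := F₁) (F₂ := F₂) hm (n := n) (fun h0 => ht0 ?_) _
    rw [h0, zero_dvd_iff] at hJ
    rw [hJ, map_zero]
  refine ⟨3, hr, ω, hω.ne_zero hloc hr hx hy hi hm hm0 hn0, fun x hx1 => ?_⟩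
  obtain ⟨i', t', ι', hι', hxι'⟩ := h x hx1.le
  have : Nonempty (Spec (.of (Localization.Away t'))) := ⟨hxι'.choose⟩
  obtain ⟨θ', hθ', ht0', hθr', hθx'⟩ := hι'.exists_algHom rfl
  obtain ⟨m', n', hm', hJ'⟩ := hι'.exists_dvd
  obtain ⟨hloc', hinv'⟩ := hθx' _ hxι'
  obtain ⟨hx', hy', hi'⟩ := aeval_chart_eq_zero θ'
  obtain ⟨⟨hm0', hm1'⟩, hn0', hn1'⟩ := chart_pderiv_isUnit hJ'
    (𝒪 := (algebraMap (X.presheaf.stalk x) X.functionField).range) (θ := θ') (fun a => hloc'.mem _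
    (by rw [← range_eq_adjoin]; exact ⟨a, rfl⟩)) ht0' hinv'
  have hz (l j : Fin 3) : θ (prodX _ _ l) * θ (prodY _ _ j) = θ' (prodX _ _ l) * θ' (prodY _ _ j) := by
    rw [← map_mul, ← map_mul, ← coneToChart_coneZ hF₁ hF₂ i (l, j),
      ← coneToChart_coneZ hF₁ hF₂ i' (l, j), hθr, hθr']
  have hyy (j : Fin 3) : θ' (prodY _ _ j) = θ (prodX _ _ i') * θ (prodY _ _ j) := by
    rw [hz, hi', one_mul]
  have := (hF₁.isDomain_affine i').toNontrivial
  have hy0' : θ' (prodY _ _ 0) ≠ 0 := (map_ne_zero_iff θ' hθ').mpr (prodY_ne_zero hF₂ 0)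
  have hy0 := hy0'
  rw [hyy] at hy0
  have hω' := hω.change_chart hF₁ hF₂ (x' := fun l => θ' (prodX _ _ l)) hi
    (left_ne_zero_of_mul hy0) fun l => by
      refine mul_right_cancel₀ (right_ne_zero_of_mul hy0) ?_
      rw [hz, hyy]
      ring
  simp_rw [← hyy] at hω'
  exact hω'.hasOrderZero hloc' hx' hy' hi' hm' hm0' hm1' hn0' hn1'

end SmoothCharts
end EllipticCone
end

noncomputable section

namespace EllipticCone

/-! ### The smooth charts of the cone -/

section ConeCharts

open MvPolynomial

set_option linter.unusedSectionVars false

theorem one_lt_height_of_ker_lt {k R D : Type*} [CommRing k] [CommRing R] [IsDomain R] [CommRing D]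
    [IsDomain D] [Algebra k R] [Algebra k D] (φ : R →ₐ[k] D) (P : Ideal R) [P.IsPrime] (hle : ∀ r, φ r = 0 → r ∈ P) {a c : R} (ha : a ∈ P)
    (ha' : φ a ≠ 0) (hc : c ≠ 0) (hc' : φ c = 0) : 1 < P.height := by
  have := RingHom.ker_isPrime φ
  have h1 : (⊥ : Ideal R) < RingHom.ker φ := bot_lt_iff_ne_bot.mpr fun h => hc (by
    have : c ∈ RingHom.ker φ := hc'
    rwa [h, Ideal.mem_bot] at this)
  have h2 : RingHom.ker φ < P := lt_of_le_of_ne hle fun h => ha' (by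
    rw [← h] at ha
    exact ha)
  have h3 := Order.height_add_one_le (show (⟨⊥, Ideal.isPrime_bot⟩ : PrimeSpectrum R) <
    ⟨RingHom.ker φ, inferInstance⟩ from h1)
  have h4 := Order.height_add_one_le (show (⟨RingHom.ker φ, inferInstance⟩ : PrimeSpectrum R) <
    ⟨P, inferInstance⟩ from h2)
  rw [(PrimeSpectrum.height_eq_orderHeight ⟨P, inferInstance⟩ : P.height = _)]
  refine lt_of_lt_of_le ?_ ((add_le_add_left h3 1).trans h4)
  exact lt_of_lt_of_le (by norm_num) (add_le_add_left (add_le_add_left zero_le 1) 1)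

variable {k : Type u} [Field k] [IsAlgClosed k] {F₁ F₂ : MvPolynomial (Fin 3) k}

variable (F₁) in
/-- The family of lines over the affine curve, given by a point of `E₂`. -/
def lineHom (hF₂ : IsSmoothPlaneCubic F₂) {b : Fin 3 → k} (hb : eval b F₂ = 0) (i : Fin 3) :
    ChartRing F₁ F₂ i →ₐ[k] (MvPolynomial (Fin 3) k ⧸ affineIdeal F₁ i)[X] :=
  prodLift (fun l => Polynomial.CAlgHom (Ideal.Quotient.mkₐ k (affineIdeal F₁ i) (X l)))
    (fun j => Polynomial.X * algebraMap k _ (b j)) (affineIdeal_le_ker (by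
      rw [← comp_aeval_apply, ← comp_aeval_apply, aeval_X_left_apply]
      exact (congrArg _ (Ideal.Quotient.eq_zero_iff_mem.mpr
        (Ideal.subset_span (by simp)))).trans (map_zero _)) (by
      rw [← sub_eq_zero, ← map_one (Polynomial.CAlgHom (R := k)), ← map_sub,
        ← map_one (Ideal.Quotient.mkₐ k (affineIdeal F₁ i)), ← map_sub]
      exact (congrArg _ (Ideal.Quotient.eq_zero_iff_mem.mpr
        (Ideal.subset_span (by simp)))).trans (map_zero _))) (span_singleton_le_ker (F := F₂) (by
      rw [aeval_mul_of_isHomogeneous hF₂.isHomogeneous]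
      refine mul_eq_zero_of_right _ ((aeval_algebraMap_apply _ b F₂).trans ?_)
      rw [aeval_eq_eval]
      exact (congrArg _ hb).trans (map_zero _)))

theorem lineHom_prodX (hF₂ : IsSmoothPlaneCubic F₂) {b : Fin 3 → k} (hb : eval b F₂ = 0)
    (i l : Fin 3) : lineHom F₁ hF₂ hb i (prodX _ _ l) =
      Polynomial.C (Ideal.Quotient.mk (affineIdeal F₁ i) (X l)) :=
  prodLift_prodX _ _ _ _ _

theorem lineHom_prodY (hF₂ : IsSmoothPlaneCubic F₂) {b : Fin 3 → k} (hb : eval b F₂ = 0)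
    (i j : Fin 3) : lineHom F₁ hF₂ hb i (prodY _ _ j) = Polynomial.X * algebraMap k _ (b j) :=
  prodLift_prodY _ _ _ _ _

/-- An element of the kernel of the family of lines vanishes on the zero section. -/
theorem mem_span_of_lineHom_eq_zero (hF₂ : IsSmoothPlaneCubic F₂) {b : Fin 3 → k} (hb : eval b F₂ = 0)
    (i : Fin 3) {a : ChartRing F₁ F₂ i} (ha : lineHom F₁ hF₂ hb i a = 0) :
    a ∈ Ideal.span (Set.range (prodY (affineIdeal F₁ i) (Ideal.span {F₂}))) := by
  set J := Ideal.span (Set.range (prodY (affineIdeal F₁ i) (Ideal.span {F₂})))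
  let g : (MvPolynomial (Fin 3) k ⧸ affineIdeal F₁ i) →ₐ[k] ChartRing F₁ F₂ i ⧸ J :=
    (Ideal.Quotient.mkₐ k J).comp (prodInl _ _)
  let h : (MvPolynomial (Fin 3) k ⧸ affineIdeal F₁ i)[X] →ₐ[k] ChartRing F₁ F₂ i ⧸ J :=
    g.comp ((Polynomial.aeval (R := MvPolynomial (Fin 3) k ⧸ affineIdeal F₁ i) 0).restrictScalars k)
  have hcomp : h.comp (lineHom F₁ hF₂ hb i) = Ideal.Quotient.mkₐ k J := by
    refine prodAlg_algHom_ext (fun l => ?_) fun j => ?_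
    · rw [AlgHom.comp_apply, lineHom_prodX]
      change g (Polynomial.aeval 0 (Polynomial.C _)) = _
      rw [Polynomial.aeval_C]
      rfl
    · rw [AlgHom.comp_apply, lineHom_prodY, map_mul]
      change g (Polynomial.aeval 0 Polynomial.X) * _ = _
      rw [Polynomial.aeval_X, map_zero, zero_mul]
      have : prodY _ _ j ∈ J := Ideal.subset_span ⟨j, rfl⟩
      exact (Ideal.Quotient.eq_zero_iff_mem.mpr this).symm
  have := congr($hcomp a)
  rw [AlgHom.comp_apply, ha, map_zero] at this
  exact Ideal.Quotient.eq_zero_iff_mem.mp this.symm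

/-- The linear form vanishing on a point. -/
theorem linear_ne_zero (hF₂ : IsSmoothPlaneCubic F₂) {b : Fin 3 → k} {j j' : Fin 3} (hj : b j ≠ 0)
    (hjj' : j ≠ j') {𝔞 : Ideal (MvPolynomial (Fin 3) k)}
    [Nontrivial (MvPolynomial (Fin 3) k ⧸ 𝔞)] :
    b j • prodY 𝔞 (Ideal.span {F₂}) j' - b j' • prodY 𝔞 (Ideal.span {F₂}) j ≠ 0 := by
  have h : b j • prodY 𝔞 (Ideal.span {F₂}) j' - b j' • prodY 𝔞 (Ideal.span {F₂}) j =
      prodInr _ _ (Ideal.Quotient.mk _ (b j • X j' - b j' • X j)) := by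
    change _ = prodInr _ _ (Ideal.Quotient.mkₐ k _ _)
    rw [map_sub, map_sub, map_smul, map_smul, map_smul, map_smul]
    rfl
  rw [h, map_ne_zero_iff _ prodInr_injective]
  refine hF₂.mk_ne_zero (fun h0 => hj ?_) (lt_of_le_of_lt (totalDegree_sub _ _) ?_)
  · have := congr_arg (coeff (Finsupp.single j' 1)) h0
    simpa [coeff_X, Finsupp.single_left_inj, hjj'] using this
  · exact lt_of_le_of_lt (max_le ((totalDegree_smul_le _ _).trans (totalDegree_X _).le)
      ((totalDegree_smul_le _ _).trans (totalDegree_X _).le)) (by norm_num)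

theorem exists_prodY_notMem (hF₁ : IsSmoothPlaneCubic F₁) (hF₂ : IsSmoothPlaneCubic F₂) {i : Fin 3}
    (P : Ideal (ChartRing F₁ F₂ i)) [P.IsPrime] (hP : P.height ≤ 1) :
    ∃ j, prodY (affineIdeal F₁ i) (Ideal.span {F₂}) j ∉ P := by
  by_contra! hmem
  refine hP.not_gt ?_
  have := hF₁.isDomain_affine i
  have := isDomain_chartRing hF₁ hF₂ i
  obtain ⟨b, hb0, hb⟩ := hF₂.exists_zero
  obtain ⟨j, hj⟩ := Function.ne_iff.mp hb0
  have hjj' : j ≠ j + 1 := by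
    clear hj
    revert j
    decide
  have hle (a : ChartRing F₁ F₂ i) (ha : lineHom F₁ hF₂ hb i a = 0) : a ∈ P := by
    refine Ideal.span_le.mpr ?_ (mem_span_of_lineHom_eq_zero hF₂ hb i ha)
    rintro _ ⟨j, rfl⟩
    exact hmem j
  have h1 : lineHom F₁ hF₂ hb i (prodY _ _ j) ≠ 0 := by
    rw [lineHom_prodY]
    exact mul_ne_zero Polynomial.X_ne_zero ((map_ne_zero_iff _ (algebraMap k _).injective).mpr hj)
  have h2 : lineHom F₁ hF₂ hb i (b j • prodY _ _ (j + 1) - b (j + 1) • prodY _ _ j) = 0 := by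
    rw [map_sub, map_smul, map_smul, lineHom_prodY, lineHom_prodY, Algebra.smul_def, Algebra.smul_def]
    ring
  exact one_lt_height_of_ker_lt (D := (MvPolynomial (Fin 3) k ⧸ affineIdeal F₁ i)[X])
    (lineHom F₁ hF₂ hb i) P hle (hmem j) h1 (linear_ne_zero hF₂ hj hjj') h2

theorem algHom_mk_of_coneZ_eq_zero {C : Type*} [CommRing C] [Algebra k C]
    (χ : coneRing F₁ F₂ →ₐ[k] C) (hχ : ∀ lj, χ (coneZ F₁ F₂ lj) = 0)
    (p : MvPolynomial (Fin 3 × Fin 3) k) :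
    χ (Ideal.Quotient.mk _ p) = algebraMap k C (constantCoeff p) := by
  have h : χ.comp (Ideal.Quotient.mkₐ k _) = aeval fun _ => (0 : C) := by
    ext lj
    rw [aeval_X]
    exact hχ lj
  exact congr($h p).trans (aeval_zero' p)

theorem exists_coneZ_notMem (hF₁ : IsSmoothPlaneCubic F₁) (hF₂ : IsSmoothPlaneCubic F₂)
    (P : Ideal (coneRing F₁ F₂)) [P.IsPrime] (hP : P.height ≤ 1) :
    ∃ i j, coneZ F₁ F₂ (i, j) ∉ P := by
  by_contra! hmem
  refine hP.not_gt ?_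
  have := hF₁.isDomain_affine 0
  have := isDomain_coneRing hF₁ hF₂
  obtain ⟨b, hb0, hb⟩ := hF₂.exists_zero
  obtain ⟨j, hj⟩ := Function.ne_iff.mp hb0
  have hjj' : j ≠ j + 1 := by
    clear hj
    revert j
    decide
  let φ := (lineHom F₁ hF₂ hb 0).comp (coneToChart hF₁ hF₂ 0)
  have hφ (l j : Fin 3) : φ (coneZ F₁ F₂ (l, j)) =
      Polynomial.C (Ideal.Quotient.mk (affineIdeal F₁ 0) (X l)) *
        (Polynomial.X * algebraMap k _ (b j)) := by
    change lineHom F₁ hF₂ hb 0 (coneToChart hF₁ hF₂ 0 _) = _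
    rw [coneToChart_coneZ, map_mul, lineHom_prodX, lineHom_prodY]
  have h1 : Ideal.Quotient.mk (affineIdeal F₁ 0) (X 0) = 1 := by
    rw [← sub_eq_zero, ← map_one (Ideal.Quotient.mk (affineIdeal F₁ 0)), ← map_sub]
    exact Ideal.Quotient.eq_zero_iff_mem.mpr (Ideal.subset_span (by simp))
  refine one_lt_height_of_ker_lt (D := (MvPolynomial (Fin 3) k ⧸ affineIdeal F₁ 0)[X])
    φ P ?_ (hmem 0 j) ?_
    (c := b j • coneZ F₁ F₂ (0, j + 1) - b (j + 1) • coneZ F₁ F₂ (0, j)) ?_ ?_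
  · intro r hr
    obtain ⟨p, rfl⟩ := Ideal.Quotient.mk_surjective r
    have h0 := algHom_mk_of_coneZ_eq_zero (((Polynomial.aeval
      (0 : MvPolynomial (Fin 3) k ⧸ affineIdeal F₁ 0)).restrictScalars k).comp φ) (fun ⟨l, j⟩ => by
        rw [AlgHom.comp_apply, hφ, map_mul, map_mul]
        change _ * (Polynomial.aeval 0 Polynomial.X * _) = 0
        rw [Polynomial.aeval_X, zero_mul, mul_zero]) p
    have hr' : φ (Ideal.Quotient.mk _ p) = 0 := hr
    rw [AlgHom.comp_apply, hr', map_zero, eq_comm,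
      map_eq_zero_iff _ (algebraMap k (MvPolynomial (Fin 3) k ⧸ affineIdeal F₁ 0)).injective] at h0
    have h1 := algHom_mk_of_coneZ_eq_zero (C := coneRing F₁ F₂ ⧸ P) (Ideal.Quotient.mkₐ k P) (fun ⟨l, j⟩ =>
      Ideal.Quotient.eq_zero_iff_mem.mpr (hmem l j)) p
    rw [h0, map_zero] at h1
    exact Ideal.Quotient.eq_zero_iff_mem.mp h1
  · change φ _ ≠ 0
    rw [hφ, h1, map_one, one_mul]
    exact mul_ne_zero Polynomial.X_ne_zero ((map_ne_zero_iff _ (algebraMap k _).injective).mpr hj)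
  · rw [← map_ne_zero_iff _ (coneToChart_injective hF₁ hF₂ 0), map_sub, map_smul, map_smul,
      coneToChart_coneZ, coneToChart_coneZ, prodX_self, one_mul, one_mul]
    exact linear_ne_zero hF₂ hj hjj'
  · change φ _ = 0
    rw [map_sub, map_smul, map_smul, hφ, hφ, Algebra.smul_def, Algebra.smul_def]
    ring

end ConeCharts
end EllipticCone
end

noncomputable section

namespace EllipticCone

section ConeSmooth

open MvPolynomial

set_option linter.unusedSectionVars false

theorem isLocalization_away_comp {R S : Type*} [CommRing R] [CommRing S] {φ : R →+* S}
    (hφ : Function.Injective φ) {r : R} (h : ∀ s, ∃ (n : ℕ) (a : R), φ r ^ n * s = φ a) :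
    @IsLocalization.Away R _ r (Localization.Away (φ r)) _
      ((algebraMap S (Localization.Away (φ r))).comp φ).toAlgebra := by
  let T := Localization.Away (φ r)
  let := ((algebraMap S T).comp φ).toAlgebra
  have hu : IsUnit (algebraMap S T (φ r)) := IsLocalization.Away.algebraMap_isUnit _
  refine ⟨?_, ?_, fun {a b} hab => ?_⟩
  · rintro ⟨_, n, rfl⟩
    change IsUnit (algebraMap S T (φ (r ^ n)))
    rw [map_pow, map_pow]
    exact hu.pow n
  · intro z
    obtain ⟨m, s, hs⟩ := IsLocalization.Away.surj (φ r) z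
    obtain ⟨n, a, ha⟩ := h s
    refine ⟨⟨a, ⟨r ^ (m + n), m + n, rfl⟩⟩, ?_⟩
    change z * algebraMap S T (φ (r ^ (m + n))) = algebraMap S T (φ a)
    rw [← ha, map_pow, map_pow, map_mul, map_pow, ← hs, pow_add]
    ring
  · obtain ⟨⟨_, n, rfl⟩, hc⟩ := IsLocalization.exists_of_eq (M := Submonoid.powers (φ r))
      (S := T) (show algebraMap S T (φ a) = algebraMap S T (φ b) from hab)
    refine ⟨⟨r ^ n, n, rfl⟩, hφ ?_⟩
    rw [map_mul, map_mul, map_pow]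
    exact hc

variable {k : Type u} [Field k] [IsAlgClosed k] {F₁ F₂ : MvPolynomial (Fin 3) k}

variable (F₁ F₂) in
/-- The complement of the zeros of this function on the cone is smooth. -/
def coneMinor (i j m n : Fin 3) : coneRing F₁ F₂ :=
  coneZ F₁ F₂ (i, j) * (aeval (fun l => coneZ F₁ F₂ (l, j)) (pderiv m F₁) *
    aeval (fun j' => coneZ F₁ F₂ (i, j')) (pderiv n F₂))

theorem coneToChart_aeval_left (hF₁ : IsSmoothPlaneCubic F₁) (hF₂ : IsSmoothPlaneCubic F₂)
    (i j : Fin 3) {G : MvPolynomial (Fin 3) k} {d : ℕ} (hG : G.IsHomogeneous d) :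
    coneToChart hF₁ hF₂ i (aeval (fun l => coneZ F₁ F₂ (l, j)) G) =
      prodY _ _ j ^ d * aeval (prodX _ _) G := by
  rw [comp_aeval_apply]
  simp_rw [coneToChart_coneZ, mul_comm (prodX _ _ _)]
  exact aeval_mul_of_isHomogeneous hG _ _

theorem coneToChart_aeval_right (hF₁ : IsSmoothPlaneCubic F₁) (hF₂ : IsSmoothPlaneCubic F₂)
    (i j : Fin 3) {G : MvPolynomial (Fin 3) k} {d : ℕ} (hG : G.IsHomogeneous d) :
    coneToChart hF₁ hF₂ i (aeval (fun l => coneZ F₁ F₂ (j, l)) G) =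
      prodX _ _ j ^ d * aeval (prodY _ _) G := by
  rw [comp_aeval_apply]
  simp_rw [coneToChart_coneZ]
  exact aeval_mul_of_isHomogeneous hG _ _

theorem coneToChart_coneMinor (hF₁ : IsSmoothPlaneCubic F₁) (hF₂ : IsSmoothPlaneCubic F₂)
    (i j m n : Fin 3) : coneToChart hF₁ hF₂ i (coneMinor F₁ F₂ i j m n) =
      chartJacobian F₁ F₂ i m n * prodY _ _ j ^ 3 := by
  rw [coneMinor, map_mul, map_mul, coneToChart_aeval_left hF₁ hF₂ i j hF₁.isHomogeneous.pderiv,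
    coneToChart_aeval_right hF₁ hF₂ i i hF₂.isHomogeneous.pderiv, coneToChart_coneZ, prodX_self,
    chartJacobian]
  ring

theorem aeval_coneZ_left (hF₁ : IsSmoothPlaneCubic F₁) (hF₂ : IsSmoothPlaneCubic F₂) (j : Fin 3) :
    aeval (fun l => coneZ F₁ F₂ (l, j)) F₁ = 0 := by
  refine (map_eq_zero_iff _ (coneToChart_injective hF₁ hF₂ 0)).mp ?_
  rw [coneToChart_aeval_left hF₁ hF₂ 0 j hF₁.isHomogeneous,
    aeval_prodX_eq_zero (Ideal.subset_span (by simp)), mul_zero]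

theorem aeval_coneZ_right (hF₁ : IsSmoothPlaneCubic F₁) (hF₂ : IsSmoothPlaneCubic F₂) (i : Fin 3) :
    aeval (fun j => coneZ F₁ F₂ (i, j)) F₂ = 0 := by
  refine (map_eq_zero_iff _ (coneToChart_injective hF₁ hF₂ 0)).mp ?_
  rw [coneToChart_aeval_right hF₁ hF₂ 0 i hF₂.isHomogeneous,
    aeval_prodY_eq_zero (Ideal.subset_span (by simp)), mul_zero]

theorem exists_coneMinor_notMem (hF₁ : IsSmoothPlaneCubic F₁) (hF₂ : IsSmoothPlaneCubic F₂)
    (P : Ideal (coneRing F₁ F₂)) [hP : P.IsPrime] {i j : Fin 3} (hij : coneZ F₁ F₂ (i, j) ∉ P) :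
    ∃ m n, m ≠ i ∧ coneMinor F₁ F₂ i j m n ∉ P := by
  obtain ⟨n, hn⟩ := hF₂.exists_pderiv_notMem (aeval_coneZ_right hF₁ hF₂ i) P (j := j) hij
  have h1 := aeval_coneZ_left hF₁ hF₂ j
  obtain ⟨m, hm, hmP⟩ : ∃ m, m ≠ i ∧ aeval (fun l => coneZ F₁ F₂ (l, j)) (pderiv m F₁) ∉ P := by
    obtain ⟨m, hm⟩ := hF₁.exists_pderiv_notMem h1 P (j := i) hij
    by_cases hmi : m = i
    · subst hmi
      by_contra! hcon
      have he := hF₁.euler h1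
      rw [sum_fin_three_cyclic _ m, add_assoc] at he
      have hne (c : Fin 3) (hc : c ≠ 0) : m + c ≠ m := by simpa using hc
      have : coneZ F₁ F₂ (m, j) * aeval (fun l => coneZ F₁ F₂ (l, j)) (pderiv m F₁) ∈ P := by
        rw [eq_neg_of_add_eq_zero_left he]
        exact P.neg_mem (P.add_mem (P.mul_mem_left _ (hcon _ (hne 1 (by decide))))
          (P.mul_mem_left _ (hcon _ (hne 2 (by decide)))))
      exact (hP.mem_or_mem this).elim hij hm
    · exact ⟨m, hmi, hm⟩
  exact ⟨m, n, hm, fun h => (hP.mem_or_mem h).elim hij fun h => (hP.mem_or_mem h).elim hmP hn⟩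

theorem exists_pow_mul_eq_coneToChart (hF₁ : IsSmoothPlaneCubic F₁) (hF₂ : IsSmoothPlaneCubic F₂)
    {i : Fin 3} (j m n : Fin 3) (s : ChartRing F₁ F₂ i) : ∃ (d : ℕ) (a : coneRing F₁ F₂),
      coneToChart hF₁ hF₂ i (coneMinor F₁ F₂ i j m n) ^ d * s = coneToChart hF₁ hF₂ i a := by
  set φ := coneToChart hF₁ hF₂ i
  set r := coneMinor F₁ F₂ i j m n with hr
  induction s using prodAlg_induction with
  | hC c => exact ⟨0, algebraMap k _ c, by rw [pow_zero, one_mul, φ.commutes]⟩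
  | hadd s s' h h' =>
    obtain ⟨d, a, ha⟩ := h
    obtain ⟨d', a', ha'⟩ := h'
    refine ⟨d + d', r ^ d' * a + r ^ d * a', ?_⟩
    rw [map_add, map_mul, map_mul, map_pow, map_pow, ← ha, ← ha']
    ring
  | hX s l h =>
    obtain ⟨d, a, ha⟩ := h
    refine ⟨d + 1, a * (coneZ F₁ F₂ (l, j) * (aeval (fun l => coneZ F₁ F₂ (l, j)) (pderiv m F₁) *
      aeval (fun j' => coneZ F₁ F₂ (i, j')) (pderiv n F₂))), ?_⟩
    have hz : φ (coneZ F₁ F₂ (l, j)) = prodX _ _ l * φ (coneZ F₁ F₂ (i, j)) := by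
      rw [coneToChart_coneZ, coneToChart_coneZ, prodX_self, one_mul]
    rw [map_mul, map_mul, hz, ← ha, pow_succ, hr, coneMinor, map_mul]
    ring
  | hY s j' h =>
    obtain ⟨d, a, ha⟩ := h
    refine ⟨d, a * coneZ F₁ F₂ (i, j'), ?_⟩
    rw [map_mul, coneToChart_coneZ, prodX_self, one_mul, ← ha, mul_assoc]

theorem isSmoothChart_coneMinor (hF₁ : IsSmoothPlaneCubic F₁) (hF₂ : IsSmoothPlaneCubic F₂)
    (i j : Fin 3) {m : Fin 3} (hm : m ≠ i) (n : Fin 3) :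
    IsSmoothChart hF₁ hF₂ (𝟙 (coneY F₁ F₂)) (Spec.map (CommRingCat.ofHom
      (coneToChartAway hF₁ hF₂ (coneToChart hF₁ hF₂ i (coneMinor F₁ F₂ i j m n))))) where
  isOpenImmersion := by
    let := (coneToChartAway hF₁ hF₂ (coneToChart hF₁ hF₂ i (coneMinor F₁ F₂ i j m n))).toAlgebra
    have : IsLocalization.Away (coneMinor F₁ F₂ i j m n) (Localization.Away
        (coneToChart hF₁ hF₂ i (coneMinor F₁ F₂ i j m n))) :=
      isLocalization_away_comp (φ := (coneToChart hF₁ hF₂ i).toRingHom)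
      (coneToChart_injective hF₁ hF₂ i) (exists_pow_mul_eq_coneToChart hF₁ hF₂ j m n)
    exact IsOpenImmersion.of_isLocalization (coneMinor F₁ F₂ i j m n)
  comp_eq := Category.comp_id _
  exists_dvd := ⟨m, n, hm, by
    rw [coneToChart_coneMinor]
    exact dvd_mul_right _ _⟩

theorem range_coneToChartAway (hF₁ : IsSmoothPlaneCubic F₁) (hF₂ : IsSmoothPlaneCubic F₂)
    (i j m n : Fin 3) (x : coneY F₁ F₂) (hx : coneMinor F₁ F₂ i j m n ∉ x.asIdeal) :
    x ∈ Set.range (Spec.map (CommRingCat.ofHom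
      (coneToChartAway hF₁ hF₂ (coneToChart hF₁ hF₂ i (coneMinor F₁ F₂ i j m n))))) := by
  let := (coneToChartAway hF₁ hF₂ (coneToChart hF₁ hF₂ i (coneMinor F₁ F₂ i j m n))).toAlgebra
  have : IsLocalization.Away (coneMinor F₁ F₂ i j m n) (Localization.Away
      (coneToChart hF₁ hF₂ i (coneMinor F₁ F₂ i j m n))) :=
    isLocalization_away_comp (φ := (coneToChart hF₁ hF₂ i).toRingHom)
    (coneToChart_injective hF₁ hF₂ i) (exists_pow_mul_eq_coneToChart hF₁ hF₂ j m n)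
  have h := PrimeSpectrum.localization_away_comap_range (Localization.Away
    (coneToChart hF₁ hF₂ i (coneMinor F₁ F₂ i j m n))) (coneMinor F₁ F₂ i j m n)
  have : x ∈ (PrimeSpectrum.basicOpen (coneMinor F₁ F₂ i j m n) : Set (PrimeSpectrum (coneRing F₁ F₂))) := hx
  rw [← h] at this
  exact this

theorem hasSmoothCharts_coneY (hF₁ : IsSmoothPlaneCubic F₁) (hF₂ : IsSmoothPlaneCubic F₂) :
    HasSmoothCharts hF₁ hF₂ (𝟙 (coneY F₁ F₂)) := by
  intro x hx
  have hP : x.asIdeal.IsPrime := x.2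
  obtain ⟨i, j, hij⟩ := exists_coneZ_notMem hF₁ hF₂ x.asIdeal
    ((idealHeight_eq_coheight (.of (coneRing F₁ F₂)) x).trans_le hx)
  obtain ⟨m, n, hm, hmn⟩ := exists_coneMinor_notMem hF₁ hF₂ x.asIdeal hij
  exact ⟨i, _, _, isSmoothChart_coneMinor hF₁ hF₂ i j hm n, range_coneToChartAway hF₁ hF₂ i j m n x hmn⟩

theorem isIntegral_coneY (hF₁ : IsSmoothPlaneCubic F₁) (hF₂ : IsSmoothPlaneCubic F₂) :
    IsIntegral (coneY F₁ F₂) := by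
  have := isDomain_coneRing hF₁ hF₂
  exact inferInstanceAs (IsIntegral (Spec (.of (coneRing F₁ F₂))))

end ConeSmooth
end EllipticCone
end

noncomputable section

namespace EllipticCone

/-! ### The affine charts of a blow-up -/

section BlowUpCharts

open HomogeneousLocalization

variable {R : Type u} [CommRing R] {I : Ideal R}

/-- The element of degree one of the Rees algebra given by an element of the ideal. -/
def reesGen {c : R} (hc : c ∈ I) : reesAlgebra I :=
  ⟨Polynomial.monomial 1 c, reesAlgebra.monomial_mem.mpr (by rwa [pow_one])⟩

theorem reesGen_mem {c : R} (hc : c ∈ I) : reesGen hc ∈ reesGrading I 1 :=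
  fun _ hi => Polynomial.coeff_monomial_of_ne _ hi

theorem eq_monomial_of_mem_reesGrading {x : reesAlgebra I} {n : ℕ} (hx : x ∈ reesGrading I n) :
    (x : R[X]) = Polynomial.monomial n ((x : R[X]).coeff n) := by
  ext m
  by_cases h : m = n
  · subst h
    simp
  · rw [hx m h, Polynomial.coeff_monomial_of_ne _ h]

theorem algebraMap_mem_reesGrading_zero (r : R) :
    algebraMap R (reesAlgebra I) r ∈ reesGrading I 0 := fun i hi => by
  change (Polynomial.C r).coeff i = 0
  rw [Polynomial.coeff_C, if_neg hi]

theorem adjoin_range_reesGen_eq_top {ι : Type*} {a : ι → R} (ha : ∀ l, a l ∈ I)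
    (hI : I ≤ Ideal.span (Set.range a)) :
    Algebra.adjoin (reesGrading I 0) (Set.range fun l => reesGen (ha l)) = ⊤ := by
  set B := Algebra.adjoin (reesGrading I 0) (Set.range fun l => reesGen (ha l))
  have hC (r : R) : algebraMap R (reesAlgebra I) r ∈ B :=
    B.algebraMap_mem ⟨_, algebraMap_mem_reesGrading_zero r⟩
  have hgen (r : R) (hr : r ∈ I) : reesGen hr ∈ B := by
    have key : ∀ r ∈ Ideal.span (Set.range a), ∃ b ∈ B, (b : R[X]) = Polynomial.monomial 1 r := by
      intro r hr
      induction hr using Submodule.span_induction with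
      | mem r hr =>
        obtain ⟨l, rfl⟩ := hr
        exact ⟨_, Algebra.subset_adjoin ⟨l, rfl⟩, rfl⟩
      | zero => exact ⟨0, zero_mem _, by simp⟩
      | add r s _ _ hr hs =>
        obtain ⟨b, hb, hbr⟩ := hr
        obtain ⟨c, hc, hcs⟩ := hs
        exact ⟨b + c, add_mem hb hc, by simp [hbr, hcs]⟩
      | smul t r _ hr =>
        obtain ⟨b, hb, hbr⟩ := hr
        refine ⟨algebraMap R (reesAlgebra I) t * b, mul_mem (hC t) hb, ?_⟩
        change Polynomial.C t * (b : R[X]) = _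
        rw [hbr, Polynomial.C_mul_monomial, smul_eq_mul]
    obtain ⟨b, hb, hbr⟩ := key r (hI hr)
    convert! hb
    exact Subtype.ext hbr.symm
  have key : ∀ p ∈ Algebra.adjoin R (Submodule.map (Polynomial.monomial 1) I : Set R[X]),
      ∃ b ∈ B, (b : R[X]) = p := by
    intro p hp
    induction hp using Algebra.adjoin_induction with
    | mem p hp =>
      obtain ⟨r, hr, rfl⟩ := hp
      exact ⟨_, hgen r hr, rfl⟩
    | algebraMap r => exact ⟨_, hC r, rfl⟩
    | add p q _ _ hp hq =>
      obtain ⟨b, hb, rfl⟩ := hp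
      obtain ⟨c, hc, rfl⟩ := hq
      exact ⟨b + c, add_mem hb hc, rfl⟩
    | mul p q _ _ hp hq =>
      obtain ⟨b, hb, rfl⟩ := hp
      obtain ⟨c, hc, rfl⟩ := hq
      exact ⟨b * c, mul_mem hb hc, rfl⟩
  rw [adjoin_monomial_eq_reesAlgebra] at key
  refine top_le_iff.mp fun x _ => ?_
  obtain ⟨b, hb, hbx⟩ := key x x.2
  rwa [← Subtype.ext hbx]

theorem exists_subring_mem_iff {A S L : Type*} [CommRing A] [CommRing S] [CommRing L] (Γ : A →+* L)
    (σ : S →+* L) : ∃ T : Subring S, ∀ s, s ∈ T ↔ ∃ a, Γ a = σ s :=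
  ⟨Γ.range.comap σ, fun _ => Iff.rfl⟩

theorem exists_ringEquiv_of_injective {A S L : Type*} [CommRing A] [CommRing S] [CommRing L]
    {Γ : A →+* L} {σ : S →+* L} (hΓ : Function.Injective Γ) (hσ : Function.Injective σ)
    (h : ∀ a, ∃ s, σ s = Γ a) (h' : ∀ s, ∃ a, Γ a = σ s) :
    ∃ e : A ≃+* S, ∀ a, σ (e a) = Γ a := by
  let e₁ : A ≃+* Γ.range :=
    RingEquiv.ofBijective Γ.rangeRestrict
      ⟨fun a b h => hΓ (congr_arg Subtype.val h), Γ.rangeRestrict_surjective⟩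
  let e₂ : S ≃+* σ.range :=
    RingEquiv.ofBijective σ.rangeRestrict
      ⟨fun a b h => hσ (congr_arg Subtype.val h), σ.rangeRestrict_surjective⟩
  have hrange : Γ.range = σ.range := by
    apply le_antisymm
    · rintro _ ⟨a, rfl⟩
      exact h a
    · rintro _ ⟨s, rfl⟩
      exact h' s
  refine ⟨(e₁.trans (RingEquiv.subringCongr hrange)).trans e₂.symm, fun a => ?_⟩
  exact congr_arg Subtype.val (e₂.apply_symm_apply (RingEquiv.subringCongr hrange (e₁ a)))

/-- The ring of the affine chart of a blow-up on which the element `c` generates the ideal. -/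
theorem exists_away_ringEquiv {S : Type u} [CommRing S] [IsDomain S] (L : Type u) [Field L]
    [Algebra S L] [IsFractionRing S L] (φ : R →+* S)
    (hφ : Function.Injective φ) {c : R} (hc : c ∈ I) (hc0 : φ c ≠ 0)
    (hI : ∀ r ∈ I, φ c ∣ φ r)
    (hS : ∀ T : Subring S, (∀ r, φ r ∈ T) → (∀ r ∈ I, ∀ s, φ r = φ c * s → s ∈ T) → ∀ s, s ∈ T) :
    ∃ e : Away (reesGrading I) (reesGen hc) ≃+* S, ∀ r,
      e (fromZeroRingHom (reesGrading I) _ (algebraMap R (reesGrading I 0) r)) = φ r := by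
  let σ : S →+* L := algebraMap S L
  have hσ : Function.Injective σ := IsFractionRing.injective S L
  have hσ0 : σ (φ c) ≠ 0 := (map_ne_zero_iff σ hσ).mpr hc0
  let f := reesGen hc
  let ψ : reesAlgebra I →+* L :=
    (Polynomial.eval₂RingHom (σ.comp φ) (σ (φ c))⁻¹).comp (reesAlgebra I).toSubring.subtype
  have hψ (x : reesAlgebra I) : ψ x = (x : R[X]).eval₂ (σ.comp φ) (σ (φ c))⁻¹ := rfl
  have hψm (x : reesAlgebra I) (n : ℕ) (r : R) (hx : (x : R[X]) = Polynomial.monomial n r) :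
      ψ x * σ (φ c) ^ n = σ (φ r) := by
    rw [hψ, hx, Polynomial.eval₂_monomial, mul_assoc, ← mul_pow, inv_mul_cancel₀ hσ0, one_pow,
      mul_one]
    rfl
  have hψf : ψ f = 1 := by
    have := hψm f 1 c rfl
    rw [pow_one] at this
    exact mul_right_cancel₀ hσ0 (this.trans (one_mul _).symm)
  have hu : IsUnit (ψ f) := hψf ▸ isUnit_one
  let Γ : Away (reesGrading I) f →+* L :=
    (IsLocalization.Away.lift f hu : Localization.Away f →+* L).comp
      (algebraMap (Away (reesGrading I) f) (Localization.Away f))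
  have hΓ (n : ℕ) (x : reesAlgebra I) (hx : x ∈ reesGrading I (n • 1)) :
      Γ (Away.mk (reesGrading I) (reesGen_mem hc) n x hx) = ψ x := by
    change IsLocalization.Away.lift f hu (Away.mk (reesGrading I) (reesGen_mem hc) n x hx).val = _
    rw [Away.val_mk, Localization.mk_eq_mk']
    have h1 := congr_arg (IsLocalization.Away.lift (S := Localization.Away f) f hu)
      (IsLocalization.mk'_spec (Localization.Away f) x (⟨f ^ n, n, rfl⟩ : Submonoid.powers f))
    rw [map_mul, IsLocalization.Away.lift_eq, IsLocalization.Away.lift_eq, map_pow, hψf, one_pow,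
      mul_one] at h1
    exact h1
  have hinj : Function.Injective Γ := by
    rw [injective_iff_map_eq_zero]
    intro z hz
    obtain ⟨n, x, hx, rfl⟩ := Away.mk_surjective (reesGrading I) (reesGen_mem hc) z
    rw [hΓ] at hz
    have hx1 := eq_monomial_of_mem_reesGrading hx
    have := hψm x _ _ hx1
    rw [hz, zero_mul, eq_comm, map_eq_zero_iff _ hσ, map_eq_zero_iff _ hφ] at this
    rw [this, map_zero] at hx1
    have hx0 : x = 0 := Subtype.ext hx1
    subst hx0
    apply HomogeneousLocalization.val_injective
    rw [Away.val_mk, Localization.mk_zero, HomogeneousLocalization.val_zero]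
  have hle (z) : ∃ s, σ s = Γ z := by
    obtain ⟨n, x, hx, rfl⟩ := Away.mk_surjective (reesGrading I) (reesGen_mem hc) z
    rw [hΓ]
    have hr := hψm x _ _ (eq_monomial_of_mem_reesGrading hx)
    have hrI := x.2 (n • 1)
    rw [smul_eq_mul, mul_one] at hr hrI
    have hle : Ideal.map φ I ≤ Ideal.span {φ c} := by
      rw [Ideal.map_le_iff_le_comap]
      exact fun r hr => Ideal.mem_span_singleton.mpr (hI r hr)
    have := Ideal.pow_right_mono hle n (by
      rw [← Ideal.map_pow]
      exact Ideal.mem_map_of_mem φ hrI)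
    rw [Ideal.span_singleton_pow, Ideal.mem_span_singleton] at this
    obtain ⟨s, hs⟩ := this
    refine ⟨s, mul_right_cancel₀ (pow_ne_zero n hσ0) ?_⟩
    rw [hr, hs, map_mul, map_pow, mul_comm]
  have hge (s) : ∃ z, Γ z = σ s := by
    obtain ⟨T, hT⟩ := exists_subring_mem_iff Γ σ
    refine (hT s).mp (hS T (fun r => (hT _).mpr ?_) (fun r hr s hrs => (hT _).mpr ?_) s)
    · refine ⟨Away.mk (reesGrading I) (reesGen_mem hc) 0 (algebraMap R _ r)
        (by simpa using algebraMap_mem_reesGrading_zero r), ?_⟩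
      rw [hΓ]
      have := hψm (algebraMap R _ r) 0 r rfl
      rwa [pow_zero, mul_one] at this
    · refine ⟨Away.mk (reesGrading I) (reesGen_mem hc) 1 (reesGen hr)
        (by simpa using reesGen_mem hr), ?_⟩
      rw [hΓ]
      have := hψm (reesGen hr) 1 r rfl
      rw [pow_one, hrs, map_mul, mul_comm] at this
      exact mul_left_cancel₀ hσ0 this
  obtain ⟨e, he⟩ := exists_ringEquiv_of_injective hinj hσ hle hge
  refine ⟨e, fun r => hσ ?_⟩
  rw [he]
  have h0 := hΓ 0 (algebraMap R _ r) (by simpa using algebraMap_mem_reesGrading_zero r)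
  have := hψm (algebraMap R _ r) 0 r rfl
  rw [pow_zero, mul_one] at this
  rw [← this, ← h0]
  congr 1

theorem isIrreducible_blowUp [IsDomain R] {c : R} (hc : c ∈ I) (hc0 : c ≠ 0) :
    IrreducibleSpace (blowUp I) := by
  let η : ProjectiveSpectrum (reesGrading I) := ⟨⊥, by
      change (⊥ : Ideal (reesAlgebra I)).IsPrime
      exact Ideal.isPrime_bot, fun h => hc0 (by
    have h1 : reesGen hc ∈ HomogeneousIdeal.irrelevant (reesGrading I) := by
      rw [HomogeneousIdeal.mem_irrelevant_iff, GradedRing.proj_apply,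
        DirectSum.decompose_of_mem_ne _ (reesGen_mem hc) one_ne_zero]
    have h2 : reesGen hc = 0 := h h1
    have h3 := congr_arg (fun x : reesAlgebra I => (x : R[X]).coeff 1) h2
    simpa [reesGen] using h3)⟩
  have hη : closure {η} = Set.univ := Set.eq_univ_of_forall fun x =>
    (ProjectiveSpectrum.le_iff_mem_closure _ η x).mp (show (⊥ : HomogeneousIdeal _) ≤ _ from bot_le)
  have hirr : IsIrreducible (Set.univ : Set (ProjectiveSpectrum (reesGrading I))) :=
    hη ▸ isIrreducible_singleton.closure
  have : IrreducibleSpace (ProjectiveSpectrum (reesGrading I)) := irreducibleSpace_def _ |>.mpr hirr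
  exact this

end BlowUpCharts
end EllipticCone
end

noncomputable section

namespace EllipticCone

/-! ### The blow-up of the cone -/

section BlowUpX

open MvPolynomial

set_option linter.unusedSectionVars false

variable {k : Type u} [Field k] [IsAlgClosed k] {F₁ F₂ ℓ : MvPolynomial (Fin 3) k}

theorem aeval_prodY_linear_ne_zero (hF₁ : IsSmoothPlaneCubic F₁) (hF₂ : IsSmoothPlaneCubic F₂)
    (hℓ : ℓ.IsHomogeneous 1) (hℓ0 : ℓ ≠ 0) (i : Fin 3) :
    aeval (prodY (affineIdeal F₁ i) (Ideal.span {F₂})) ℓ ≠ 0 := by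
  have := (hF₁.isDomain_affine i).toNontrivial
  rw [aeval_prodY, map_ne_zero_iff _ prodInr_injective]
  exact hF₂.mk_ne_zero hℓ0 (by rw [hℓ.totalDegree hℓ0]; norm_num)

theorem coneA_mem (hF₁ : IsSmoothPlaneCubic F₁) (hF₂ : IsSmoothPlaneCubic F₂)
    (hℓ : ℓ.IsHomogeneous 1) (hℓ0 : ℓ ≠ 0) (l : Fin 3) : coneA F₁ F₂ ℓ l ∈ idealZ F₁ F₂ ℓ := by
  rw [idealZ_eq hF₁ hF₂ hℓ hℓ0]
  exact Ideal.subset_span ⟨l, rfl⟩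

theorem coneToChart_coneA_self (hF₁ : IsSmoothPlaneCubic F₁) (hF₂ : IsSmoothPlaneCubic F₂)
    (hℓ : ℓ.IsHomogeneous 1) (i : Fin 3) :
    coneToChart hF₁ hF₂ i (coneA F₁ F₂ ℓ i) = aeval (prodY _ _) ℓ := by
  rw [coneToChart_coneA hF₁ hF₂ hℓ, prodX_self, one_mul]

theorem exists_chart_ringEquiv (hF₁ : IsSmoothPlaneCubic F₁) (hF₂ : IsSmoothPlaneCubic F₂)
    (hℓ : ℓ.IsHomogeneous 1) (hℓ0 : ℓ ≠ 0) (i : Fin 3) :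
    ∃ e : HomogeneousLocalization.Away (reesGrading (idealZ F₁ F₂ ℓ))
        (reesGen (coneA_mem hF₁ hF₂ hℓ hℓ0 i)) ≃+* ChartRing F₁ F₂ i, ∀ r,
      e (HomogeneousLocalization.fromZeroRingHom (reesGrading (idealZ F₁ F₂ ℓ)) _
        (algebraMap (coneRing F₁ F₂) (reesGrading (idealZ F₁ F₂ ℓ) 0) r)) =
          coneToChart hF₁ hF₂ i r := by
  have := isDomain_chartRing hF₁ hF₂ i
  have h0 := aeval_prodY_linear_ne_zero hF₁ hF₂ hℓ hℓ0 i
  have hA := coneToChart_coneA_self hF₁ hF₂ hℓ i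
  refine exists_away_ringEquiv (FractionRing (ChartRing F₁ F₂ i)) (coneToChart hF₁ hF₂ i).toRingHom
    (coneToChart_injective hF₁ hF₂ i) (coneA_mem hF₁ hF₂ hℓ hℓ0 i) (hA ▸ h0) ?_ ?_
  · intro r hr
    change coneToChart hF₁ hF₂ i _ ∣ coneToChart hF₁ hF₂ i r
    rw [idealZ_eq hF₁ hF₂ hℓ hℓ0] at hr
    rw [hA]
    induction hr using Submodule.span_induction with
    | mem r hr =>
      obtain ⟨l, rfl⟩ := hr
      rw [coneToChart_coneA hF₁ hF₂ hℓ]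
      exact dvd_mul_left _ _
    | zero => rw [map_zero]; exact dvd_zero _
    | add r s _ _ hr hs => rw [map_add]; exact dvd_add hr hs
    | smul t r _ hr => rw [smul_eq_mul, map_mul]; exact hr.mul_left _
  · intro T hT hT' s
    have hX (l) : prodX _ _ l ∈ T := hT' _ (coneA_mem hF₁ hF₂ hℓ hℓ0 l) _ (by
      change coneToChart hF₁ hF₂ i _ = coneToChart hF₁ hF₂ i _ * _
      rw [hA, coneToChart_coneA hF₁ hF₂ hℓ, mul_comm])
    have hY (j) : prodY _ _ j ∈ T := by
      have := hT (coneZ F₁ F₂ (i, j))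
      change coneToChart hF₁ hF₂ i _ ∈ T at this
      rwa [coneToChart_coneZ, prodX_self, one_mul] at this
    induction s using prodAlg_induction with
    | hC c =>
      have := hT (algebraMap k _ c)
      change coneToChart hF₁ hF₂ i _ ∈ T at this
      rwa [AlgHom.commutes] at this
    | hadd a b ha hb => exact add_mem ha hb
    | hX a l ha => exact mul_mem ha (hX l)
    | hY a j ha => exact mul_mem ha (hY j)

/-- The blow-up is covered by the spectra of the chart rings. -/
theorem exists_blowUpX_chart (hF₁ : IsSmoothPlaneCubic F₁) (hF₂ : IsSmoothPlaneCubic F₂)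
    (hℓ : ℓ.IsHomogeneous 1) (hℓ0 : ℓ ≠ 0) (x : blowUpX F₁ F₂ ℓ) :
    ∃ (i : Fin 3) (ι : Spec (.of (ChartRing F₁ F₂ i)) ⟶ blowUpX F₁ F₂ ℓ), IsOpenImmersion ι ∧
      ι ≫ blowDown F₁ F₂ ℓ = Spec.map (CommRingCat.ofHom (coneToChart hF₁ hF₂ i).toRingHom) ∧
      x ∈ Set.range ι := by
  let 𝒜 := reesGrading (idealZ F₁ F₂ ℓ)
  have hcov := Proj.iSup_basicOpen_eq_top' 𝒜 (fun l => reesGen (coneA_mem hF₁ hF₂ hℓ hℓ0 l))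
    (fun l => ⟨1, reesGen_mem _⟩) (adjoin_range_reesGen_eq_top (coneA_mem hF₁ hF₂ hℓ hℓ0)
      (idealZ_eq hF₁ hF₂ hℓ hℓ0).le)
  change (Proj 𝒜 : Type _) at x
  have hx : x ∈ ⨆ l, Proj.basicOpen 𝒜 (reesGen (coneA_mem hF₁ hF₂ hℓ hℓ0 l)) := by
    rw [hcov]
    trivial
  obtain ⟨i, hi⟩ := TopologicalSpace.Opens.mem_iSup.mp hx
  obtain ⟨e, he⟩ := exists_chart_ringEquiv hF₁ hF₂ hℓ hℓ0 i
  let α : Spec (.of (ChartRing F₁ F₂ i)) ⟶ Spec (.of (HomogeneousLocalization.Away 𝒜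
      (reesGen (coneA_mem hF₁ hF₂ hℓ hℓ0 i)))) := Spec.map e.toCommRingCatIso.hom
  let β := Proj.awayι 𝒜 _ (reesGen_mem (coneA_mem hF₁ hF₂ hℓ hℓ0 i)) one_pos
  refine ⟨i, α ≫ β, inferInstanceAs (IsOpenImmersion (α ≫ β)), ?_, ?_⟩
  · change (α ≫ β) ≫ Proj.toSpecZero 𝒜 ≫ Spec.map _ = _
    rw [Category.assoc, Proj.awayι_toSpecZero_assoc, ← Spec.map_comp, ← Spec.map_comp]
    congr 1
    exact CommRingCat.hom_ext (RingHom.ext he)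
  · have : x ∈ (α ≫ β).opensRange := by
      rw [Scheme.Hom.opensRange_comp_of_isIso, Proj.opensRange_awayι]
      exact hi
    exact this

theorem isLocallyNoetherian_blowUpX (hF₁ : IsSmoothPlaneCubic F₁) (hF₂ : IsSmoothPlaneCubic F₂)
    (hℓ : ℓ.IsHomogeneous 1) (hℓ0 : ℓ ≠ 0) : IsLocallyNoetherian (blowUpX F₁ F₂ ℓ) := by
  choose i ι hι _ hx using exists_blowUpX_chart hF₁ hF₂ hℓ hℓ0
  refine isLocallyNoetherian_of_affine_cover (S := fun x => ⟨ι x ''ᵁ ⊤, isAffineOpen_chart (ι x)⟩)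
    ?_ fun x => ?_
  · refine top_le_iff.mp fun x _ => TopologicalSpace.Opens.mem_iSup.mpr ⟨x, ?_⟩
    obtain ⟨y, hy⟩ := hx x
    exact ⟨y, trivial, hy⟩
  · have := (isGorCMRing_chartRing hF₁ hF₂ (i x)).2.1
    exact isNoetherianRing_of_ringEquiv (ChartRing F₁ F₂ (i x))
      (chartSections (ι x)).commRingCatIsoToRingEquiv

theorem exists_isLocalization_stalk_blowUpX (hF₁ : IsSmoothPlaneCubic F₁)
    (hF₂ : IsSmoothPlaneCubic F₂) (hℓ : ℓ.IsHomogeneous 1) (hℓ0 : ℓ ≠ 0) (x : blowUpX F₁ F₂ ℓ) :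
    ∃ (i : Fin 3) (P : Ideal (ChartRing F₁ F₂ i)) (_ : P.IsPrime)
      (_ : Algebra (ChartRing F₁ F₂ i) ((blowUpX F₁ F₂ ℓ).presheaf.stalk x)),
      IsLocalization.AtPrime ((blowUpX F₁ F₂ ℓ).presheaf.stalk x) P := by
  obtain ⟨i, ι, hι, -, ⟨y, hy⟩⟩ := exists_blowUpX_chart hF₁ hF₂ hℓ hℓ0 x
  obtain ⟨P, hP, h⟩ := exists_isLocalization_chartToStalk ι x ⟨y, trivial, hy⟩
  exact ⟨i, P, hP, _, h⟩

theorem isGorenstein_blowUpX (hF₁ : IsSmoothPlaneCubic F₁) (hF₂ : IsSmoothPlaneCubic F₂)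
    (hℓ : ℓ.IsHomogeneous 1) (hℓ0 : ℓ ≠ 0) : IsGorenstein (blowUpX F₁ F₂ ℓ) where
  isLocallyNoetherian := isLocallyNoetherian_blowUpX hF₁ hF₂ hℓ hℓ0
  stalk x := by
    obtain ⟨i, P, hP, _, h⟩ := exists_isLocalization_stalk_blowUpX hF₁ hF₂ hℓ hℓ0 x
    have hS := isGorCMRing_chartRing hF₁ hF₂ i
    have := hS.2.1
    exact isGorensteinLocalRing_atPrime hS.1 P _

theorem isCohenMacaulay_blowUpX (hF₁ : IsSmoothPlaneCubic F₁) (hF₂ : IsSmoothPlaneCubic F₂)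
    (hℓ : ℓ.IsHomogeneous 1) (hℓ0 : ℓ ≠ 0) : IsCohenMacaulay (blowUpX F₁ F₂ ℓ) where
  isLocallyNoetherian := isLocallyNoetherian_blowUpX hF₁ hF₂ hℓ hℓ0
  stalk x := by
    obtain ⟨i, P, hP, _, h⟩ := exists_isLocalization_stalk_blowUpX hF₁ hF₂ hℓ hℓ0 x
    exact (isGorCMRing_chartRing hF₁ hF₂ i).2.atPrime P _

theorem isIntegral_blowUpX (hF₁ : IsSmoothPlaneCubic F₁) (hF₂ : IsSmoothPlaneCubic F₂)
    (hℓ : ℓ.IsHomogeneous 1) (hℓ0 : ℓ ≠ 0) : IsIntegral (blowUpX F₁ F₂ ℓ) := by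
  have := isDomain_coneRing hF₁ hF₂
  have : IrreducibleSpace (blowUpX F₁ F₂ ℓ) := by
    refine isIrreducible_blowUp (coneA_mem hF₁ hF₂ hℓ hℓ0 0) fun h => ?_
    have h1 := coneToChart_coneA_self hF₁ hF₂ hℓ 0
    rw [h, map_zero] at h1
    exact aeval_prodY_linear_ne_zero hF₁ hF₂ hℓ hℓ0 0 h1.symm
  have (x : blowUpX F₁ F₂ ℓ) : _root_.IsReduced ((blowUpX F₁ F₂ ℓ).presheaf.stalk x) := by
    obtain ⟨i, P, hP, _, h⟩ := exists_isLocalization_stalk_blowUpX hF₁ hF₂ hℓ hℓ0 x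
    have := isDomain_chartRing hF₁ hF₂ i
    have : IsDomain ((blowUpX F₁ F₂ ℓ).presheaf.stalk x) :=
      IsLocalization.isDomain_of_le_nonZeroDivisors _ P.primeCompl_le_nonZeroDivisors
    infer_instance
  have := isReduced_of_isReduced_stalk (blowUpX F₁ F₂ ℓ)
  exact isIntegral_of_irreducibleSpace_of_isReduced _

theorem hasSmoothCharts_blowUpX (hF₁ : IsSmoothPlaneCubic F₁) (hF₂ : IsSmoothPlaneCubic F₂)
    (hℓ : ℓ.IsHomogeneous 1) (hℓ0 : ℓ ≠ 0) : HasSmoothCharts hF₁ hF₂ (blowDown F₁ F₂ ℓ) := by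
  intro x hx
  obtain ⟨i, ι, hι, hcomp, y, rfl⟩ := exists_blowUpX_chart hF₁ hF₂ hℓ hℓ0 x
  have hP : y.asIdeal.IsPrime := y.2
  obtain ⟨j, hj⟩ := exists_prodY_notMem hF₁ hF₂ y.asIdeal ((idealHeight_eq_coheight
    (.of (ChartRing F₁ F₂ i)) y).trans_le ((coheight_eq_of_isOpenImmersion ι).symm.trans_le hx))
  obtain ⟨m, n, hm, hmn⟩ := exists_coneMinor_notMem hF₁ hF₂
    (y.asIdeal.comap (coneToChart hF₁ hF₂ i)) (i := i) (j := j) (by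
      rw [Ideal.mem_comap, coneToChart_coneZ, prodX_self, one_mul]
      exact hj)
  let t := coneToChart hF₁ hF₂ i (coneMinor F₁ F₂ i j m n)
  let α : Spec (.of (Localization.Away t)) ⟶ Spec (.of (ChartRing F₁ F₂ i)) :=
    Spec.map (CommRingCat.ofHom (algebraMap (ChartRing F₁ F₂ i) (Localization.Away t)))
  refine ⟨i, t, α ≫ ι, ⟨inferInstance, ?_, m, n, hm, ?_⟩, ?_⟩
  · rw [Category.assoc, hcomp]
    exact (Spec.map_comp _ _).symm
  · change _ ∣ coneToChart hF₁ hF₂ i (coneMinor F₁ F₂ i j m n)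
    rw [coneToChart_coneMinor]
    exact dvd_mul_right _ _
  · have h := PrimeSpectrum.localization_away_comap_range (Localization.Away t) t
    have hy : y ∈ (PrimeSpectrum.basicOpen t : Set (PrimeSpectrum (ChartRing F₁ F₂ i))) := hmn
    rw [← h] at hy
    obtain ⟨z, hz⟩ := hy
    exact ⟨z, (Scheme.Hom.comp_apply _ _ _).trans (congrArg ι hz)⟩

end BlowUpX
end EllipticCone
end

/-- Let `E₁ = V(F₁)` and `E₂ = V(F₂)` be smooth cubics in `ℙ²` over an algebraically closed field
`k`, `H ⊆ E₂` the hyperplane section by a line `ℓ = 0`, `Y = C(E₁ × E₂)`, `Z = C(E₁ × H)` and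
`f : X ⟶ Y` the blow-up of `Y` along `Z`. Then `X` and `Y` are smooth in codimension `1` with
trivial canonical divisor, and `X` is Gorenstein and Cohen–Macaulay. -/
theorem elliptic_cone_blowup_Gorenstein (k : Type u) [Field k] [IsAlgClosed k]
    (F₁ F₂ ℓ : MvPolynomial (Fin 3) k)
    (hF₁ : EllipticCone.IsSmoothPlaneCubic F₁) (hF₂ : EllipticCone.IsSmoothPlaneCubic F₂)
    (hℓ : ℓ.IsHomogeneous 1) (hℓ0 : ℓ ≠ 0) :
    EllipticCone.SmoothInCodimOne (EllipticCone.blowUpX.toSpec F₁ F₂ ℓ) ∧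
    EllipticCone.SmoothInCodimOne (EllipticCone.coneY.toSpec F₁ F₂) ∧
    EllipticCone.HasTrivialCanonicalDivisor (EllipticCone.blowUpX.toSpec F₁ F₂ ℓ) ∧
    EllipticCone.HasTrivialCanonicalDivisor (EllipticCone.coneY.toSpec F₁ F₂) ∧
    EllipticCone.IsGorenstein (EllipticCone.blowUpX F₁ F₂ ℓ) ∧
    EllipticCone.IsCohenMacaulay (EllipticCone.blowUpX F₁ F₂ ℓ) := by
  have := EllipticCone.isIntegral_blowUpX hF₁ hF₂ hℓ hℓ0
  have := EllipticCone.isIntegral_coneY hF₁ hF₂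
  have hX := EllipticCone.hasSmoothCharts_blowUpX hF₁ hF₂ hℓ hℓ0
  have hY := EllipticCone.hasSmoothCharts_coneY hF₁ hF₂
  refine ⟨hX.smoothInCodimOne, ?_, hX.hasTrivialCanonicalDivisor, ?_,
    EllipticCone.isGorenstein_blowUpX hF₁ hF₂ hℓ hℓ0,
    EllipticCone.isCohenMacaulay_blowUpX hF₁ hF₂ hℓ hℓ0⟩
  · simpa only [Category.id_comp] using hY.smoothInCodimOne
  · simpa only [Category.id_comp] using hY.hasTrivialCanonicalDivisor
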